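/- For every integer d ≥ 1 there exists a constant c(d) > 0 with the following property: for every function f : [0,1]^d → [0,1] that is 1-Lipschitz with respect to the sup norm, and every ε ∈ (0,1), there exist an integer N with N ≤ c(d) · ε^{−d}, real numbers a_1, …, a_N, b_1, …, b_N, and vectors w_1, …, w_N ∈ ℝ^d such that sup_{x ∈ [0,1]^d} |f(x) − Σ_{k=1}^N a_k · max(0, ⟨w_k, x⟩ + b_k)| < ε. -/

import Mathlib

open Finset

/-- `P` traces out no shattered set of more than `D` points. -/
def TraceDimLE {X ι : Type*} [DecidableEq ι] (P : X → Finset ι) (D : ℕ) : Prop :=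
  ∀ T : Finset ι, (∀ t ⊆ T, ∃ x, T ∩ P x = t) → #T ≤ D

theorem sum_min_edges_le {κ : Type*} [DecidableEq κ] (G : Finset κ) :
    ∀ (D : ℕ) (w : Finset κ → ℕ),
      (∀ T ⊆ G, (∀ t ⊆ T, ∃ Q ⊆ G, w Q ≠ 0 ∧ T ∩ Q = t) → #T ≤ D) →
      ∑ Q ∈ G.powerset, ∑ i ∈ G \ Q, min (w Q) (w (insert i Q)) ≤ D * ∑ Q ∈ G.powerset, w Q := by
  induction G using Finset.induction_on with
  | empty => intro D w _; simp
  | insert a G ha ih =>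
    intro D w hw
    set u : Finset κ → ℕ := fun Q => max (w Q) (w (insert a Q)) with hu
    set v : Finset κ → ℕ := fun Q => min (w Q) (w (insert a Q)) with hv
    have hsplit : ∑ Q ∈ (insert a G).powerset, ∑ i ∈ insert a G \ Q, min (w Q) (w (insert i Q))
        ≤ ∑ Q ∈ G.powerset, v Q + (∑ Q ∈ G.powerset, ∑ i ∈ G \ Q, min (u Q) (u (insert i Q))
          + ∑ Q ∈ G.powerset, ∑ i ∈ G \ Q, min (v Q) (v (insert i Q))) := by
      rw [Finset.sum_powerset_insert ha, ← sum_add_distrib, ← sum_add_distrib, ← sum_add_distrib]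
      refine sum_le_sum fun Q hQ => ?_
      have hQG := mem_powerset.1 hQ
      have haQ : a ∉ Q := fun h => ha (hQG h)
      have h1 : insert a G \ Q = insert a (G \ Q) := by
        ext x; simp only [mem_sdiff, mem_insert]; grind
      have h2 : insert a G \ insert a Q = G \ Q := by
        ext x; simp only [mem_sdiff, mem_insert]; grind
      rw [h1, h2, sum_insert (by simp [ha]), ← sum_add_distrib, add_assoc, ← sum_add_distrib]
      refine add_le_add le_rfl (sum_le_sum fun i _ => ?_)
      simp only [hu, hv, Finset.insert_comm i a Q]
      omega
    have hsum : ∑ Q ∈ (insert a G).powerset, w Q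
        = ∑ Q ∈ G.powerset, u Q + ∑ Q ∈ G.powerset, v Q := by
      rw [Finset.sum_powerset_insert ha, ← sum_add_distrib, ← sum_add_distrib]
      refine sum_congr rfl fun Q _ => ?_
      simp only [hu, hv]; omega
    have hU : ∑ Q ∈ G.powerset, ∑ i ∈ G \ Q, min (u Q) (u (insert i Q))
        ≤ D * ∑ Q ∈ G.powerset, u Q := by
      refine ih D u fun T hT hsh => hw T (hT.trans (subset_insert _ _)) fun t ht => ?_
      obtain ⟨Q, hQ, hne, hTQ⟩ := hsh t ht
      have haT : a ∉ T := fun h => ha (hT h)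
      by_cases h0 : w Q = 0
      · refine ⟨insert a Q, insert_subset_insert _ hQ, ?_, ?_⟩
        · intro h; apply hne; simp [hu, h0, h]
        · rw [inter_insert_of_notMem haT, hTQ]
      · exact ⟨Q, hQ.trans (subset_insert _ _), h0, hTQ⟩
    have hshV : ∀ T ⊆ G, (∀ t ⊆ T, ∃ Q ⊆ G, v Q ≠ 0 ∧ T ∩ Q = t) → #T + 1 ≤ D := by
      intro T hT hsh
      have haT : a ∉ T := fun h => ha (hT h)
      rw [← card_insert_of_notMem haT]
      refine hw _ (insert_subset_insert _ hT) fun t ht => ?_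
      obtain ⟨Q, hQ, hne, hTQ⟩ := hsh (t.erase a) (by
        intro x hx; have := ht (mem_of_mem_erase hx)
        exact (mem_insert.1 this).resolve_left (ne_of_mem_erase hx))
      have haQ : a ∉ Q := fun h => ha (hQ h)
      have hne' : w Q ≠ 0 ∧ w (insert a Q) ≠ 0 := by
        simp only [hv] at hne; omega
      by_cases hat : a ∈ t
      · refine ⟨insert a Q, insert_subset_insert _ hQ, hne'.2, ?_⟩
        rw [← insert_inter_distrib, hTQ, insert_erase hat]
      · refine ⟨Q, hQ.trans (subset_insert _ _), hne'.1, ?_⟩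
        rw [insert_inter_of_notMem haQ, hTQ, erase_eq_of_notMem hat]
    have hV : ∑ Q ∈ G.powerset, v Q + ∑ Q ∈ G.powerset, ∑ i ∈ G \ Q, min (v Q) (v (insert i Q))
        ≤ D * ∑ Q ∈ G.powerset, v Q := by
      cases D with
      | zero =>
        have hv0 : ∀ Q ∈ G.powerset, v Q = 0 := by
          intro Q hQ
          by_contra hne
          have := hshV ∅ (empty_subset _) (fun t ht => ⟨Q, mem_powerset.1 hQ, hne, by
            rw [subset_empty.1 ht, empty_inter]⟩)
          omega
        have : ∑ Q ∈ G.powerset, v Q = 0 := sum_eq_zero hv0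
        rw [this, zero_add, mul_zero, Nat.le_zero]
        exact sum_eq_zero fun Q hQ => sum_eq_zero fun i _ => by rw [hv0 Q hQ, Nat.zero_min]
      | succ D =>
        have := ih D v fun T hT hsh => by have := hshV T hT hsh; omega
        rw [Nat.succ_mul]; omega
    rw [hsum, mul_add]
    omega

/-- The trace of the sampled sets `A i` on the point `x`. -/
def sampleTrace {X ι : Type*} [DecidableEq ι] {s : ℕ} (P : X → Finset ι) (A : Fin s → ι) (x : X) :
    Finset (Fin s) := univ.filter fun i => A i ∈ P x

theorem TraceDimLE.sampleTrace {X ι : Type*} [DecidableEq ι] {P : X → Finset ι} {D s : ℕ}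
    (hP : TraceDimLE P D) (A : Fin s → ι) : TraceDimLE (sampleTrace P A) D := by
  intro T hT
  have hinj : Set.InjOn A T := by
    intro i hi j hj hij
    by_contra hne
    obtain ⟨x, hx⟩ := hT {i} (by simpa using hi)
    have h1 : i ∈ T ∩ _root_.sampleTrace P A x := by rw [hx]; simp
    have h2 : j ∉ T ∩ _root_.sampleTrace P A x := by rw [hx]; simpa using Ne.symm hne
    simp only [_root_.sampleTrace, mem_inter, mem_filter, mem_univ, true_and] at h1 h2
    exact h2 ⟨hj, hij ▸ h1.2⟩
  rw [← card_image_of_injOn hinj]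
  refine hP _ fun t ht => ?_
  obtain ⟨x, hx⟩ := hT (T.filter fun i => A i ∈ t) (filter_subset _ _)
  refine ⟨x, ?_⟩
  ext k
  constructor
  · intro hk
    obtain ⟨hk1, hk2⟩ := mem_inter.1 hk
    obtain ⟨i, hi, rfl⟩ := mem_image.1 hk1
    have : i ∈ T ∩ _root_.sampleTrace P A x := by simp [_root_.sampleTrace, hi, hk2]
    rw [hx] at this
    exact (mem_filter.1 this).2
  · intro hk
    obtain ⟨i, hi, rfl⟩ := mem_image.1 (ht hk)
    have : i ∈ T ∩ _root_.sampleTrace P A x := by rw [hx]; simp [hi, hk]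
    simp only [_root_.sampleTrace, mem_inter, mem_filter, mem_univ, true_and] at this
    exact mem_inter.2 ⟨ht hk, this.2⟩

theorem sum_choose_Iic_le (s D : ℕ) : ∑ k ∈ Iic D, s.choose k ≤ (s + 1) ^ D := by
  have : (s + 1) ^ D = ∑ k ∈ range (D + 1), s ^ k * D.choose k := by
    rw [add_pow]; simp
  rw [this, ← Nat.range_succ_eq_Iic]
  refine sum_le_sum fun k hk => ?_
  have hk' : k ≤ D := by have := mem_range.1 hk; omega
  calc s.choose k ≤ s ^ k := Nat.choose_le_pow s k
    _ ≤ s ^ k * D.choose k := Nat.le_mul_of_pos_right _ (Nat.choose_pos hk')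

theorem TraceDimLE.card_image_le {X : Type*} [DecidableEq X] {s D : ℕ} {P : X → Finset (Fin s)}
    (hP : TraceDimLE P D) (S : Finset X) : #(S.image P) ≤ (s + 1) ^ D := by
  have hvc : (S.image P).vcDim ≤ D := by
    refine Finset.sup_le fun T hT => hP T fun t ht => ?_
    obtain ⟨u, hu, htu⟩ := (mem_shatterer.1 hT) ht
    obtain ⟨x, _, rfl⟩ := mem_image.1 hu
    exact ⟨x, htu⟩
  calc #(S.image P) ≤ #(S.image P).shatterer := card_le_card_shatterer _
    _ ≤ ∑ k ∈ Iic (S.image P).vcDim, (Fintype.card (Fin s)).choose k := card_shatterer_le_sum_vcDim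
    _ ≤ ∑ k ∈ Iic D, s.choose k := by
        rw [Fintype.card_fin]
        exact sum_le_sum_of_subset (Iic_subset_Iic.2 hvc)
    _ ≤ _ := sum_choose_Iic_le s D

theorem sum_sum_update {ι κ : Type*} [Fintype ι] [Fintype κ] [DecidableEq κ] (i : κ)
    (F : (κ → ι) → ℝ) :
    ∑ A : κ → ι, ∑ a : ι, F (Function.update A i a) = Fintype.card ι * ∑ A, F A := by
  rw [← Fintype.sum_prod_type' (f := fun A a => F (Function.update A i a))]
  let e : (κ → ι) × ι ≃ (κ → ι) × ι :=
    { toFun := fun p => (Function.update p.1 i p.2, p.1 i)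
      invFun := fun p => (Function.update p.1 i p.2, p.1 i)
      left_inv := fun p => by simp
      right_inv := fun p => by simp }
  rw [Fintype.sum_equiv e (fun p => F (Function.update p.1 i p.2)) (fun p => F p.1)
    (fun p => rfl), Fintype.sum_prod_type, mul_sum]
  simp

/-- Two counts of a class `S`, split by membership of a random element, have large minimum. -/
theorem card_sub_one_mul_le_sum_min {X ι : Type*} [DecidableEq X] [DecidableEq ι] [Fintype ι]
    (P : X → Finset ι) (S : Finset X) {Δ : ℝ}
    (hsep : ∀ x ∈ S, ∀ y ∈ S, x ≠ y → Δ ≤ #(P x \ P y) + #(P y \ P x)) (hS : S.Nonempty) :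
    ((#S : ℝ) - 1) * Δ ≤
      2 * ∑ a : ι, ((min #(S.filter fun x => a ∉ P x) #(S.filter fun x => a ∈ P x) : ℕ) : ℝ) := by
  have hcount : ∑ a : ι, ((#(S.filter fun x => a ∈ P x) : ℝ) * #(S.filter fun x => a ∉ P x))
      = ∑ x ∈ S, ∑ y ∈ S, (#(P x \ P y) : ℝ) := by
    have h1 : ∀ x y, (#(P x \ P y) : ℝ)
        = ∑ a : ι, (if a ∈ P x then 1 else 0) * (if a ∉ P y then 1 else 0) := by
      intro x y
      have : P x \ P y = univ.filter fun a => a ∈ P x ∧ a ∉ P y := by ext; simp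
      rw [this, ← sum_boole]
      refine sum_congr rfl fun a _ => ?_
      by_cases h : a ∈ P x <;> by_cases h' : a ∈ P y <;> simp [h, h']
    simp_rw [h1]
    calc _ = ∑ a : ι, ∑ x ∈ S, ∑ y ∈ S,
          (if a ∈ P x then (1:ℝ) else 0) * (if a ∉ P y then 1 else 0) := by
          refine sum_congr rfl fun a _ => ?_
          rw [← sum_mul_sum, sum_boole, sum_boole]
      _ = ∑ x ∈ S, ∑ a : ι, ∑ y ∈ S, _ := sum_comm
      _ = _ := sum_congr rfl fun x _ => sum_comm
  have hlow : (#S : ℝ) * (#S - 1) * Δ ≤ 2 * ∑ x ∈ S, ∑ y ∈ S, (#(P x \ P y) : ℝ) := by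
    have hsym : ∑ x ∈ S, ∑ y ∈ S, (#(P y \ P x) : ℝ) = ∑ x ∈ S, ∑ y ∈ S, (#(P x \ P y) : ℝ) :=
      sum_comm
    have : 2 * ∑ x ∈ S, ∑ y ∈ S, (#(P x \ P y) : ℝ)
        = ∑ x ∈ S, ∑ y ∈ S, ((#(P x \ P y) : ℝ) + #(P y \ P x)) := by
      simp_rw [sum_add_distrib]; rw [hsym]; ring
    rw [this]
    calc (#S : ℝ) * (#S - 1) * Δ = ∑ x ∈ S, ∑ y ∈ S.erase x, Δ := by
          rw [sum_congr rfl (g := fun _ => ((#S:ℝ) - 1) * Δ)]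
          · rw [sum_const, nsmul_eq_mul]; ring
          · intro x hx
            rw [sum_const, card_erase_of_mem hx, nsmul_eq_mul,
              Nat.cast_sub (card_pos.2 ⟨x, hx⟩)]; simp
      _ ≤ ∑ x ∈ S, ∑ y ∈ S.erase x, ((#(P x \ P y) : ℝ) + #(P y \ P x)) :=
          sum_le_sum fun x hx => sum_le_sum fun y hy =>
            hsep x hx y (mem_of_mem_erase hy) (ne_of_mem_erase hy).symm
      _ ≤ _ := sum_le_sum fun x hx =>
          sum_le_sum_of_subset_of_nonneg (erase_subset _ _) fun _ _ _ => by positivity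
  have hmin : ∑ a : ι, ((#(S.filter fun x => a ∈ P x) : ℝ) * #(S.filter fun x => a ∉ P x))
      ≤ #S * ∑ a : ι,
        ((min #(S.filter fun x => a ∉ P x) #(S.filter fun x => a ∈ P x) : ℕ) : ℝ) := by
    push_cast
    rw [mul_sum]
    refine sum_le_sum fun a _ => ?_
    have hb : (#(S.filter fun x => a ∈ P x) : ℝ) + #(S.filter fun x => a ∉ P x) = #S := by
      exact_mod_cast card_filter_add_card_filter_not (s := S) (fun x => a ∈ P x)
    set p := (#(S.filter fun x => a ∈ P x) : ℝ)
    set q := (#(S.filter fun x => a ∉ P x) : ℝ)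
    have hp : 0 ≤ p := Nat.cast_nonneg _
    have hq : 0 ≤ q := Nat.cast_nonneg _
    rcases le_total p q with h | h
    · rw [min_eq_right h, ← hb]; nlinarith
    · rw [min_eq_left h, ← hb]; nlinarith
  have hSpos : (0:ℝ) < #S := by exact_mod_cast card_pos.2 hS
  rw [hcount] at hmin
  refine le_of_mul_le_mul_left ?_ hSpos
  linarith

theorem sub_mul_le_sum_resample {X ι : Type*} [DecidableEq X] [DecidableEq ι] [Fintype ι]
    {P : X → Finset ι} {D s : ℕ} (hP : TraceDimLE P D) (S : Finset X) {Δ : ℝ} (hΔ : 0 ≤ Δ)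
    (hsep : ∀ x ∈ S, ∀ y ∈ S, x ≠ y → Δ ≤ #(P x \ P y) + #(P y \ P x))
    (A : Fin s → ι) (i : Fin s) :
    ((#S : ℝ) - (s + 1) ^ D) * Δ ≤ 2 * ∑ a : ι,
      ∑ Q ∈ (univ : Finset (Finset (Fin s))).filter (i ∉ ·),
        ((min #(S.filter fun x => sampleTrace P (Function.update A i a) x = Q)
          #(S.filter fun x => sampleTrace P (Function.update A i a) x = insert i Q) : ℕ) : ℝ) := by
  set q : X → Finset (Fin s) := fun x => (sampleTrace P A x).erase i with hq
  have hmem : ∀ a x j, j ∈ sampleTrace P (Function.update A i a) x ↔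
      (j = i ∧ a ∈ P x) ∨ j ∈ q x := by
    intro a x j
    by_cases hj : j = i
    · subst hj; simp [sampleTrace, hq]
    · simp [sampleTrace, hq, hj]
  have hiq : ∀ x, i ∉ q x := fun x => by simp [hq]
  have h0 : ∀ a x Q, i ∉ Q → (sampleTrace P (Function.update A i a) x = Q ↔ q x = Q ∧ a ∉ P x) := by
    intro a x Q hQ
    constructor
    · rintro rfl
      have hax : a ∉ P x := fun h => hQ ((hmem a x i).2 (Or.inl ⟨rfl, h⟩))
      refine ⟨?_, hax⟩
      ext j; rw [hmem]; simp [hax]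
    · rintro ⟨rfl, hax⟩
      ext j; rw [hmem]; simp [hax]
  have h1 : ∀ a x Q, i ∉ Q →
      (sampleTrace P (Function.update A i a) x = insert i Q ↔ q x = Q ∧ a ∈ P x) := by
    intro a x Q hQ
    constructor
    · intro h
      have hax : a ∈ P x := by
        have : i ∈ sampleTrace P (Function.update A i a) x := by rw [h]; simp
        rcases (hmem a x i).1 this with h' | h'
        · exact h'.2
        · exact absurd h' (hiq x)
      refine ⟨?_, hax⟩
      ext j
      have := hmem a x j
      rw [h, mem_insert] at this
      have hiq := hiq x
      grind
    · rintro ⟨rfl, hax⟩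
      ext j; rw [hmem, mem_insert]; simp [hax]
  have himg : (#(S.image q) : ℝ) ≤ (s + 1) ^ D := by
    have : S.image q = (S.image (sampleTrace P A)).image fun Q => Q.erase i := by
      rw [image_image]; rfl
    have h2 : #(S.image q) ≤ (s + 1) ^ D := by
      rw [this]; exact card_image_le.trans ((hP.sampleTrace A).card_image_le S)
    exact_mod_cast h2
  have hcard : (#S : ℝ) = ∑ Q ∈ S.image q, (#(S.filter fun x => q x = Q) : ℝ) := by
    exact_mod_cast card_eq_sum_card_image q S
  calc ((#S : ℝ) - (s + 1) ^ D) * Δ ≤ ((#S : ℝ) - #(S.image q)) * Δ := by gcongr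
    _ = ∑ Q ∈ S.image q, ((#(S.filter fun x => q x = Q) : ℝ) - 1) * Δ := by
        rw [← sum_mul, sum_sub_distrib, ← hcard]; simp
    _ ≤ ∑ Q ∈ S.image q, 2 * ∑ a : ι,
        ((min #((S.filter fun x => q x = Q).filter fun x => a ∉ P x)
          #((S.filter fun x => q x = Q).filter fun x => a ∈ P x) : ℕ) : ℝ) := by
        refine sum_le_sum fun Q hQ => card_sub_one_mul_le_sum_min P _ ?_ ?_
        · exact fun x hx y hy => hsep x (mem_filter.1 hx).1 y (mem_filter.1 hy).1
        · obtain ⟨x, hx, rfl⟩ := mem_image.1 hQ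
          exact ⟨x, by simp [hx]⟩
    _ = 2 * ∑ a : ι, ∑ Q ∈ S.image q,
        ((min #(S.filter fun x => sampleTrace P (Function.update A i a) x = Q)
          #(S.filter fun x => sampleTrace P (Function.update A i a) x = insert i Q) : ℕ) : ℝ) := by
        rw [← mul_sum, sum_comm]
        push_cast
        congr 1
        refine sum_congr rfl fun a _ => sum_congr rfl fun Q hQ => ?_
        have hiQ : i ∉ Q := by
          obtain ⟨x, hx, rfl⟩ := mem_image.1 hQ
          exact hiq x
        simp_rw [filter_filter, h0 a _ Q hiQ, h1 a _ Q hiQ]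
    _ ≤ _ := by
        push_cast
        refine mul_le_mul_of_nonneg_left (sum_le_sum fun a _ =>
          sum_le_sum_of_subset_of_nonneg ?_ fun _ _ _ => by positivity) zero_le_two
        intro Q hQ
        obtain ⟨x, hx, rfl⟩ := mem_image.1 hQ
        simp [hiq x]

theorem card_mul_le_of_separated {X ι : Type*} [DecidableEq X] [DecidableEq ι] [Fintype ι]
    [Nonempty ι] {P : X → Finset ι} {D : ℕ} (hP : TraceDimLE P D) (S : Finset X) {Δ : ℝ}
    (hΔ : 0 ≤ Δ) (hsep : ∀ x ∈ S, ∀ y ∈ S, x ≠ y → Δ ≤ #(P x \ P y) + #(P y \ P x)) (s : ℕ) :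
    s * Δ * ((#S : ℝ) - (s + 1) ^ D) ≤ 2 * Fintype.card ι * D * #S := by
  set M : ℝ := ((Fintype.card ι : ℕ) : ℝ) with hM
  have hMpos : 0 < M := by rw [hM]; exact_mod_cast Fintype.card_pos
  let w : (Fin s → ι) → Finset (Fin s) → ℕ := fun A Q => #(S.filter fun x => sampleTrace P A x = Q)
  let F : Fin s → (Fin s → ι) → ℝ := fun i A =>
    ∑ Q ∈ (univ : Finset (Finset (Fin s))).filter (i ∉ ·),
      ((min (w A Q) (w A (insert i Q)) : ℕ) : ℝ)
  have hup : ∀ A, ∑ i, F i A ≤ D * #S := by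
    intro A
    have hedge := sum_min_edges_le (univ : Finset (Fin s)) D (w A) (by
      intro T _ hsh
      refine hP.sampleTrace A T fun t ht => ?_
      obtain ⟨Q, _, hne, hTQ⟩ := hsh t ht
      obtain ⟨x, hx⟩ := card_ne_zero.1 hne
      exact ⟨x, by rw [(mem_filter.1 hx).2, hTQ]⟩)
    have hsum : ∑ Q ∈ (univ : Finset (Fin s)).powerset, w A Q = #S := by
      rw [powerset_univ]
      exact (card_eq_sum_card_fiberwise (f := sampleTrace P A) (fun x _ => by simp)).symm
    rw [hsum] at hedge
    have hcomm : ∑ i, F i A = ((∑ Q ∈ (univ : Finset (Fin s)).powerset,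
        ∑ i ∈ univ \ Q, min (w A Q) (w A (insert i Q)) : ℕ) : ℝ) := by
      simp only [F, powerset_univ]
      push_cast
      exact sum_comm' (by simp)
    rw [hcomm]; exact_mod_cast hedge
  have hlow : ∀ i, ((#S : ℝ) - (s + 1) ^ D) * Δ * Fintype.card (Fin s → ι)
      ≤ 2 * (M * ∑ A, F i A) := by
    intro i
    rw [← sum_sum_update i (F i), mul_sum]
    calc _ = ∑ A : Fin s → ι, ((#S : ℝ) - (s + 1) ^ D) * Δ := by simp; ring
      _ ≤ _ := by
        refine sum_le_sum fun A _ => ?_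
        have := sub_mul_le_sum_resample hP S hΔ hsep A i
        simpa only [F, w, Nat.cast_sum] using this
  have h1 : s * (((#S : ℝ) - (s + 1) ^ D) * Δ * Fintype.card (Fin s → ι))
      ≤ 2 * M * ∑ A, ∑ i, F i A := by
    rw [sum_comm]
    calc _ = ∑ i : Fin s, ((#S : ℝ) - (s + 1) ^ D) * Δ * Fintype.card (Fin s → ι) := by simp
      _ ≤ ∑ i, 2 * (M * ∑ A, F i A) := sum_le_sum fun i _ => hlow i
      _ = _ := by rw [mul_sum]; exact sum_congr rfl fun i _ => by ring
  have h2 : ∑ A, ∑ i, F i A ≤ (D * #S) * Fintype.card (Fin s → ι) := by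
    calc _ ≤ ∑ A : Fin s → ι, (D * #S : ℝ) := sum_le_sum fun A _ => hup A
      _ = _ := by simp; ring
  have hpos : (0:ℝ) < Fintype.card (Fin s → ι) := by exact_mod_cast Fintype.card_pos
  refine le_of_mul_le_mul_right ?_ hpos
  have h3 := mul_le_mul_of_nonneg_left h2 (by positivity : 0 ≤ 2 * M)
  nlinarith

/-- **Haussler's packing lemma**. -/
theorem card_le_of_separated {X ι : Type*} [DecidableEq X] [DecidableEq ι] [Fintype ι]
    {P : X → Finset ι} {D : ℕ} (hP : TraceDimLE P D) (S : Finset X) {Δ : ℝ}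
    (hΔ : 0 < Δ) (hΔM : Δ ≤ Fintype.card ι)
    (hsep : ∀ x ∈ S, ∀ y ∈ S, x ≠ y → Δ ≤ #(P x \ P y) + #(P y \ P x)) :
    (#S : ℝ) ≤ 2 * ((4 * D + 2) * (Fintype.card ι / Δ)) ^ D := by
  set M : ℝ := ((Fintype.card ι : ℕ) : ℝ) with hM
  have hMpos : 0 < M := hΔ.trans_le hΔM
  have : Nonempty ι := by
    rw [← Fintype.card_pos_iff]; rw [hM] at hMpos; exact_mod_cast hMpos
  set s : ℕ := ⌈4 * D * (M / Δ)⌉₊ with hs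
  have h1M : 1 ≤ M / Δ := (one_le_div hΔ).2 hΔM
  have hs1 : 4 * D * (M / Δ) ≤ s := Nat.le_ceil _
  have hs2 : (s : ℝ) < 4 * D * (M / Δ) + 1 := Nat.ceil_lt_add_one (by positivity)
  have hbound : ((s : ℝ) + 1) ^ D ≤ ((4 * D + 2) * (M / Δ)) ^ D := by
    gcongr; linarith
  by_contra! hlt
  have key := card_mul_le_of_separated hP S hΔ.le hsep s
  have hsΔ : 4 * D * M ≤ s * Δ := by
    have := mul_le_mul_of_nonneg_right hs1 hΔ.le
    rwa [mul_assoc, div_mul_cancel₀ _ hΔ.ne'] at this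
  rcases Nat.eq_zero_or_pos D with hD | hD
  · subst hD
    have h1 : #S ≤ 1 := by
      by_contra! h
      obtain ⟨x, hx, y, hy, hxy⟩ := one_lt_card.1 h
      have hne : P x ≠ P y := by
        intro he
        have := hsep x hx y hy hxy
        simp [he] at this
        linarith
      obtain ⟨k, hk⟩ : ∃ k, ¬ (k ∈ P x ↔ k ∈ P y) := by
        by_contra! hall; exact hne (Finset.ext hall)
      have := hP {k} fun t ht => by
        have hk' : (k ∈ P x ∧ k ∉ P y) ∨ (k ∉ P x ∧ k ∈ P y) := by tauto
        rcases subset_singleton_iff.1 ht with rfl | rfl <;> rcases hk' with ⟨h1, h2⟩ | ⟨h1, h2⟩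
        · exact ⟨y, singleton_inter_of_notMem h2⟩
        · exact ⟨x, singleton_inter_of_notMem h1⟩
        · exact ⟨x, singleton_inter_of_mem h1⟩
        · exact ⟨y, singleton_inter_of_mem h2⟩
      simp at this
    have : (#S : ℝ) ≤ 1 := by exact_mod_cast h1
    simp at hlt; linarith
  · have hDr : (0:ℝ) < D := by exact_mod_cast hD
    have hpos : 0 < (#S : ℝ) - (s + 1) ^ D := by
      have : 0 ≤ ((4 * D + 2) * (M / Δ)) ^ D := by positivity
      linarith
    have h2 : 4 * D * M * ((#S : ℝ) - (s + 1) ^ D) ≤ 2 * M * D * #S :=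
      (mul_le_mul_of_nonneg_right hsΔ hpos.le).trans key
    have hDM : 0 < D * M := by positivity
    nlinarith

/-- The half-spaces `{x | ⟨w k, x⟩ > t k}` containing the point `x`. -/
noncomputable def halfSpaceTrace {d : ℕ} {ι : Type*} [Fintype ι] (w : ι → Fin d → ℝ) (t : ι → ℝ)
    (x : Fin d → ℝ) : Finset ι := by
  classical exact univ.filter fun k => t k < w k ⬝ᵥ x

theorem mem_halfSpaceTrace {d : ℕ} {ι : Type*} [Fintype ι] {w : ι → Fin d → ℝ} {t : ι → ℝ}
    {x : Fin d → ℝ} {k : ι} : k ∈ halfSpaceTrace w t x ↔ t k < w k ⬝ᵥ x := by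
  simp [halfSpaceTrace]

theorem traceDimLE_halfSpaceTrace {d : ℕ} {ι : Type*} [Fintype ι] [DecidableEq ι]
    (w : ι → Fin d → ℝ) (t : ι → ℝ) : TraceDimLE (halfSpaceTrace w t) d := by
  intro T hT
  by_contra! hlt
  have hdep : ¬ LinearIndependent ℝ (fun i : T => w i) := by
    intro h
    have := h.fintype_card_le_finrank
    simp at this
    omega
  obtain ⟨g, hg, i₀, hi₀⟩ := Fintype.not_linearIndependent_iff.1 hdep
  have hgx : ∀ x : Fin d → ℝ, ∑ i : T, g i * (w i ⬝ᵥ x) = 0 := by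
    intro x
    have := congrArg (fun v => v ⬝ᵥ x) hg
    simpa [sum_dotProduct] using this
  have hpat : ∀ q : T → Prop, ∃ x : Fin d → ℝ, ∀ i : T, t i < w i ⬝ᵥ x ↔ q i := by
    intro q
    classical
    obtain ⟨x, hx⟩ := hT (T.attach.filter q |>.map (Function.Embedding.subtype _)) (by
      intro k hk
      obtain ⟨i, _, rfl⟩ := mem_map.1 hk
      exact i.2)
    refine ⟨x, fun i => ?_⟩
    rw [← mem_halfSpaceTrace (w := w) (t := t)]
    have : (i : ι) ∈ T ∩ halfSpaceTrace w t x ↔ q i := by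
      rw [hx]; simp
    rw [← this]; simp
  have key : ∀ s : ℝ, 0 ≤ ∑ i : T, s * g i * -t i ∧
      ((∃ i, 0 < s * g i) → 0 < ∑ i : T, s * g i * -t i) := by
    intro s
    obtain ⟨x, hx⟩ := hpat fun i => 0 < s * g i
    have h1 : ∑ i : T, s * g i * -t i = ∑ i : T, s * g i * (w i ⬝ᵥ x - t i) := by
      simp_rw [mul_sub, sum_sub_distrib, mul_assoc, ← mul_sum, hgx x]
      simp
    have hnn : ∀ i ∈ univ, 0 ≤ s * g i * (w i ⬝ᵥ x - t i) := by
      intro i _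
      by_cases hi : 0 < s * g i
      · exact mul_nonneg hi.le (sub_nonneg.2 ((hx i).2 hi).le)
      · have := not_lt.1 (mt (hx i).1 hi)
        exact mul_nonneg_of_nonpos_of_nonpos (not_lt.1 hi) (sub_nonpos.2 this)
    rw [h1]
    exact ⟨sum_nonneg hnn, fun ⟨j, hj⟩ =>
      sum_pos' hnn ⟨j, mem_univ _, mul_pos hj (sub_pos.2 ((hx j).2 hj))⟩⟩
  have hneg : ∑ i : T, (-1 : ℝ) * g i * -t i = -∑ i : T, 1 * g i * -t i := by
    rw [← sum_neg_distrib]; exact sum_congr rfl fun i _ => by ring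
  rcases lt_or_gt_of_ne hi₀ with h | h
  · have := (key (-1)).2 ⟨i₀, by linarith⟩
    linarith [(key 1).1]
  · have := (key 1).2 ⟨i₀, by linarith⟩
    linarith [(key (-1)).1]

theorem cosh_sub_one_le_sq {x : ℝ} (hx : |x| ≤ 1) : Real.cosh x - 1 ≤ x ^ 2 := by
  have h1 := Real.cosh_le_exp_half_sq x
  have hx2 : x ^ 2 ≤ 1 := (sq_le_one_iff_abs_le_one x).2 hx
  have h2 := Real.abs_exp_sub_one_le (x := x ^ 2 / 2) (by
    rw [abs_of_nonneg (by positivity)]; linarith)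
  rw [abs_of_nonneg (a := x ^ 2 / 2) (by positivity)] at h2
  have := le_abs_self (Real.exp (x ^ 2 / 2) - 1)
  linarith

theorem exists_orthonormal_of_constraints {ι : Type*} [Fintype ι] {κ : Type*} [Fintype κ]
    (u : κ → ι → ℝ) {m : ℕ} (hm : m + Fintype.card κ ≤ Fintype.card ι) :
    ∃ e : Fin m → ι → ℝ, (∀ j, ∑ k, e j k ^ 2 = 1) ∧ (∀ j i, u i ⬝ᵥ e j = 0) ∧
      ∀ g : ι → ℝ, ∑ j, (g ⬝ᵥ e j) ^ 2 ≤ ∑ k, g k ^ 2 := by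
  let L : EuclideanSpace ℝ ι →ₗ[ℝ] (κ → ℝ) :=
    { toFun := fun z i => u i ⬝ᵥ z.ofLp
      map_add' := fun z z' => by ext i; simp [dotProduct_add]
      map_smul' := fun c z => by ext i; simp [dotProduct_smul] }
  let W := LinearMap.ker L
  have hdim : m ≤ Module.finrank ℝ W := by
    have h1 := LinearMap.finrank_range_add_finrank_ker L
    have h2 : Module.finrank ℝ (LinearMap.range L) ≤ Fintype.card κ := by
      simpa using Submodule.finrank_le (LinearMap.range L)
    rw [finrank_euclideanSpace] at h1
    change m ≤ Module.finrank ℝ (LinearMap.ker L)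
    omega
  let b := stdOrthonormalBasis ℝ W
  let e' : Fin m → EuclideanSpace ℝ ι := fun j => (b (Fin.castLE hdim j) : EuclideanSpace ℝ ι)
  have hon : Orthonormal ℝ e' := by
    have h1 : Orthonormal ℝ (fun j => (b j : EuclideanSpace ℝ ι)) :=
      b.orthonormal.comp_linearIsometry W.subtypeₗᵢ
    exact h1.comp _ (Fin.castLE_injective hdim)
  refine ⟨fun j => (e' j).ofLp, fun j => ?_, fun j i => ?_, fun g => ?_⟩
  · have := hon.1 j
    have h2 := EuclideanSpace.real_norm_sq_eq (e' j)
    rw [this] at h2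
    rw [← h2]; norm_num
  · have : e' j ∈ W := (b (Fin.castLE hdim j)).2
    have := congrFun (LinearMap.mem_ker.1 this) i
    exact this
  · have := hon.sum_inner_products_le (WithLp.toLp 2 g : EuclideanSpace ℝ ι) (s := univ)
    rw [EuclideanSpace.real_norm_sq_eq] at this
    refine le_trans (le_of_eq (sum_congr rfl fun j _ => ?_)) this
    rw [Real.norm_eq_abs, sq_abs, PiLp.inner_apply]
    simp [dotProduct]

theorem exists_partial_coloring {ι J I : Type*} [Fintype ι] [Fintype J] [Fintype I]
    (u : J → ι → ℝ) (g : I → ι → ℝ) (τ β : I → ℝ) (hτ : ∀ i, 0 < τ i) (hβ : ∀ i, 0 ≤ β i)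
    (hg : ∀ i, ∑ k, g i k ^ 2 ≤ 1 / 16) (hJ : 8 * Fintype.card J ≤ Fintype.card ι)
    (hβsum : ∑ i, β i ≤ Fintype.card ι) (hcosh : ∀ i, 16 ≤ β i * (Real.cosh (τ i) - 1)) :
    ∃ y : ι → ℝ, (∀ k, |y k| ≤ 1) ∧ (∀ j, u j ⬝ᵥ y = 0) ∧ (∀ i, |g i ⬝ᵥ y| ≤ τ i) ∧
      2 * #(univ.filter fun k => |y k| < 1) ≤ Fintype.card ι := by
  classical
  set M := Fintype.card ι with hM
  let K : Set (ι → ℝ) := {y | (∀ k, |y k| ≤ 1) ∧ (∀ j, u j ⬝ᵥ y = 0) ∧ ∀ i, |g i ⬝ᵥ y| ≤ τ i}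
  let Ψ : (ι → ℝ) → ℝ := fun y => ∑ k, y k ^ 2 - ∑ i, β i * (Real.cosh (g i ⬝ᵥ y) - 1)
  have hdot : ∀ v : ι → ℝ, Continuous fun y : ι → ℝ => v ⬝ᵥ y := by
    intro v; unfold dotProduct; fun_prop
  have hKclosed : IsClosed K := by
    have hK : K = (⋂ k, {y | |y k| ≤ 1}) ∩ ((⋂ j, {y | u j ⬝ᵥ y = 0}) ∩
        ⋂ i, {y | |g i ⬝ᵥ y| ≤ τ i}) := by
      ext y; simp [K]
    rw [hK]
    exact (isClosed_iInter fun k => isClosed_le (by fun_prop) continuous_const).inter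
      ((isClosed_iInter fun j => isClosed_eq (hdot _) continuous_const).inter
        (isClosed_iInter fun i => isClosed_le (hdot _).abs continuous_const))
  have hKcompact : IsCompact K := by
    refine (isCompact_Icc (a := (fun _ => -1 : ι → ℝ)) (b := fun _ => 1)).of_isClosed_subset
      hKclosed fun y hy => ?_
    exact ⟨fun k => (abs_le.1 (hy.1 k)).1, fun k => (abs_le.1 (hy.1 k)).2⟩
  have h0K : (0 : ι → ℝ) ∈ K := by
    refine ⟨fun k => by simp, fun j => by simp, fun i => by simpa using (hτ i).le⟩
  have hΨ : Continuous Ψ := by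
    refine Continuous.sub (by fun_prop) (continuous_finsetSum _ fun i _ => ?_)
    exact continuous_const.mul ((Real.continuous_cosh.comp (hdot _)).sub continuous_const)
  obtain ⟨y, hyK, hymax⟩ := hKcompact.exists_isMaxOn ⟨0, h0K⟩ hΨ.continuousOn
  refine ⟨y, hyK.1, hyK.2.1, hyK.2.2, ?_⟩
  by_contra! hfree
  set F := univ.filter fun k => |y k| < 1 with hF
  set R := univ.filter fun i => |g i ⬝ᵥ y| = τ i with hR
  have hcost : ∑ i, β i * (Real.cosh (g i ⬝ᵥ y) - 1) ≤ M := by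
    have h1 : Ψ 0 ≤ Ψ y := hymax h0K
    have h2 : ∑ k, y k ^ 2 ≤ M := by
      calc ∑ k, y k ^ 2 ≤ ∑ k : ι, (1:ℝ) :=
            sum_le_sum fun k _ => (sq_le_one_iff_abs_le_one _).2 (hyK.1 k)
        _ = M := by simp [hM]
    simp [Ψ] at h1
    simp only [mul_sub, sum_sub_distrib] at *
    linarith
  have htight : 16 * #R ≤ M := by
    have : (16 * #R : ℝ) ≤ M := by
      calc (16 * #R : ℝ) = ∑ i ∈ R, (16:ℝ) := by simp [mul_comm]
        _ ≤ ∑ i ∈ R, β i * (Real.cosh (g i ⬝ᵥ y) - 1) := by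
            refine sum_le_sum fun i hi => ?_
            rw [← Real.cosh_abs (g i ⬝ᵥ y), (mem_filter.1 hi).2]
            exact hcosh i
        _ ≤ ∑ i, β i * (Real.cosh (g i ⬝ᵥ y) - 1) :=
            sum_le_sum_of_subset_of_nonneg (subset_univ _) fun i _ _ =>
              mul_nonneg (hβ i) (sub_nonneg.2 (Real.one_le_cosh _))
        _ ≤ M := hcost
    exact_mod_cast this
  have hMpos : 0 < M := by
    rw [hM]; by_contra! h
    have : #F ≤ M := card_le_univ _
    omega
  let κ := (Fᶜ : Finset ι) ⊕ J ⊕ R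
  let c : κ → ι → ℝ := Sum.elim (fun k => Pi.single (k : ι) 1) (Sum.elim u fun i => g i)
  have hκ : Fintype.card κ = (M - #F) + (Fintype.card J + #R) := by
    simp [κ, hM]
  have hFM : #F ≤ M := card_le_univ _
  set m := #F - Fintype.card J - #R with hm
  have h5 : 5 * M < 16 * m := by omega
  obtain ⟨e, he1, he2, he3⟩ := exists_orthonormal_of_constraints c (m := m) (by omega)
  have heF : ∀ j k, k ∉ F → e j k = 0 := by
    intro j k hk
    have := he2 j (Sum.inl ⟨k, by simpa using hk⟩)
    simpa [c] using this
  have heJ : ∀ j i, u i ⬝ᵥ e j = 0 := fun j i => he2 j (Sum.inr (Sum.inl i))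
  have heR : ∀ j, ∀ i ∈ R, g i ⬝ᵥ e j = 0 := fun j i hi => he2 j (Sum.inr (Sum.inr ⟨i, hi⟩))
  have hfeas : ∀ j, ∀ᶠ ε : ℝ in nhds 0, y + ε • e j ∈ K ∧ y - ε • e j ∈ K ∧
      ∀ i, |ε * (g i ⬝ᵥ e j)| ≤ 1 := by
    intro j
    have hbound : ∀ a b r : ℝ, |a| < r → ∀ᶠ ε : ℝ in nhds 0, |a + ε * b| ≤ r ∧ |a - ε * b| ≤ r := by
      intro a b r h
      have h1 : Filter.Tendsto (fun ε : ℝ => |a + ε * b|) (nhds 0) (nhds |a|) := by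
        have : Continuous fun ε : ℝ => |a + ε * b| := by fun_prop
        simpa using this.tendsto 0
      have h2 : Filter.Tendsto (fun ε : ℝ => |a - ε * b|) (nhds 0) (nhds |a|) := by
        have : Continuous fun ε : ℝ => |a - ε * b| := by fun_prop
        simpa using this.tendsto 0
      filter_upwards [h1.eventually_lt_const h, h2.eventually_lt_const h] with ε h1 h2
      exact ⟨h1.le, h2.le⟩
    have hk : ∀ᶠ ε : ℝ in nhds 0, ∀ k, |y k + ε * e j k| ≤ 1 ∧ |y k - ε * e j k| ≤ 1 := by
      refine Filter.eventually_all.2 fun k => ?_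
      by_cases hkF : k ∈ F
      · exact hbound _ _ _ (mem_filter.1 hkF).2
      · exact .of_forall fun ε => by simpa [heF j k hkF] using hyK.1 k
    have hi : ∀ᶠ ε : ℝ in nhds 0, ∀ i, |g i ⬝ᵥ y + ε * (g i ⬝ᵥ e j)| ≤ τ i ∧
        |g i ⬝ᵥ y - ε * (g i ⬝ᵥ e j)| ≤ τ i := by
      refine Filter.eventually_all.2 fun i => ?_
      by_cases hiR : i ∈ R
      · exact .of_forall fun ε => by simpa [heR j i hiR] using hyK.2.2 i
      · exact hbound _ _ _ (lt_of_le_of_ne (hyK.2.2 i) fun h => hiR (by simp [hR, h]))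
    have h1 : ∀ᶠ ε : ℝ in nhds 0, ∀ i, |0 + ε * (g i ⬝ᵥ e j)| ≤ 1 ∧ |0 - ε * (g i ⬝ᵥ e j)| ≤ 1 :=
      Filter.eventually_all.2 fun i => hbound _ _ _ (by simp)
    filter_upwards [hk, hi, h1] with ε hk hi h1
    refine ⟨⟨fun k => by simpa using (hk k).1, fun i => ?_, fun i => ?_⟩,
      ⟨fun k => by simpa using (hk k).2, fun i => ?_, fun i => ?_⟩,
      fun i => by simpa using (h1 i).1⟩
    · simp [dotProduct_add, dotProduct_smul, hyK.2.1 i, heJ j i]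
    · simpa [dotProduct_add, dotProduct_smul] using (hi i).1
    · simp [dotProduct_sub, dotProduct_smul, hyK.2.1 i, heJ j i]
    · simpa [dotProduct_sub, dotProduct_smul] using (hi i).2
  have hvar : ∀ j, 1 ≤ ∑ i, β i * Real.cosh (g i ⬝ᵥ y) * (g i ⬝ᵥ e j) ^ 2 := by
    intro j
    obtain ⟨ε, ⟨hp, hn, hsmall⟩, hε⟩ :=
      (((hfeas j).filter_mono nhdsWithin_le_nhds).and
        (self_mem_nhdsWithin : Set.Ioi (0:ℝ) ∈ nhdsWithin 0 (Set.Ioi 0))).exists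
    have hε : 0 < ε := hε
    have h1 : Ψ (y + ε • e j) ≤ Ψ y := hymax hp
    have h2 : Ψ (y - ε • e j) ≤ Ψ y := hymax hn
    have hsq : ∑ k, (y + ε • e j) k ^ 2 + ∑ k, (y - ε • e j) k ^ 2 =
        2 * ∑ k, y k ^ 2 + 2 * ε ^ 2 := by
      calc _ = ∑ k, (2 * y k ^ 2 + 2 * ε ^ 2 * e j k ^ 2) := by
            rw [← sum_add_distrib]
            exact sum_congr rfl fun k _ => by simp; ring
        _ = _ := by rw [sum_add_distrib, ← mul_sum, ← mul_sum, he1 j, mul_one]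
    have hco : ∑ i, β i * (Real.cosh (g i ⬝ᵥ (y + ε • e j)) - 1)
        + ∑ i, β i * (Real.cosh (g i ⬝ᵥ (y - ε • e j)) - 1)
        ≤ 2 * ∑ i, β i * (Real.cosh (g i ⬝ᵥ y) - 1)
          + 2 * ε ^ 2 * ∑ i, β i * Real.cosh (g i ⬝ᵥ y) * (g i ⬝ᵥ e j) ^ 2 := by
      rw [mul_sum, mul_sum, ← sum_add_distrib, ← sum_add_distrib]
      refine sum_le_sum fun i _ => ?_
      rw [dotProduct_add, dotProduct_sub, dotProduct_smul, smul_eq_mul, Real.cosh_add,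
        Real.cosh_sub]
      have := cosh_sub_one_le_sq (hsmall i)
      have h3 : 0 ≤ β i * Real.cosh (g i ⬝ᵥ y) := mul_nonneg (hβ i) (Real.cosh_pos _).le
      nlinarith [mul_le_mul_of_nonneg_left this h3]
    have h4 : 2 * ε ^ 2 * 1
        ≤ 2 * ε ^ 2 * ∑ i, β i * Real.cosh (g i ⬝ᵥ y) * (g i ⬝ᵥ e j) ^ 2 := by
      simp only [Ψ] at h1 h2
      linarith
    exact le_of_mul_le_mul_left h4 (by positivity)
  have hsum : (m : ℝ) ≤ ∑ i, β i * Real.cosh (g i ⬝ᵥ y) * (1 / 16) := by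
    calc (m : ℝ) = ∑ j : Fin m, (1:ℝ) := by simp
      _ ≤ ∑ j, ∑ i, β i * Real.cosh (g i ⬝ᵥ y) * (g i ⬝ᵥ e j) ^ 2 := sum_le_sum fun j _ => hvar j
      _ = ∑ i, β i * Real.cosh (g i ⬝ᵥ y) * ∑ j, (g i ⬝ᵥ e j) ^ 2 := by
          rw [sum_comm]; simp_rw [mul_sum]
      _ ≤ _ := sum_le_sum fun i _ => mul_le_mul_of_nonneg_left ((he3 (g i)).trans (hg i))
          (mul_nonneg (hβ i) (Real.cosh_pos _).le)
  have hfin : (16 * m : ℝ) ≤ 2 * M := by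
    rw [← sum_mul] at hsum
    simp only [mul_sub, sum_sub_distrib, mul_one] at hcost
    linarith
  have : 16 * m ≤ 2 * M := by exact_mod_cast hfin
  omega

theorem pow_div_factorial_le_cosh_sub_one (x : ℝ) {q : ℕ} (hq : q ≠ 0) :
    x ^ (2 * q) / (2 * q).factorial ≤ Real.cosh x - 1 := by
  have h := sum_le_hasSum {0, q} (fun n _ => by
    rw [pow_mul]; positivity) (Real.hasSum_cosh x)
  rw [sum_pair (Ne.symm hq)] at h
  simp at h
  linarith

theorem exists_separated_net {X : Type*} [Fintype X] (δ : X → X → ℕ) (hδ : ∀ x, δ x x = 0)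
    (hsymm : ∀ x y, δ x y = δ y x) {Δ : ℝ} (hΔ : 0 < Δ) :
    ∃ N : Finset X, (∀ x ∈ N, ∀ y ∈ N, x ≠ y → Δ ≤ δ x y) ∧ ∀ x, ∃ p ∈ N, (δ x p : ℝ) < Δ := by
  classical
  obtain ⟨N, hN, hmax⟩ := exists_max_image
    ((univ : Finset (Finset X)).filter fun N => ∀ x ∈ N, ∀ y ∈ N, x ≠ y → Δ ≤ δ x y)
    card ⟨∅, by simp⟩
  have hsep := (mem_filter.1 hN).2
  refine ⟨N, hsep, fun x => ?_⟩
  by_contra! hfar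
  have hxN : x ∉ N := fun h => by
    have := hfar x h
    rw [hδ] at this
    simp at this; linarith
  have hins : insert x N ∈ (univ : Finset (Finset X)).filter
      fun N => ∀ x ∈ N, ∀ y ∈ N, x ≠ y → Δ ≤ δ x y := by
    refine mem_filter.2 ⟨mem_univ _, fun a ha b hb hab => ?_⟩
    rcases mem_insert.1 ha with rfl | ha' <;> rcases mem_insert.1 hb with rfl | hb'
    · exact absurd rfl hab
    · exact hfar b hb'
    · rw [hsymm]; exact hfar a ha'
    · exact hsep a ha' b hb' hab
  have := hmax _ hins
  rw [card_insert_of_notMem hxN] at this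
  omega

theorem exists_separated_net_le {ι X : Type*} [Fintype ι] [DecidableEq ι] [Fintype X]
    {P : X → Finset ι} {D : ℕ} (hP : TraceDimLE P D) {Δ : ℝ} (hΔ : 0 < Δ)
    (hΔM : Δ ≤ Fintype.card ι) :
    ∃ N : Finset X, (#N : ℝ) ≤ 2 * ((4 * D + 2) * (Fintype.card ι / Δ)) ^ D ∧
      ∀ x, ∃ p ∈ N, (#(P x \ P p) : ℝ) + #(P p \ P x) < Δ := by
  classical
  obtain ⟨N, hsep, hnet⟩ := exists_separated_net (fun x y => #(P x \ P y) + #(P y \ P x))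
    (fun x => by simp) (fun x y => Nat.add_comm _ _) hΔ
  refine ⟨N, card_le_of_separated hP N hΔ hΔM ?_, ?_⟩
  · exact_mod_cast hsep
  · exact_mod_cast hnet

theorem sum_sq_indicator_sub_le {ι : Type*} [Fintype ι] [DecidableEq ι] (a : ι → ℝ)
    (ha : ∀ k, |a k| ≤ 1) (S T : Finset ι) :
    ∑ k, (a k * ((if k ∈ S then 1 else 0) - (if k ∈ T then 1 else 0))) ^ 2
      ≤ (#(S \ T) : ℝ) + #(T \ S) := by
  have h : ∀ U V : Finset ι, (#(U \ V) : ℝ) = ∑ k, if k ∈ U ∧ k ∉ V then 1 else 0 := by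
    intro U V
    rw [sum_boole]; congr 2; ext; simp
  rw [h, h, ← sum_add_distrib]
  refine sum_le_sum fun k _ => ?_
  have := (sq_le_one_iff_abs_le_one _).2 (ha k)
  by_cases h1 : k ∈ S <;> by_cases h2 : k ∈ T <;> simp [h1, h2, this]

/-- Scale of the coarsest net in the chaining argument. -/
noncomputable def netScale (d : ℕ) : ℝ := 32 * (4 * d + 2)

/-- Scale of the discrepancy allowed at the coarsest link of the chain. -/
noncomputable def chainScale (d : ℕ) : ℝ := 4 * (2 * 16 ^ d * (2 * (2 * d + 2)).factorial)

theorem netScale_pos (d : ℕ) : 0 < netScale d := by unfold netScale; positivity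

theorem chainScale_pos (d : ℕ) : 0 < chainScale d := by unfold chainScale; positivity

theorem chain_weight_le (d l : ℕ) :
    16 ^ ((l + 1) * d) / (Real.cosh (chainScale d / 4 * 2 ^ l) - 1) ≤
      (1 / 2) * (1 / 2 : ℝ) ^ l := by
  set Q : ℝ := 2 * 16 ^ d * (2 * (2 * d + 2)).factorial with hQ
  have hfac : (1:ℝ) ≤ (2 * (2 * d + 2)).factorial := by exact_mod_cast Nat.factorial_pos _
  have hQ1 : 1 ≤ Q := by
    have h1 : (1:ℝ) ≤ 16 ^ d := one_le_pow₀ (by norm_num)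
    rw [hQ]; nlinarith
  have hc : chainScale d / 4 = Q := by rw [hQ, chainScale]; ring
  have h := pow_div_factorial_le_cosh_sub_one (Q * 2 ^ l) (q := 2 * d + 2) (by omega)
  have hpow : Q ≤ Q ^ (2 * (2 * d + 2)) := le_self_pow₀ hQ1 (by omega)
  have h16 : ((2:ℝ) ^ l) ^ (2 * (2 * d + 2)) = 16 ^ (l * d) * 16 ^ l := by
    rw [show (16:ℝ) = 2 ^ 4 by norm_num, ← pow_mul, ← pow_mul, ← pow_mul, ← pow_add]
    congr 1; ring
  have hlow : 2 * 16 ^ ((l + 1) * d) * 16 ^ l ≤ Real.cosh (Q * 2 ^ l) - 1 := by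
    refine le_trans ?_ h
    rw [le_div_iff₀ (by positivity), mul_pow, h16]
    calc 2 * (16:ℝ) ^ ((l + 1) * d) * 16 ^ l * (2 * (2 * d + 2)).factorial
        = Q * (16 ^ (l * d) * 16 ^ l) := by rw [hQ]; ring
      _ ≤ _ := by gcongr
  rw [hc, div_le_iff₀ (lt_of_lt_of_le (by positivity) hlow)]
  have h2 : ((1:ℝ) / 2) * (1 / 2) ^ l * (2 * 16 ^ ((l + 1) * d) * 16 ^ l)
      = 16 ^ ((l + 1) * d) * 8 ^ l := by
    rw [show (16:ℝ) ^ l = 2 ^ l * 8 ^ l by rw [← mul_pow]; norm_num, one_div_pow]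
    field_simp
  calc (16:ℝ) ^ ((l + 1) * d) ≤ 16 ^ ((l + 1) * d) * 8 ^ l :=
        le_mul_of_one_le_right (by positivity) (one_le_pow₀ (by norm_num))
    _ = _ := h2.symm
    _ ≤ _ := by gcongr

theorem sum_half_pow_le (L : ℕ) : ∑ l ∈ range L, (1 / 2 : ℝ) ^ l ≤ 2 := by
  rw [geom_sum_eq (by norm_num)]
  have : (0:ℝ) ≤ (1 / 2) ^ L := by positivity
  rw [div_le_iff_of_neg (by norm_num)]; linarith

theorem exists_low_discrepancy_coloring {ι X : Type*} [Fintype ι] [DecidableEq ι] [Fintype X]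
    {P : X → Finset ι} {d : ℕ} (hd : 1 ≤ d) (hP : TraceDimLE P d) (a : ι → ℝ)
    (ha : ∀ k, |a k| ≤ 1) {r : ℝ} (hr : netScale d ≤ r) (hrd : r ^ d = Fintype.card ι) :
    ∃ y : ι → ℝ, (∀ k, |y k| ≤ 1) ∧ ∑ k, a k * y k = 0 ∧
      (∀ x, |∑ k ∈ P x, a k * y k| ≤ 2 * chainScale d * √(netScale d * (Fintype.card ι / r))) ∧
      2 * #(univ.filter fun k => |y k| < 1) ≤ Fintype.card ι := by
  classical
  set M := Fintype.card ι with hM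
  have hA := netScale_pos d
  have hΛ := chainScale_pos d
  have hr0 : 0 < r := hA.trans_le hr
  have hd0 : d ≠ 0 := by omega
  have hA64 : 64 ≤ netScale d := by
    unfold netScale
    have : (0:ℝ) ≤ d := Nat.cast_nonneg _
    linarith
  have hMr : r ≤ M := by rw [← hrd]; exact le_self_pow₀ (by linarith) hd0
  have hMpos : (0:ℝ) < M := hr0.trans_le hMr
  set Δ₀ := netScale d * (M / r) with hΔ₀
  have hΔ₀pos : 0 < Δ₀ := by positivity
  have hΔ₀M : Δ₀ ≤ M := by
    rw [hΔ₀, mul_div_assoc', div_le_iff₀ hr0]; nlinarith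
  let Δ : ℕ → ℝ := fun l => Δ₀ / 16 ^ l
  have hΔpos : ∀ l, 0 < Δ l := fun l => by positivity
  have hnet : ∀ l, ∃ N : Finset X, (#N : ℝ) ≤ M / 16 * 16 ^ (l * d) ∧
      ∀ x, ∃ p ∈ N, (#(P x \ P p) : ℝ) + #(P p \ P x) < Δ l := by
    intro l
    obtain ⟨N, hN, hN'⟩ := exists_separated_net_le hP (hΔpos l)
      ((div_le_self hΔ₀pos.le (one_le_pow₀ (by norm_num))).trans hΔ₀M)
    refine ⟨N, hN.trans ?_, hN'⟩
    have h1 : (4 * d + 2) * ((M:ℝ) / Δ l) = r * 16 ^ l * (1 / 32) := by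
      simp only [Δ, hΔ₀, netScale]
      field_simp
    rw [h1, mul_pow, mul_pow, hrd, ← pow_mul]
    have h2 : ((1:ℝ) / 32) ^ d ≤ 1 / 32 := pow_le_of_le_one (by norm_num) (by norm_num) hd0
    have h3 : 0 ≤ (M:ℝ) * 16 ^ (l * d) := by positivity
    nlinarith
  choose N hNcard hN using hnet
  choose π hπN hπ using hN
  obtain ⟨L, hL⟩ : ∃ L : ℕ, Δ₀ ≤ 16 ^ L := (pow_unbounded_of_one_lt Δ₀ (by norm_num)).imp
    fun _ h => h.le
  let v : (Σ l : Fin L, N (l + 1)) → ι → ℝ := fun i k => a k *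
    ((if k ∈ P i.2 then 1 else 0) - (if k ∈ P (π i.1 i.2) then 1 else 0))
  let u : Option (N 0) → ι → ℝ := fun j k => a k * (j.elim 1 fun p => if k ∈ P p then 1 else 0)
  let τ : (Σ l : Fin L, N (l + 1)) → ℝ := fun i => chainScale d / 4 * 2 ^ (i.1 : ℕ)
  have hτ : ∀ i, 0 < τ i := fun i => by positivity
  have hcosh : ∀ i, 0 < Real.cosh (τ i) - 1 := fun i =>
    sub_pos.2 (Real.one_lt_cosh.2 (hτ i).ne')
  have hv : ∀ i, ∑ k, ((4 * √(Δ i.1))⁻¹ • v i) k ^ 2 ≤ 1 / 16 := by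
    intro i
    have h1 := sum_sq_indicator_sub_le a ha (P i.2) (P (π i.1 i.2))
    have h2 := (hπ i.1 i.2).le
    simp only [Pi.smul_apply, smul_eq_mul, mul_pow, ← mul_sum]
    rw [inv_pow, inv_mul_le_iff₀ (by have := hΔpos i.1; positivity), mul_pow,
      Real.sq_sqrt (hΔpos i.1).le]
    simp only [v, mul_pow] at h1 ⊢
    linarith
  have hJ : 8 * Fintype.card (Option (N 0)) ≤ M := by
    have h1 := hNcard 0
    simp only [Fintype.card_option, Fintype.card_coe]
    have h2 : (8 * (#(N 0) + 1) : ℝ) ≤ M := by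
      simp at h1; linarith
    exact_mod_cast h2
  have hβ : ∑ i, 16 / (Real.cosh (τ i) - 1) ≤ M := by
    rw [Fintype.sum_sigma]
    calc ∑ l : Fin L, ∑ p : N (l + 1), 16 / (Real.cosh (τ ⟨l, p⟩) - 1)
        ≤ ∑ l : Fin L, M * ((1 / 2) * (1 / 2 : ℝ) ^ (l : ℕ)) := by
          refine sum_le_sum fun l _ => ?_
          have hc : 0 < Real.cosh (chainScale d / 4 * 2 ^ (l : ℕ)) - 1 :=
            sub_pos.2 (Real.one_lt_cosh.2 (by positivity))
          simp only [τ, sum_const, card_univ, Fintype.card_coe, nsmul_eq_mul]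
          calc (#(N (l + 1)) : ℝ) * (16 / (Real.cosh (chainScale d / 4 * 2 ^ (l : ℕ)) - 1))
              ≤ (M / 16 * 16 ^ (((l : ℕ) + 1) * d))
                  * (16 / (Real.cosh (chainScale d / 4 * 2 ^ (l : ℕ)) - 1)) := by
                gcongr; exact hNcard _
            _ = M * (16 ^ (((l : ℕ) + 1) * d)
                  / (Real.cosh (chainScale d / 4 * 2 ^ (l : ℕ)) - 1)) := by ring
            _ ≤ _ := by gcongr; exact chain_weight_le d l
      _ = M * ((1 / 2) * ∑ l ∈ range L, (1 / 2 : ℝ) ^ l) := by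
          rw [← Fin.sum_univ_eq_sum_range, mul_sum, mul_sum]
      _ ≤ M := by
          have := sum_half_pow_le L
          nlinarith
  obtain ⟨y, hy1, hyu, hyv, hyF⟩ := exists_partial_coloring u
    (fun i => (4 * √(Δ i.1))⁻¹ • v i) τ (fun i => 16 / (Real.cosh (τ i) - 1)) hτ
    (fun i => (div_pos (by norm_num) (hcosh i)).le) hv hJ hβ
    (fun i => by rw [div_mul_cancel₀ _ (hcosh i).ne'])
  have hind : ∀ S : Finset ι, ∑ k ∈ S, a k * y k = ∑ k, if k ∈ S then a k * y k else 0 := by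
    intro S; simp
  have hlink : ∀ l < L, ∀ p ∈ N (l + 1), |∑ k ∈ P p, a k * y k - ∑ k ∈ P (π l p), a k * y k|
      ≤ chainScale d * √Δ₀ * (1 / 2) ^ l := by
    intro l hl p hp
    have h1 := hyv ⟨⟨l, hl⟩, ⟨p, hp⟩⟩
    have h2 : v ⟨⟨l, hl⟩, ⟨p, hp⟩⟩ ⬝ᵥ y
        = ∑ k ∈ P p, a k * y k - ∑ k ∈ P (π l p), a k * y k := by
      rw [hind, hind, ← sum_sub_distrib]
      refine sum_congr rfl fun k _ => ?_
      by_cases h3 : k ∈ P p <;> by_cases h4 : k ∈ P (π l p) <;> simp [v, h3, h4]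
    simp only [smul_dotProduct, smul_eq_mul, abs_mul, h2] at h1
    rw [abs_of_nonneg (by positivity), inv_mul_le_iff₀ (by positivity)] at h1
    refine h1.trans (le_of_eq ?_)
    have h16 : √(Δ l) = √Δ₀ / 4 ^ l := by
      simp only [Δ]
      rw [Real.sqrt_div hΔ₀pos.le, show (16:ℝ) ^ l = (4 ^ l) ^ 2 by
        rw [← pow_mul, mul_comm, pow_mul]; norm_num, Real.sqrt_sq (by positivity)]
    simp only [τ, h16]
    rw [show (4:ℝ) ^ l = 2 ^ l * 2 ^ l by rw [← mul_pow]; norm_num, one_div_pow]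
    field_simp
  have hchain : ∀ l ≤ L, ∀ p ∈ N l, |∑ k ∈ P p, a k * y k|
      ≤ chainScale d * √Δ₀ * ∑ j ∈ range l, (1 / 2 : ℝ) ^ j := by
    intro l
    induction l with
    | zero =>
      intro _ p hp
      have := hyu (some ⟨p, hp⟩)
      simp only [u, Option.elim, dotProduct, mul_ite, mul_one, mul_zero, ite_mul, zero_mul] at this
      simp [hind, this]
    | succ l ih =>
      intro hl p hp
      have h1 := hlink l (by omega) p hp
      have h2 := ih (by omega) (π l p) (hπN l p)
      rw [sum_range_succ, mul_add]
      have := abs_sub_abs_le_abs_sub (∑ k ∈ P p, a k * y k) (∑ k ∈ P (π l p), a k * y k)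
      linarith
  refine ⟨y, hy1, ?_, fun x => ?_, hyF⟩
  · have := hyu none
    simpa [u, dotProduct] using this
  · have hclose := hπ L x
    have hΔL : Δ L ≤ 1 := (div_le_one (by positivity)).2 hL
    have hnat : #(P x \ P (π L x)) + #(P (π L x) \ P x) < 1 := by
      exact_mod_cast hclose.trans_le hΔL
    have heq : P x = P (π L x) := by
      refine Subset.antisymm ?_ ?_ <;> rw [← sdiff_eq_empty_iff_subset, ← card_eq_zero] <;> omega
    rw [heq]
    refine (hchain L le_rfl _ (hπN L x)).trans ?_
    calc chainScale d * √Δ₀ * ∑ j ∈ range L, (1 / 2 : ℝ) ^ j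
        ≤ chainScale d * √Δ₀ * 2 := by gcongr; exact sum_half_pow_le L
      _ = _ := by ring

theorem TraceDimLE.restrict {X ι : Type*} [DecidableEq ι] {P : X → Finset ι} {D : ℕ}
    (hP : TraceDimLE P D) (U : Finset ι) :
    TraceDimLE (fun x => (univ : Finset U).filter fun k : U => (k : ι) ∈ P x) D := by
  intro T hT
  rw [← card_map (Function.Embedding.subtype _)]
  refine hP _ fun t ht => ?_
  obtain ⟨x, hx⟩ := hT (T.filter fun k => (k : ι) ∈ t) (filter_subset _ _)
  refine ⟨x, ?_⟩
  ext k
  have hiff : ∀ hk : k ∈ U, (⟨k, hk⟩ : U) ∈ T → (k ∈ P x ↔ k ∈ t) := by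
    intro hk hkT
    have := Finset.ext_iff.1 hx ⟨k, hk⟩
    simpa [hkT] using this
  constructor
  · intro hk
    obtain ⟨hk1, hk2⟩ := mem_inter.1 hk
    obtain ⟨j, hj, rfl⟩ := mem_map.1 hk1
    exact (hiff j.2 hj).1 hk2
  · intro hk
    obtain ⟨j, hj, rfl⟩ := mem_map.1 (ht hk)
    exact mem_inter.2 ⟨ht hk, (hiff j.2 hj).2 hk⟩

/-- A colouring that kills at least a quarter of the elements. -/
theorem exists_low_discrepancy_killing {ι X : Type*} [Fintype ι] [DecidableEq ι] [Fintype X]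
    {P : X → Finset ι} {d : ℕ} (hd : 1 ≤ d) (hP : TraceDimLE P d) (a : ι → ℝ)
    (ha : ∀ k, |a k| ≤ 1) {r : ℝ} (hr : netScale d ≤ r) (hrd : r ^ d = Fintype.card ι) :
    ∃ y : ι → ℝ, (∀ k, -1 ≤ y k) ∧ ∑ k, a k * y k = 0 ∧
      (∀ x, |∑ k ∈ P x, a k * y k| ≤ 2 * chainScale d * √(netScale d * (Fintype.card ι / r))) ∧
      Fintype.card ι ≤ 4 * #(univ.filter fun k => y k = -1) := by
  obtain ⟨y, hy1, hy0, hyP, hyF⟩ := exists_low_discrepancy_coloring hd hP a ha hr hrd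
  have hcover : Fintype.card ι ≤ #(univ.filter fun k => |y k| < 1) +
      (#(univ.filter fun k => y k = -1) + #(univ.filter fun k => -y k = -1)) := by
    rw [← card_univ]
    calc #(univ : Finset ι) ≤ #((univ.filter fun k => |y k| < 1) ∪
          ((univ.filter fun k => y k = -1) ∪ (univ.filter fun k => -y k = -1))) := by
          refine card_le_card fun k _ => ?_
          simp only [mem_union, mem_filter, mem_univ, true_and]
          rcases lt_or_eq_of_le (hy1 k) with h | h
          · exact Or.inl h
          · rcases (abs_eq zero_le_one).1 h with h | h
            · exact Or.inr (Or.inr (by rw [h]))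
            · exact Or.inr (Or.inl h)
      _ ≤ _ := (card_union_le _ _).trans (Nat.add_le_add_left (card_union_le _ _) _)
  by_cases h : Fintype.card ι ≤ 4 * #(univ.filter fun k => y k = -1)
  · exact ⟨y, fun k => (abs_le.1 (hy1 k)).1, hy0, hyP, h⟩
  · refine ⟨fun k => -y k, fun k => neg_le_neg (abs_le.1 (hy1 k)).2, ?_, fun x => ?_, ?_⟩
    · simp [sum_neg_distrib, hy0]
    · simpa [sum_neg_distrib] using hyP x
    · change Fintype.card ι ≤ 4 * #(univ.filter fun k => -y k = -1)
      omega

noncomputable def sparsifyConst (d : ℕ) : ℝ := 4 * chainScale d * √(netScale d)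

theorem sparsifyConst_pos (d : ℕ) : 0 < sparsifyConst d := by
  have := netScale_pos d
  have := chainScale_pos d
  unfold sparsifyConst; positivity

theorem exists_sparser_weights {ι X : Type*} [Fintype ι] [DecidableEq ι] [Fintype X]
    {P : X → Finset ι} {d : ℕ} (hd : 1 ≤ d) (hP : TraceDimLE P d) (a : ι → ℝ)
    (ha : ∀ k, 0 ≤ a k) {K : ℝ} (hK : ∑ k, a k = K)
    (hm : 2 * netScale d ^ d ≤ #(univ.filter fun k => a k ≠ 0)) :
    ∃ a' : ι → ℝ, (∀ k, 0 ≤ a' k) ∧ ∑ k, a' k = K ∧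
      8 * #(univ.filter fun k => a' k ≠ 0) ≤ 7 * #(univ.filter fun k => a k ≠ 0) ∧
      ∀ x, |∑ k ∈ P x, a' k - ∑ k ∈ P x, a k| ≤
        sparsifyConst d * K *
          (#(univ.filter fun k => a k ≠ 0) : ℝ) ^ (-(1 / 2 + 1 / (2 * d)) : ℝ) := by
  set U := univ.filter fun k => a k ≠ 0 with hU
  set m := #U with hmdef
  have hA := netScale_pos d
  have hΛ := chainScale_pos d
  have hmpos : (0:ℝ) < m := lt_of_lt_of_le (by positivity) hm
  have hKU : ∑ k ∈ U, a k = K := by rw [← hK]; exact sum_filter_ne_zero _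
  have hKpos : 0 < K := by
    rw [← hKU]
    refine sum_pos (fun k hk => lt_of_le_of_ne (ha k) (mem_filter.1 hk).2.symm) ?_
    rw [← card_pos]; exact_mod_cast hmpos
  set α := 2 * K / m with hα
  have hαpos : 0 < α := by positivity
  set V := U.filter fun k => a k ≤ α with hV
  have hVm : #V ≤ m := card_filter_le _ _
  have hVhalf : m ≤ 2 * #V := by
    have h1 : (#(U.filter fun k => ¬ a k ≤ α) : ℝ) * α ≤ K := by
      calc (#(U.filter fun k => ¬ a k ≤ α) : ℝ) * α
          = ∑ k ∈ U.filter fun k => ¬ a k ≤ α, α := by simp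
        _ ≤ ∑ k ∈ U.filter fun k => ¬ a k ≤ α, a k :=
            sum_le_sum fun k hk => (not_le.1 (mem_filter.1 hk).2).le
        _ ≤ ∑ k ∈ U, a k := sum_le_sum_of_subset_of_nonneg (filter_subset _ _) fun k _ _ => ha k
        _ = K := hKU
    have h2 : (2 * #(U.filter fun k => ¬ a k ≤ α) : ℝ) ≤ m := by
      rw [hα, ← mul_div_assoc, div_le_iff₀ hmpos] at h1
      nlinarith
    have h3 : 2 * #(U.filter fun k => ¬ a k ≤ α) ≤ m := by exact_mod_cast h2
    have h4 : #V + #(U.filter fun k => ¬ a k ≤ α) = m := card_filter_add_card_filter_not _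
    omega
  have hVr : (m : ℝ) ≤ 2 * #V := by exact_mod_cast hVhalf
  have hVpos : (0:ℝ) < #V := by linarith
  have hd0 : (d : ℝ) ≠ 0 := by positivity
  set r : ℝ := (#V : ℝ) ^ (1 / d : ℝ) with hr
  have hrd : r ^ d = #V := by
    rw [hr, one_div, Real.rpow_inv_natCast_pow hVpos.le (by omega)]
  have hnr : netScale d ≤ r := by
    refine le_of_pow_le_pow_left₀ (by omega : d ≠ 0) (by positivity) ?_
    rw [hrd]; linarith
  obtain ⟨y, hy1, hy0, hyP, hyV⟩ := exists_low_discrepancy_killing hd (hP.restrict V)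
    (fun k : V => a k / α) (fun k => by
      rw [abs_of_nonneg (div_nonneg (ha _) hαpos.le), div_le_one hαpos]
      exact (mem_filter.1 k.2).2) hnr (by rw [hrd]; simp)
  rw [Fintype.card_coe] at hyP hyV
  let z : ι → ℝ := fun k => if h : k ∈ V then y ⟨k, h⟩ else 0
  have hzsum : ∀ S : Finset ι, ∑ k ∈ S, a k * z k
      = α * ∑ k ∈ (univ : Finset V).filter (fun k : V => (k : ι) ∈ S), a k / α * y k := by
    intro S
    have h1 : ∑ k ∈ S, a k * z k = ∑ k ∈ V, if k ∈ S then a k * z k else 0 := by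
      rw [← sum_filter, filter_mem_eq_inter, inter_comm, ← filter_mem_eq_inter, sum_filter]
      refine sum_congr rfl fun k _ => ?_
      by_cases h : k ∈ V <;> simp [z, h]
    rw [h1, ← sum_coe_sort V, mul_sum, sum_filter]
    refine sum_congr rfl fun k _ => ?_
    by_cases h : (k : ι) ∈ S
    · simp only [h, if_true, z, k.2, dif_pos]
      field_simp
    · simp [h]
  have hz1 : ∀ k, -1 ≤ z k := by
    intro k
    by_cases h : k ∈ V
    · simpa [z, h] using hy1 ⟨k, h⟩
    · simp [z, h]
  refine ⟨fun k => a k * (1 + z k), fun k => mul_nonneg (ha k) (by linarith [hz1 k]), ?_, ?_,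
    fun x => ?_⟩
  · simp_rw [mul_add, mul_one, sum_add_distrib, hzsum univ, mem_univ, filter_true, hy0]
    simp [hK]
  · have hsub : (univ.filter fun k => a k * (1 + z k) ≠ 0) ⊆
        U \ ((univ.filter fun k => y k = -1).map (Function.Embedding.subtype _)) := by
      intro k hk
      have hk' := (mem_filter.1 hk).2
      refine mem_sdiff.2 ⟨mem_filter.2 ⟨mem_univ _, left_ne_zero_of_mul hk'⟩, fun h => ?_⟩
      obtain ⟨j, hj, rfl⟩ := mem_map.1 h
      apply right_ne_zero_of_mul hk'
      simp [z, (mem_filter.1 hj).2]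
    have hin : ((univ.filter fun k => y k = -1).map (Function.Embedding.subtype _)) ⊆ U := by
      intro k hk
      obtain ⟨j, _, rfl⟩ := mem_map.1 hk
      exact (mem_filter.1 j.2).1
    have h1 := card_le_card hsub
    rw [card_sdiff_of_subset hin, card_map] at h1
    have h2 := card_le_card hin
    rw [card_map] at h2
    change 8 * #(univ.filter fun k => a k * (1 + z k) ≠ 0) ≤ 7 * m
    omega
  · have h1 : ∑ k ∈ P x, a k * (1 + z k) - ∑ k ∈ P x, a k = ∑ k ∈ P x, a k * z k := by
      rw [← sum_sub_distrib]; exact sum_congr rfl fun k _ => by ring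
    rw [h1, hzsum, abs_mul, abs_of_pos hαpos]
    refine (mul_le_mul_of_nonneg_left (hyP x) hαpos.le).trans ?_
    have h2 : (#V : ℝ) / r ≤ (m : ℝ) ^ (1 - 1 / d : ℝ) := by
      rw [hr, div_eq_mul_inv, ← Real.rpow_neg hVpos.le]
      nth_rewrite 1 [← Real.rpow_one (#V : ℝ)]
      rw [← Real.rpow_add hVpos]
      refine Real.rpow_le_rpow hVpos.le (by exact_mod_cast hVm) ?_
      have : (1:ℝ) / d ≤ 1 := by
        rw [div_le_one (by positivity)]; exact_mod_cast hd
      linarith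
    have h3 : √((m : ℝ) ^ (1 - 1 / d : ℝ)) = m * (m : ℝ) ^ (-(1 / 2 + 1 / (2 * d)) : ℝ) := by
      rw [Real.sqrt_eq_rpow, ← Real.rpow_mul hmpos.le]
      nth_rewrite 2 [← Real.rpow_one (m : ℝ)]
      rw [← Real.rpow_add hmpos]
      congr 1; field_simp; ring
    calc α * (2 * chainScale d * √(netScale d * (#V / r)))
        ≤ α * (2 * chainScale d * √(netScale d * (m : ℝ) ^ (1 - 1 / d : ℝ))) := by gcongr
      _ = _ := by
        rw [Real.sqrt_mul hA.le, h3, hα, sparsifyConst]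
        field_simp
        ring

theorem exists_sparse_weights {ι X : Type*} [Fintype ι] [DecidableEq ι] [Fintype X]
    {P : X → Finset ι} {d : ℕ} (hd : 1 ≤ d) (hP : TraceDimLE P d) {N : ℕ}
    (hN : 2 * netScale d ^ d ≤ N) {K : ℝ} (a : ι → ℝ) (ha : ∀ k, 0 ≤ a k) (hK : ∑ k, a k = K) :
    ∃ a' : ι → ℝ, (∀ k, 0 ≤ a' k) ∧ ∑ k, a' k = K ∧ #(univ.filter fun k => a' k ≠ 0) ≤ N ∧
      ∀ x, |∑ k ∈ P x, a' k - ∑ k ∈ P x, a k| ≤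
        40 * sparsifyConst d * K * (N : ℝ) ^ (-(1 / 2 + 1 / (2 * d)) : ℝ) := by
  set β : ℝ := 1 / 2 + 1 / (2 * d) with hβ
  have hβ2 : 1 / 2 ≤ β := by
    have : (0:ℝ) ≤ 1 / (2 * d) := by positivity
    linarith
  have hc := sparsifyConst_pos d
  have hK0 : 0 ≤ K := hK ▸ sum_nonneg fun k _ => ha k
  have hA := netScale_pos d
  have hNpos : (0:ℝ) < N := lt_of_lt_of_le (by positivity) hN
  have key : ∀ m : ℕ, N ≤ m → ∀ a : ι → ℝ, (∀ k, 0 ≤ a k) → ∑ k, a k = K →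
      #(univ.filter fun k => a k ≠ 0) = m →
      ∃ a' : ι → ℝ, (∀ k, 0 ≤ a' k) ∧ ∑ k, a' k = K ∧ #(univ.filter fun k => a' k ≠ 0) ≤ N ∧
      ∀ x, |∑ k ∈ P x, a' k - ∑ k ∈ P x, a k| ≤
        20 * sparsifyConst d * K * (2 * (N : ℝ) ^ (-β) - (m : ℝ) ^ (-β)) := by
    intro m
    induction m using Nat.strong_induction_on with
    | _ m ih =>
      intro hNm a ha hK hm
      have hNm' : (N : ℝ) ≤ m := by exact_mod_cast hNm
      have hmpos : (0:ℝ) < m := hNpos.trans_le hNm'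
      have hmN : (m : ℝ) ^ (-β) ≤ (N : ℝ) ^ (-β) :=
        Real.rpow_le_rpow_of_nonpos hNpos hNm' (by linarith)
      have hmβ : 0 < (m : ℝ) ^ (-β) := by positivity
      obtain ⟨b, hb, hbK, hb8, hbP⟩ := exists_sparser_weights hd hP a ha hK
        (by rw [hm]; exact hN.trans hNm')
      rw [hm] at hb8 hbP
      have hcK : 0 ≤ sparsifyConst d * K := by positivity
      rcases le_or_gt N #(univ.filter fun k => b k ≠ 0) with h | h
      · obtain ⟨a', h1, h2, h3, h4⟩ := ih _ (by
          have : 0 < m := by exact_mod_cast hmpos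
          omega) h b hb hbK rfl
        refine ⟨a', h1, h2, h3, fun x => ?_⟩
        set m' := #(univ.filter fun k => b k ≠ 0)
        have hm'pos : (0:ℝ) < m' := hNpos.trans_le (by exact_mod_cast h)
        have hgrow : (1.05 : ℝ) * (m : ℝ) ^ (-β) ≤ (m' : ℝ) ^ (-β) := by
          have h8 : (8 * m' : ℝ) ≤ 7 * m := by exact_mod_cast hb8
          have h5 : (m' : ℝ) ≤ 7 / 8 * m := by linarith
          have h6 : (7 / 8 * (m : ℝ)) ^ (-β) ≤ (m' : ℝ) ^ (-β) :=
            Real.rpow_le_rpow_of_nonpos hm'pos h5 (by linarith)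
          rw [Real.mul_rpow (by norm_num) hmpos.le] at h6
          have h7 : (1.05 : ℝ) ≤ (7 / 8 : ℝ) ^ (-β) := by
            calc (1.05 : ℝ) ≤ (8 / 7 : ℝ) ^ (1 / 2 : ℝ) := by
                  rw [← Real.sqrt_eq_rpow]
                  exact Real.le_sqrt_of_sq_le (by norm_num)
              _ ≤ (8 / 7 : ℝ) ^ β := Real.rpow_le_rpow_of_exponent_le (by norm_num) hβ2
              _ = _ := by
                rw [Real.rpow_neg (by norm_num), ← Real.inv_rpow (by norm_num)]; norm_num
          exact (mul_le_mul_of_nonneg_right h7 hmβ.le).trans h6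
        have h9 := abs_sub_le (∑ k ∈ P x, a' k) (∑ k ∈ P x, b k) (∑ k ∈ P x, a k)
        have h10 := hbP x
        have h11 := h4 x
        have h12 := mul_le_mul_of_nonneg_left hgrow hcK
        linarith
      · refine ⟨b, hb, hbK, h.le, fun x => (hbP x).trans ?_⟩
        have h12 := mul_le_mul_of_nonneg_left hmN hcK
        have h13 := mul_nonneg hcK hmβ.le
        linarith
  rcases le_or_gt N #(univ.filter fun k => a k ≠ 0) with h | h
  · obtain ⟨a', h1, h2, h3, h4⟩ := key _ h a ha hK rfl
    refine ⟨a', h1, h2, h3, fun x => (h4 x).trans ?_⟩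
    have : 0 ≤ sparsifyConst d * K * (#(univ.filter fun k => a k ≠ 0) : ℝ) ^ (-β) := by positivity
    linarith
  · refine ⟨a, ha, hK, h.le, fun x => ?_⟩
    simp only [sub_self, abs_zero]; positivity

theorem sum_mul_ite_halfSpace {d : ℕ} {ι : Type*} [Fintype ι] (a : ι → ℝ) (w : ι → Fin d → ℝ)
    (t : ι → ℝ) (x : Fin d → ℝ) :
    ∑ k, a k * (if t k < w k ⬝ᵥ x then 1 else 0) = ∑ k ∈ halfSpaceTrace w t x, a k := by
  classical
  simp [halfSpaceTrace, sum_filter]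

/-- A finitely supported combination can be indexed by `Fin N`, padding with zeros. -/
theorem exists_fin_units {ι E : Type*} [Fintype ι] [Inhabited E] (a : ι → ℝ) (p : ι → E) {N : ℕ}
    (hN : #(univ.filter fun k => a k ≠ 0) ≤ N) {K : ℝ} (hK : 0 ≤ K) (ha : ∀ k, |a k| ≤ K) :
    ∃ (b : Fin N → ℝ) (q : Fin N → E), (∀ j, |b j| ≤ K) ∧
      ∀ g : E → ℝ, ∑ j, b j * g (q j) = ∑ k, a k * g (p k) := by
  classical
  set S := univ.filter fun k => a k ≠ 0 with hS
  let e := S.equivFin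
  let b : ℕ → ℝ := fun j => if h : j < #S then a (e.symm ⟨j, h⟩) else 0
  let q : ℕ → E := fun j => if h : j < #S then p (e.symm ⟨j, h⟩) else default
  refine ⟨fun j => b j, fun j => q j, fun j => ?_, fun g => ?_⟩
  · by_cases h : (j : ℕ) < #S
    · simpa [b, h] using ha _
    · simpa [b, h] using hK
  · rw [Fin.sum_univ_eq_sum_range (fun j => b j * g (q j)),
      ← sum_subset (range_subset_range.2 hN) (fun j _ hj => by
        simp only [mem_range] at hj
        simp [b, hj]),
      ← Fin.sum_univ_eq_sum_range (fun j => b j * g (q j))]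
    have h1 : ∀ j : Fin #S, b j * g (q j) = a (e.symm j) * g (p (e.symm j)) := by
      intro j; simp [b, q, j.2]
    simp_rw [h1]
    rw [Equiv.sum_comp e.symm (fun k : S => a k * g (p k)), sum_coe_sort S fun k => a k * g (p k)]
    refine sum_subset (subset_univ _) fun k _ hk => ?_
    have : a k = 0 := by simpa [hS] using hk
    simp [this]

theorem exists_sparse_halfSpaces {d : ℕ} (hd : 1 ≤ d) {N : ℕ} (hN : 2 * netScale d ^ d ≤ N)
    {ι : Type*} [Fintype ι] (a : ι → ℝ) (w : ι → Fin d → ℝ) (t : ι → ℝ) {K : ℝ}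
    (ha : ∑ k, |a k| ≤ K) (X : Finset (Fin d → ℝ)) :
    ∃ (b : Fin (N + N) → ℝ) (v : Fin (N + N) → Fin d → ℝ) (s : Fin (N + N) → ℝ),
      (∀ j, |b j| ≤ K) ∧ ∀ x ∈ X,
      |∑ j, b j * (if s j < v j ⬝ᵥ x then 1 else 0)
        - ∑ k, a k * (if t k < w k ⬝ᵥ x then 1 else 0)|
        ≤ 40 * sparsifyConst d * K * (N : ℝ) ^ (-(1 / 2 + 1 / (2 * d)) : ℝ) := by
  classical
  have hTr := traceDimLE_halfSpaceTrace w t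
  have hX : TraceDimLE (fun x : X => halfSpaceTrace w t x) d := fun T hT => hTr T fun u hu => by
    obtain ⟨x, hx⟩ := hT u hu
    exact ⟨x, hx⟩
  have hpm : ∑ k, (a k)⁺ + ∑ k, (a k)⁻ ≤ K := by
    rw [← sum_add_distrib]
    simpa [posPart_add_negPart] using ha
  have hp0 : 0 ≤ ∑ k, (a k)⁺ := sum_nonneg fun k _ => posPart_nonneg _
  have hn0 : 0 ≤ ∑ k, (a k)⁻ := sum_nonneg fun k _ => negPart_nonneg _
  have hK0 : 0 ≤ K := by linarith
  obtain ⟨p, hp, hpK, hpN, hpX⟩ := exists_sparse_weights hd hX hN (fun k => (a k)⁺)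
    (fun k => posPart_nonneg _) rfl
  obtain ⟨n, hn, hnK, hnN, hnX⟩ := exists_sparse_weights hd hX hN (fun k => (a k)⁻)
    (fun k => negPart_nonneg _) rfl
  obtain ⟨b₁, q₁, hb₁, hg₁⟩ := exists_fin_units p (fun k => (w k, t k)) hpN hK0 fun k => by
    rw [abs_of_nonneg (hp k)]
    have := single_le_sum (fun j _ => hp j) (mem_univ k)
    linarith
  obtain ⟨b₂, q₂, hb₂, hg₂⟩ := exists_fin_units n (fun k => (w k, t k)) hnN hK0 fun k => by
    rw [abs_of_nonneg (hn k)]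
    have := single_le_sum (fun j _ => hn j) (mem_univ k)
    linarith
  refine ⟨Fin.append b₁ fun j => -b₂ j, fun j => (Fin.append q₁ q₂ j).1,
    fun j => (Fin.append q₁ q₂ j).2, fun j => ?_, fun x hx => ?_⟩
  · refine Fin.addCases (fun i => ?_) (fun i => ?_) j
    · simpa using hb₁ i
    · simpa only [Fin.append_right, abs_neg] using hb₂ i
  · rw [Fin.sum_univ_add]
    simp only [Fin.append_left, Fin.append_right, neg_mul, sum_neg_distrib]
    have e1 := hg₁ fun q => if q.2 < q.1 ⬝ᵥ x then 1 else 0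
    have e2 := hg₂ fun q => if q.2 < q.1 ⬝ᵥ x then 1 else 0
    simp only at e1 e2
    rw [e1, e2, sum_mul_ite_halfSpace, sum_mul_ite_halfSpace, sum_mul_ite_halfSpace]
    have h1 := hpX ⟨x, hx⟩
    have h2 := hnX ⟨x, hx⟩
    have h3 : ∑ k ∈ halfSpaceTrace w t x, a k = ∑ k ∈ halfSpaceTrace w t x, (a k)⁺
        - ∑ k ∈ halfSpaceTrace w t x, (a k)⁻ := by
      rw [← sum_sub_distrib]
      exact sum_congr rfl fun k _ => (posPart_sub_negPart _).symm
    rw [h3]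
    have hc := sparsifyConst_pos d
    set R := (N : ℝ) ^ (-(1 / 2 + 1 / (2 * d)) : ℝ)
    have hR : 0 ≤ R := by positivity
    have h4 : 40 * sparsifyConst d * (∑ k, (a k)⁺) * R + 40 * sparsifyConst d * (∑ k, (a k)⁻) * R
        ≤ 40 * sparsifyConst d * K * R := by
      rw [← add_mul, ← mul_add]; gcongr
    refine le_trans ?_ ((add_le_add h1 h2).trans h4)
    refine le_trans (le_of_eq ?_) (abs_sub _ _)
    congr 1; ring

theorem exists_normalized_halfSpace {d : ℕ} (w : Fin d → ℝ) (t : ℝ) :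
    ∃ q : (Fin d → ℝ) × ℝ, ‖q‖ = 1 ∧ ∀ x, t < w ⬝ᵥ x ↔ q.2 < q.1 ⬝ᵥ x := by
  by_cases h : (w, t) = 0
  · obtain ⟨rfl, rfl⟩ := Prod.mk_eq_zero.1 h
    exact ⟨(0, 1), by simp [Prod.norm_def], fun x => by simp⟩
  · have hpos : 0 < ‖(w, t)‖ := norm_pos_iff.2 h
    refine ⟨‖(w, t)‖⁻¹ • (w, t), by
      rw [norm_smul, norm_inv, norm_norm, inv_mul_cancel₀ hpos.ne'], fun x => ?_⟩
    simp only [Prod.smul_mk, smul_dotProduct, smul_eq_mul]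
    exact (mul_lt_mul_iff_right₀ (inv_pos.2 hpos)).symm

/-- Approximation by `n` half-spaces passes from finite sets to arbitrary sets, up to the choice of
values on the boundaries. -/
theorem exists_limit_halfSpaces {d n : ℕ} {f : (Fin d → ℝ) → ℝ} {B : Set (Fin d → ℝ)} {K η : ℝ}
    (h : ∀ X : Finset (Fin d → ℝ), ↑X ⊆ B → ∃ (a : Fin n → ℝ) (w : Fin n → Fin d → ℝ)
      (t : Fin n → ℝ), (∀ k, |a k| ≤ K) ∧
        ∀ x ∈ X, |f x - ∑ k, a k * (if t k < w k ⬝ᵥ x then 1 else 0)| ≤ η) :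
    ∃ (a : Fin n → ℝ) (q : Fin n → (Fin d → ℝ) × ℝ), (∀ k, q k ≠ 0) ∧
      ∀ x ∈ B, ∃ σ : Fin n → Bool, (∀ k, σ k = true → (q k).2 ≤ (q k).1 ⬝ᵥ x) ∧
        (∀ k, σ k = false → (q k).1 ⬝ᵥ x ≤ (q k).2) ∧
        |f x - ∑ k, a k * (if σ k then 1 else 0)| ≤ η := by
  let S : Set ((Fin n → ℝ) × (Fin n → (Fin d → ℝ) × ℝ)) := Set.Icc (fun _ => -K) (fun _ => K) ×ˢ
    Set.univ.pi fun _ => Metric.sphere (0 : (Fin d → ℝ) × ℝ) 1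
  have hS : IsCompact S := isCompact_Icc.prod (isCompact_univ_pi fun _ => isCompact_sphere _ _)
  let C : B → Set ((Fin n → ℝ) × (Fin n → (Fin d → ℝ) × ℝ)) := fun x => ⋃ σ : Fin n → Bool,
    {p | (∀ k, σ k = true → (p.2 k).2 ≤ (p.2 k).1 ⬝ᵥ x.1) ∧
      (∀ k, σ k = false → (p.2 k).1 ⬝ᵥ x.1 ≤ (p.2 k).2) ∧
      |f x - ∑ k, p.1 k * (if σ k then 1 else 0)| ≤ η}
  have hC : ∀ x, IsClosed (C x) := by
    intro x
    refine isClosed_iUnion_of_finite fun σ => ?_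
    have hdot : ∀ k, Continuous fun p : (Fin n → ℝ) × (Fin n → (Fin d → ℝ) × ℝ) =>
        (p.2 k).1 ⬝ᵥ x.1 := fun k => by
      unfold dotProduct; fun_prop
    have h2 : ∀ k, Continuous fun p : (Fin n → ℝ) × (Fin n → (Fin d → ℝ) × ℝ) =>
        (p.2 k).2 := fun k => by fun_prop
    have h1 : IsClosed {p : (Fin n → ℝ) × (Fin n → (Fin d → ℝ) × ℝ) |
        ∀ k, σ k = true → (p.2 k).2 ≤ (p.2 k).1 ⬝ᵥ x.1} := by
      simp only [Set.ofPred_forall]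
      exact isClosed_iInter fun k => isClosed_iInter fun _ => isClosed_le (h2 k) (hdot k)
    have h3 : IsClosed {p : (Fin n → ℝ) × (Fin n → (Fin d → ℝ) × ℝ) |
        ∀ k, σ k = false → (p.2 k).1 ⬝ᵥ x.1 ≤ (p.2 k).2} := by
      simp only [Set.ofPred_forall]
      exact isClosed_iInter fun k => isClosed_iInter fun _ => isClosed_le (hdot k) (h2 k)
    have h4 : IsClosed {p : (Fin n → ℝ) × (Fin n → (Fin d → ℝ) × ℝ) |
        |f x - ∑ k, p.1 k * (if σ k then 1 else 0)| ≤ η} :=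
      isClosed_le (by fun_prop) continuous_const
    exact h1.inter (h3.inter h4)
  obtain ⟨p, hpS, hpC⟩ := hS.inter_iInter_nonempty C hC fun U => by
    classical
    obtain ⟨a, w, t, ha, hX⟩ := h (U.image Subtype.val) (by
      intro x hx
      obtain ⟨y, _, rfl⟩ := mem_image.1 (mem_coe.1 hx)
      exact y.2)
    choose q hq1 hq using fun k => exists_normalized_halfSpace (w k) (t k)
    refine ⟨(a, q), ⟨⟨fun k => (abs_le.1 (ha k)).1, fun k => (abs_le.1 (ha k)).2⟩,
      fun k _ => by simpa using hq1 k⟩, ?_⟩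
    simp only [Set.mem_iInter]
    intro x hx
    refine Set.mem_iUnion.2 ⟨fun k => decide ((q k).2 < (q k).1 ⬝ᵥ x.1), fun k hk => ?_,
      fun k hk => ?_, ?_⟩
    · exact (of_decide_eq_true hk).le
    · exact not_lt.1 (of_decide_eq_false hk)
    · have := hX x (mem_image_of_mem _ hx)
      simpa only [hq, decide_eq_true_eq] using this
  refine ⟨p.1, p.2, fun k h0 => ?_, fun x hx => ?_⟩
  · have := hpS.2 k (Set.mem_univ k)
    rw [h0] at this
    simp at this
  · exact Set.mem_iUnion.1 (Set.mem_iInter.1 hpC ⟨x, hx⟩)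

theorem exists_norm_le_one_dotProduct_ne_zero {d n : ℕ} (w : Fin n → Fin d → ℝ) :
    ∃ v : Fin d → ℝ, ‖v‖ ≤ 1 ∧ ∀ k, w k ≠ 0 → w k ⬝ᵥ v ≠ 0 := by
  obtain ⟨v, hv⟩ := Module.Dual.exists_forall_ne_zero_of_forall_exists (K := ℝ) (M := Fin d → ℝ)
    (fun k : {k // w k ≠ 0} => dotProductBilin ℝ ℝ (w k)) fun k => by
      refine ⟨w k, ?_⟩
      simpa using k.2
  by_cases h0 : v = 0
  · refine ⟨0, by simp, fun k hk => ?_⟩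
    have := hv ⟨k, hk⟩
    simp [h0] at this
  · have hpos : 0 < ‖v‖ := norm_pos_iff.2 h0
    refine ⟨‖v‖⁻¹ • v, ?_, fun k hk => ?_⟩
    · rw [norm_smul, norm_inv, norm_norm, inv_mul_cancel₀ hpos.ne']
    · rw [dotProduct_smul, smul_eq_mul]
      exact mul_ne_zero (inv_ne_zero hpos.ne') (by simpa using hv ⟨k, hk⟩)

/-- A primitive of the indicator of `0 < r + u * α` in the variable `u`. -/
noncomputable def rampPrimitive (r α u : ℝ) : ℝ :=
  if α = 0 then (if 0 < r then u else 0) else max 0 (r + u * α) / α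

open Filter Topology in
theorem eventually_pos_iff_nhdsGT {r α : ℝ} (h : α = 0 → r ≠ 0) (u : ℝ) :
    ∀ᶠ u' in 𝓝[>] u, r + u' * α ≠ 0 ∧
      (0 < r + u' * α ↔ 0 < r + u * α ∨ r + u * α = 0 ∧ 0 < α) := by
  have hc : ContinuousAt (fun u' : ℝ => r + u' * α) u := by fun_prop
  rcases lt_trichotomy (r + u * α) 0 with hs | hs | hs
  · filter_upwards [nhdsWithin_le_nhds (hc.eventually (gt_mem_nhds hs))] with u' hu'
    exact ⟨hu'.ne, by constructor <;> intro h' <;> grind⟩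
  · have hα : α ≠ 0 := fun h0 => h h0 (by simpa [h0] using hs)
    filter_upwards [self_mem_nhdsWithin] with u' hu'
    have hu : 0 < u' - u := sub_pos.2 hu'
    have e : r + u' * α = (u' - u) * α := by linear_combination hs
    rw [e]
    refine ⟨mul_ne_zero hu.ne' hα, ?_⟩
    simp [hs, mul_pos_iff_of_pos_left hu]
  · filter_upwards [nhdsWithin_le_nhds (hc.eventually (lt_mem_nhds hs))] with u' hu'
    exact ⟨hu'.ne', by simp [hu', hs]⟩

open Filter Topology in
theorem hasDerivWithinAt_rampPrimitive {r α : ℝ} (h : α = 0 → r ≠ 0) (u : ℝ) :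
    HasDerivWithinAt (rampPrimitive r α)
      (if 0 < r + u * α ∨ r + u * α = 0 ∧ 0 < α then 1 else 0) (Set.Ici u) u := by
  by_cases hα : α = 0
  · have hr : (0 < r + u * α ∨ r + u * α = 0 ∧ 0 < α) ↔ 0 < r := by simp [hα]
    have e : rampPrimitive r α = fun u => if 0 < r then u else 0 := by
      ext u; simp [rampPrimitive, hα]
    rw [e]; simp only [hr]
    split_ifs
    · exact hasDerivWithinAt_id _ _
    · exact hasDerivWithinAt_const _ _ _
  · rw [← hasDerivWithinAt_Ioi_iff_Ici]
    have hev := eventually_pos_iff_nhdsGT h u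
    have hlin : HasDerivWithinAt (fun u' : ℝ => (r + u' * α) / α) 1 (Set.Ioi u) u := by
      have := (((hasDerivAt_id u).mul_const α).const_add r).div_const α
      simp only [one_mul, div_self hα, id] at this
      exact this.hasDerivWithinAt
    split_ifs with hP
    · refine hlin.congr_of_eventuallyEq ?_ ?_
      · filter_upwards [hev] with u' hu'
        simp [rampPrimitive, hα, max_eq_right (hu'.2.2 hP).le]
      · have : 0 ≤ r + u * α := by grind
        simp [rampPrimitive, hα, max_eq_right this]
    · refine (hasDerivWithinAt_const u _ (0 : ℝ)).congr_of_eventuallyEq ?_ ?_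
      · filter_upwards [hev] with u' hu'
        have : r + u' * α ≤ 0 := not_lt.1 fun h' => hP (hu'.2.1 h')
        simp [rampPrimitive, hα, max_eq_left this]
      · have : r + u * α ≤ 0 := by grind
        simp [rampPrimitive, hα, max_eq_left this]

theorem continuous_rampPrimitive (r α : ℝ) : Continuous (rampPrimitive r α) := by
  unfold rampPrimitive
  split_ifs <;> fun_prop

open Filter Topology in
/-- Averaging half-spaces along a generic direction turns them into differences of two ReLUs. -/
theorem exists_relu_of_limit_halfSpaces {d n : ℕ} {f : (Fin d → ℝ) → ℝ} {L η δ : ℝ} (hL : 0 < L)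
    (hf : ∀ x y, |f x - f y| ≤ L * ‖x - y‖) (hδ : 0 < δ) (a : Fin n → ℝ)
    (q : Fin n → (Fin d → ℝ) × ℝ) (hq : ∀ k, q k ≠ 0)
    (h : ∀ x ∈ Metric.closedBall (0 : Fin d → ℝ) 2, ∃ σ : Fin n → Bool,
      (∀ k, σ k = true → (q k).2 ≤ (q k).1 ⬝ᵥ x) ∧ (∀ k, σ k = false → (q k).1 ⬝ᵥ x ≤ (q k).2) ∧
        |f x - ∑ k, a k * (if σ k then 1 else 0)| ≤ η) :
    ∃ (a' b' : Fin (n + n) → ℝ) (w' : Fin (n + n) → Fin d → ℝ),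
      ∀ x ∈ Metric.closedBall (0 : Fin d → ℝ) 1,
        |f x - ∑ k, a' k * max 0 (w' k ⬝ᵥ x + b' k)| ≤ η + δ := by
  obtain ⟨v, hv1, hv⟩ := exists_norm_le_one_dotProduct_ne_zero fun k => (q k).1
  obtain ⟨τ, hτ0, hτ1, hτδ⟩ : ∃ τ : ℝ, 0 < τ ∧ τ ≤ 1 ∧ L * τ ≤ δ := by
    refine ⟨min 1 (δ / L), by positivity, min_le_left _ _, ?_⟩
    calc L * min 1 (δ / L) ≤ L * (δ / L) := by gcongr; exact min_le_right _ _
      _ = δ := mul_div_cancel₀ _ hL.ne'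
  have hgen : ∀ x : Fin d → ℝ, ∀ k, (q k).1 ⬝ᵥ v = 0 → (q k).1 ⬝ᵥ x - (q k).2 ≠ 0 := by
    intro x k h0 h1
    have hw : (q k).1 = 0 := by
      by_contra hne; exact hv k hne h0
    refine hq k (Prod.ext hw ?_)
    simpa [hw] using h1
  have key : ∀ x ∈ Metric.closedBall (0 : Fin d → ℝ) 1,
      |f x - ∑ k, a k * ((rampPrimitive ((q k).1 ⬝ᵥ x - (q k).2) ((q k).1 ⬝ᵥ v) τ
        - rampPrimitive ((q k).1 ⬝ᵥ x - (q k).2) ((q k).1 ⬝ᵥ v) 0) / τ)| ≤ η + δ := by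
    intro x hx
    set r : Fin n → ℝ := fun k => (q k).1 ⬝ᵥ x - (q k).2 with hr
    set α : Fin n → ℝ := fun k => (q k).1 ⬝ᵥ v with hα
    let P : ℝ → Fin n → Prop := fun u k => 0 < r k + u * α k ∨ r k + u * α k = 0 ∧ 0 < α k
    classical
    have hder : ∀ u ∈ Set.Ico 0 τ, HasDerivWithinAt
        (fun u => ∑ k, a k * rampPrimitive (r k) (α k) u - f x * u)
        (∑ k, a k * (if P u k then 1 else 0) - f x) (Set.Ici u) u := by
      intro u _
      refine HasDerivWithinAt.sub (HasDerivWithinAt.fun_sum fun k _ => ?_) ?_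
      · exact (hasDerivWithinAt_rampPrimitive (hgen x k) u).const_mul (a k)
      · simpa using (hasDerivWithinAt_id u (Set.Ici u)).const_mul (f x)
    have hbd : ∀ u ∈ Set.Ico 0 τ, ‖∑ k, a k * (if P u k then 1 else 0) - f x‖ ≤ η + δ := by
      intro u hu
      have hev : ∀ᶠ u' in 𝓝[>] u, ∀ k, r k + u' * α k ≠ 0 ∧ (0 < r k + u' * α k ↔ P u k) :=
        eventually_all.2 fun k => eventually_pos_iff_nhdsGT (hgen x k) u
      obtain ⟨u', hu', hmem⟩ := (hev.and (Ioo_mem_nhdsGT hu.2)).exists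
      have hu0 : 0 < u' := hu.1.trans_lt hmem.1
      have hxv : ‖u' • v‖ ≤ u' := by
        rw [norm_smul, Real.norm_of_nonneg hu0.le]
        exact mul_le_of_le_one_right hu0.le hv1
      have hx2 : x + u' • v ∈ Metric.closedBall (0 : Fin d → ℝ) 2 := by
        rw [mem_closedBall_zero_iff] at hx ⊢
        linarith [norm_add_le x (u' • v), hmem.2]
      obtain ⟨σ, h1, h2, h3⟩ := h _ hx2
      have hs : ∀ k, (q k).1 ⬝ᵥ (x + u' • v) - (q k).2 = r k + u' * α k := by
        intro k; simp only [dotProduct_add, dotProduct_smul, smul_eq_mul, hr, hα]; ring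
      have hσ : ∀ k, σ k = true ↔ P u k := by
        intro k
        rw [← (hu' k).2]
        have hne := (hu' k).1
        have e := hs k
        constructor
        · intro hk
          exact lt_of_le_of_ne (by linarith [h1 k hk]) hne.symm
        · intro hk
          by_contra hk'
          linarith [h2 k (by simpa using hk')]
      simp only [hσ] at h3
      have h4 := hf (x + u' • v) x
      rw [add_sub_cancel_left] at h4
      have h5 : L * ‖u' • v‖ ≤ δ := le_trans (by gcongr; linarith [hmem.2]) hτδ
      rw [Real.norm_eq_abs, abs_le]
      rw [abs_le] at h3 h4
      constructor <;> linarith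
    have hcont : ContinuousOn (fun u => ∑ k, a k * rampPrimitive (r k) (α k) u - f x * u)
        (Set.Icc 0 τ) := by
      refine Continuous.continuousOn ?_
      have := fun k => continuous_rampPrimitive (r k) (α k)
      fun_prop
    have hmv := norm_image_sub_le_of_norm_deriv_right_le_segment hcont hder hbd τ
      (Set.right_mem_Icc.2 hτ0.le)
    rw [Real.norm_eq_abs] at hmv
    have e : f x - ∑ k, a k * ((rampPrimitive (r k) (α k) τ - rampPrimitive (r k) (α k) 0) / τ)
        = -((∑ k, a k * rampPrimitive (r k) (α k) τ - f x * τ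
          - (∑ k, a k * rampPrimitive (r k) (α k) 0 - f x * 0)) / τ) := by
      have : ∑ k, a k * ((rampPrimitive (r k) (α k) τ - rampPrimitive (r k) (α k) 0) / τ)
          = (∑ k, a k * rampPrimitive (r k) (α k) τ
            - ∑ k, a k * rampPrimitive (r k) (α k) 0) / τ := by
        rw [← sum_sub_distrib, sum_div]
        exact sum_congr rfl fun k _ => by ring
      rw [this]
      field_simp
      ring
    rw [e, abs_neg, abs_div, abs_of_pos hτ0, div_le_iff₀ hτ0]
    simpa using hmv
  let α : Fin n → ℝ := fun k => (q k).1 ⬝ᵥ v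
  refine ⟨Fin.append
      (fun k => if α k = 0 then a k * (if 0 < -(q k).2 then 1 else 0) else a k / (τ * α k))
      (fun k => if α k = 0 then 0 else -(a k / (τ * α k))),
    Fin.append (fun k => if α k = 0 then 1 else -(q k).2 + τ * α k) (fun k => -(q k).2),
    Fin.append (fun k => (q k).1) (fun k => (q k).1), fun x hx => ?_⟩
  rw [Fin.sum_univ_add]
  simp only [Fin.append_left, Fin.append_right]
  rw [← sum_add_distrib]
  refine le_of_eq_of_le ?_ (key x hx)
  congr 2
  refine sum_congr rfl fun k _ => ?_
  by_cases h0 : α k = 0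
  · have hw : (q k).1 = 0 := by
      by_contra hne; exact hv k hne h0
    simp only [rampPrimitive, h0, hw, if_true, zero_dotProduct, zero_sub, zero_add, zero_mul]
    split_ifs
    · field_simp; simp
    · simp
  · have h0' : (q k).1 ⬝ᵥ v ≠ 0 := h0
    have e1 : (q k).1 ⬝ᵥ x + (-(q k).2 + τ * (q k).1 ⬝ᵥ v)
      = (q k).1 ⬝ᵥ x - (q k).2 + τ * (q k).1 ⬝ᵥ v := by ring
    simp only [rampPrimitive, h0, h0', if_false, zero_mul, add_zero]
    simp only [α, e1, ← sub_eq_add_neg]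
    field_simp
    ring

open MeasureTheory in
theorem integrable_exp_neg_mul_dotProduct {d : ℕ} {b : ℝ} (hb : 0 < b) :
    Integrable fun v : Fin d → ℝ => Real.exp (-b * v ⬝ᵥ v) := by
  have h := GaussianFourier.integrable_cexp_neg_mul_sum_add (ι := Fin d) (b := (b : ℂ))
    (by simpa using hb) 0
  refine h.re.congr (Filter.Eventually.of_forall fun v => ?_)
  have : (-(b : ℂ) * ∑ i, (v i : ℂ) ^ 2 + ∑ i, (0 : Fin d → ℂ) i * v i)
      = ((-b * v ⬝ᵥ v : ℝ) : ℂ) := by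
    simp [dotProduct, sq]
  simp only [this, RCLike.re_eq_complex_re]
  rw [← Complex.ofReal_exp, Complex.ofReal_re]

open MeasureTheory in
theorem integral_exp_neg_mul_dotProduct_mul_cos {d : ℕ} {b : ℝ} (hb : 0 < b) (z : Fin d → ℝ) :
    ∫ v : Fin d → ℝ, Real.exp (-b * v ⬝ᵥ v) * Real.cos (v ⬝ᵥ z)
      = (Real.pi / b) ^ ((d : ℝ) / 2) * Real.exp (-(z ⬝ᵥ z) / (4 * b)) := by
  have hb' : 0 < (b : ℂ).re := by simpa using hb
  have h := GaussianFourier.integral_cexp_neg_mul_sum_add (ι := Fin d) hb'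
    (fun i => Complex.I * z i)
  have hi := GaussianFourier.integrable_cexp_neg_mul_sum_add (ι := Fin d) hb'
    (fun i => Complex.I * z i)
  have e1 : ∀ v : Fin d → ℝ, (Complex.exp (-(b : ℂ) * ∑ i, (v i : ℂ) ^ 2
      + ∑ i, Complex.I * z i * v i)).re = Real.exp (-b * v ⬝ᵥ v) * Real.cos (v ⬝ᵥ z) := by
    intro v
    have : (-(b : ℂ) * ∑ i, (v i : ℂ) ^ 2 + ∑ i, Complex.I * z i * v i)
        = ((-b * v ⬝ᵥ v : ℝ) : ℂ) + ((v ⬝ᵥ z : ℝ) : ℂ) * Complex.I := by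
      simp only [dotProduct, sq]
      push_cast
      rw [sum_mul]
      congr 1
      exact sum_congr rfl fun i _ => by ring
    rw [this, Complex.exp_re]
    simp
  have e2 : (Real.pi / (b : ℂ)) ^ ((Fintype.card (Fin d) : ℂ) / 2)
      * Complex.exp ((∑ i, (Complex.I * (z i : ℂ)) ^ 2) / (4 * b))
      = (((Real.pi / b) ^ ((d : ℝ) / 2) * Real.exp (-(z ⬝ᵥ z) / (4 * b)) : ℝ) : ℂ) := by
    have : (∑ i, (Complex.I * (z i : ℂ)) ^ 2) = ((-(z ⬝ᵥ z) : ℝ) : ℂ) := by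
      simp only [dotProduct, mul_pow, Complex.I_sq]
      push_cast
      rw [← sum_neg_distrib]
      exact sum_congr rfl fun i _ => by ring
    rw [this, Complex.ofReal_mul, Complex.ofReal_cpow (by positivity)]
    push_cast
    simp
  rw [e2] at h
  have h3 := congrArg Complex.re h
  rw [Complex.ofReal_re] at h3
  rw [← h3, ← RCLike.re_eq_complex_re, ← integral_re hi]
  simp only [RCLike.re_eq_complex_re, e1]

open MeasureTheory in
theorem integral_exp_neg_mul_dotProduct {d : ℕ} {b : ℝ} (hb : 0 < b) :
    ∫ v : Fin d → ℝ, Real.exp (-b * v ⬝ᵥ v) = (Real.pi / b) ^ ((d : ℝ) / 2) := by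
  simpa using integral_exp_neg_mul_dotProduct_mul_cos (d := d) hb 0

theorem norm_sq_le_dotProduct_self {d : ℕ} (v : Fin d → ℝ) : ‖v‖ ^ 2 ≤ v ⬝ᵥ v := by
  have h0 : 0 ≤ v ⬝ᵥ v := sum_nonneg fun i _ => mul_self_nonneg _
  have : ‖v‖ ≤ √(v ⬝ᵥ v) := by
    refine (pi_norm_le_iff_of_nonneg (Real.sqrt_nonneg _)).2 fun i => ?_
    refine Real.le_sqrt_of_sq_le ?_
    rw [Real.norm_eq_abs, sq_abs, sq]
    exact single_le_sum (f := fun i => v i * v i) (fun i _ => mul_self_nonneg _) (mem_univ i)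
  calc ‖v‖ ^ 2 ≤ √(v ⬝ᵥ v) ^ 2 := by gcongr
    _ = _ := Real.sq_sqrt h0

theorem abs_dotProduct_le {d : ℕ} (v x : Fin d → ℝ) : |v ⬝ᵥ x| ≤ d * ‖v‖ * ‖x‖ := by
  unfold dotProduct
  refine (abs_sum_le_sum_abs _ _).trans ?_
  calc ∑ i, |v i * x i| ≤ ∑ _i : Fin d, ‖v‖ * ‖x‖ := by
        refine sum_le_sum fun i _ => ?_
        rw [abs_mul]
        exact mul_le_mul (norm_le_pi_norm v i) (norm_le_pi_norm x i) (abs_nonneg _)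
          (norm_nonneg _)
    _ = _ := by simp [mul_assoc]

/-- A Lipschitz function supported in the ball of radius `3`. -/
structure IsLipschitzBump {d : ℕ} (φ : (Fin d → ℝ) → ℝ) : Prop where
  abs_sub_le : ∀ x y, |φ x - φ y| ≤ 2 * ‖x - y‖
  abs_le_one : ∀ x, |φ x| ≤ 1
  eq_zero : ∀ x, 3 ≤ ‖x‖ → φ x = 0

namespace IsLipschitzBump

variable {d : ℕ} {φ : (Fin d → ℝ) → ℝ}

theorem continuous (h : IsLipschitzBump φ) : Continuous φ :=
  (LipschitzWith.of_dist_le_mul (K := 2) fun x y => by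
    simpa [Real.dist_eq, dist_eq_norm] using h.abs_sub_le x y).continuous

theorem abs_le_indicator (h : IsLipschitzBump φ) (x : Fin d → ℝ) :
    |φ x| ≤ (Metric.closedBall (0 : Fin d → ℝ) 3).indicator 1 x := by
  by_cases hx : x ∈ Metric.closedBall (0 : Fin d → ℝ) 3
  · simpa [hx] using h.abs_le_one x
  · have : φ x = 0 := h.eq_zero x (by
      rw [mem_closedBall_zero_iff, not_le] at hx; exact hx.le)
    simp [this, hx]

open MeasureTheory in
theorem integrable (h : IsLipschitzBump φ) : Integrable φ := by
  refine h.continuous.integrable_of_hasCompactSupport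
    (HasCompactSupport.of_support_subset_isCompact (isCompact_closedBall (0 : Fin d → ℝ) 3) ?_)
  intro x hx
  by_contra hx'
  rw [mem_closedBall_zero_iff, not_le] at hx'
  exact hx (h.eq_zero x hx'.le)

open MeasureTheory in
theorem integral_abs_le (h : IsLipschitzBump φ) : ∫ x, |φ x| ≤ 6 ^ d := by
  calc ∫ x, |φ x| ≤ ∫ x, (Metric.closedBall (0 : Fin d → ℝ) 3).indicator (1 : (Fin d → ℝ) → ℝ) x :=
        integral_mono h.integrable.abs
          ((integrable_indicator_iff measurableSet_closedBall).2
            (integrableOn_const measure_closedBall_lt_top.ne)) h.abs_le_indicator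
    _ = 6 ^ d := by
        rw [integral_indicator_one measurableSet_closedBall, Measure.real,
          Real.volume_pi_closedBall _ (by norm_num), ENNReal.toReal_ofReal (by positivity)]
        norm_num

end IsLipschitzBump

theorem pi_div_sq_div_rpow {d : ℕ} {m k : ℝ} (hm : 0 < m) (hk : 0 < k) :
    (Real.pi / (m ^ 2 / k)) ^ ((d : ℝ) / 2) = (k * Real.pi) ^ ((d : ℝ) / 2) / m ^ d := by
  have e : Real.pi / (m ^ 2 / k) = (k * Real.pi) / m ^ 2 := by field_simp
  rw [e, Real.div_rpow (by positivity) (by positivity)]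
  congr 1
  rw [← Real.rpow_natCast m 2, ← Real.rpow_mul hm.le, ← Real.rpow_natCast m d]
  congr 1
  push_cast
  ring

theorem mul_norm_mul_exp_le {d : ℕ} {m : ℝ} (hm : 0 < m) (z : Fin d → ℝ) :
    m * ‖z‖ * Real.exp (-(m ^ 2 / 2) * z ⬝ᵥ z) ≤ Real.exp (-(m ^ 2 / 4) * z ⬝ᵥ z) := by
  have h1 := norm_sq_le_dotProduct_self z
  have h2 := Real.add_one_le_exp (m ^ 2 / 4 * z ⬝ᵥ z)
  have h3 : m ^ 2 / 4 * ‖z‖ ^ 2 ≤ m ^ 2 / 4 * z ⬝ᵥ z := by gcongr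
  have h4 : m * ‖z‖ ≤ Real.exp (m ^ 2 / 4 * z ⬝ᵥ z) := by
    nlinarith [sq_nonneg (m * ‖z‖ / 2 - 1)]
  have e : Real.exp (-(m ^ 2 / 4) * z ⬝ᵥ z)
      = Real.exp (m ^ 2 / 4 * z ⬝ᵥ z) * Real.exp (-(m ^ 2 / 2) * z ⬝ᵥ z) := by
    rw [← Real.exp_add]; congr 1; ring
  rw [e]; gcongr

theorem sq_mul_norm_mul_exp_le {d : ℕ} (m : ℝ) (z : Fin d → ℝ) :
    m ^ 2 * ‖z‖ ^ 2 * Real.exp (-(m ^ 2 / 2) * z ⬝ᵥ z)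
      ≤ 4 * Real.exp (-(m ^ 2 / 4) * z ⬝ᵥ z) := by
  have h1 := norm_sq_le_dotProduct_self z
  have h2 := Real.add_one_le_exp (m ^ 2 / 4 * z ⬝ᵥ z)
  have h3 : m ^ 2 / 4 * ‖z‖ ^ 2 ≤ m ^ 2 / 4 * z ⬝ᵥ z := by gcongr
  have h4 : m ^ 2 * ‖z‖ ^ 2 ≤ 4 * Real.exp (m ^ 2 / 4 * z ⬝ᵥ z) := by linarith
  have e : Real.exp (-(m ^ 2 / 4) * z ⬝ᵥ z)
      = Real.exp (m ^ 2 / 4 * z ⬝ᵥ z) * Real.exp (-(m ^ 2 / 2) * z ⬝ᵥ z) := by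
    rw [← Real.exp_add]; congr 1; ring
  rw [e, ← mul_assoc]; gcongr

@[fun_prop]
theorem continuous_dotProduct' {α : Type*} [TopologicalSpace α] {d : ℕ} {f g : α → Fin d → ℝ}
    (hf : Continuous f) (hg : Continuous g) : Continuous fun x => f x ⬝ᵥ g x := by
  unfold dotProduct; fun_prop

/-- The unnormalised Gaussian `exp (-b |z|²)`. -/
noncomputable def gaussKernel {d : ℕ} (b : ℝ) (z : Fin d → ℝ) : ℝ := Real.exp (-b * z ⬝ᵥ z)

theorem gaussKernel_pos {d : ℕ} (b : ℝ) (z : Fin d → ℝ) : 0 < gaussKernel b z := Real.exp_pos _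

theorem gaussKernel_sub_comm {d : ℕ} (b : ℝ) (x y : Fin d → ℝ) :
    gaussKernel b (x - y) = gaussKernel b (y - x) := by
  unfold gaussKernel
  rw [← neg_sub y x, neg_dotProduct_neg]

@[fun_prop]
theorem continuous_gaussKernel {d : ℕ} (b : ℝ) :
    Continuous (gaussKernel b : (Fin d → ℝ) → ℝ) := by
  unfold gaussKernel; fun_prop

open MeasureTheory in
theorem integrable_gaussKernel {d : ℕ} {b : ℝ} (hb : 0 < b) :
    Integrable (gaussKernel b : (Fin d → ℝ) → ℝ) := integrable_exp_neg_mul_dotProduct hb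

open MeasureTheory in
theorem integral_gaussKernel {d : ℕ} {b : ℝ} (hb : 0 < b) :
    ∫ v : Fin d → ℝ, gaussKernel b v = (Real.pi / b) ^ ((d : ℝ) / 2) :=
  integral_exp_neg_mul_dotProduct hb

open MeasureTheory in
theorem IsLipschitzBump.abs_gaussian_average_sub_le {d : ℕ} {φ : (Fin d → ℝ) → ℝ}
    (h : IsLipschitzBump φ) {m : ℝ} (hm : 0 < m) (x : Fin d → ℝ) :
    |(∫ y, φ y * gaussKernel (m ^ 2 / 2) (x - y))
        - φ x * ((2 * Real.pi) ^ ((d : ℝ) / 2) / m ^ d)|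
      ≤ 2 / m * ((4 * Real.pi) ^ ((d : ℝ) / 2) / m ^ d) := by
  have hi : ∀ b : ℝ, 0 < b → Integrable fun y : Fin d → ℝ => gaussKernel b (x - y) :=
    fun b hb => (integrable_gaussKernel hb).comp_sub_left x
  have hgauss : ∀ b : ℝ, 0 < b → ∫ y : Fin d → ℝ, gaussKernel b (x - y)
      = (Real.pi / b) ^ ((d : ℝ) / 2) := fun b hb => by
    rw [integral_sub_left_eq_self (fun z => gaussKernel b z) volume x, integral_gaussKernel hb]
  have h2 : 0 < m ^ 2 / 2 := by positivity
  have h4 : 0 < m ^ 2 / 4 := by positivity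
  rw [← pi_div_sq_div_rpow hm (by norm_num : (0 : ℝ) < 2),
    ← pi_div_sq_div_rpow hm (by norm_num : (0 : ℝ) < 4), ← hgauss _ h2, ← hgauss _ h4,
    ← integral_const_mul, ← integral_const_mul, ← integral_sub, ← Real.norm_eq_abs]
  · refine norm_integral_le_of_norm_le ((hi _ h4).const_mul _) (Filter.Eventually.of_forall ?_)
    intro y
    rw [← sub_mul, norm_mul, Real.norm_eq_abs, Real.norm_of_nonneg (gaussKernel_pos _ _).le]
    have := mul_norm_mul_exp_le hm (x - y)
    have h5 := h.abs_sub_le y x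
    rw [norm_sub_rev] at h5
    calc |φ y - φ x| * gaussKernel (m ^ 2 / 2) (x - y)
        ≤ 2 * ‖x - y‖ * gaussKernel (m ^ 2 / 2) (x - y) :=
          mul_le_mul_of_nonneg_right h5 (gaussKernel_pos _ _).le
      _ = 2 / m * (m * ‖x - y‖ * gaussKernel (m ^ 2 / 2) (x - y)) := by field_simp
      _ ≤ _ := by unfold gaussKernel; gcongr
  · refine (hi _ h2).bdd_mul (c := 1) h.continuous.aestronglyMeasurable
      (Filter.Eventually.of_forall h.abs_le_one)
  · exact (hi _ h2).const_mul _

/-- The cosine transform of `φ` at frequency `m • v`. -/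
noncomputable def cosCoeff {d : ℕ} (φ : (Fin d → ℝ) → ℝ) (m : ℝ) (v : Fin d → ℝ) : ℝ :=
  ∫ y, φ y * Real.cos (m * v ⬝ᵥ y)

/-- The sine transform of `φ` at frequency `m • v`. -/
noncomputable def sinCoeff {d : ℕ} (φ : (Fin d → ℝ) → ℝ) (m : ℝ) (v : Fin d → ℝ) : ℝ :=
  ∫ y, φ y * Real.sin (m * v ⬝ᵥ y)

namespace IsLipschitzBump

variable {d : ℕ} {φ : (Fin d → ℝ) → ℝ}

open MeasureTheory

theorem integrable_mul_cos (h : IsLipschitzBump φ) (m : ℝ) (v : Fin d → ℝ) :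
    Integrable fun y => φ y * Real.cos (m * v ⬝ᵥ y) :=
  h.integrable.mul_bdd (c := 1) (by fun_prop)
    (Filter.Eventually.of_forall fun y => Real.abs_cos_le_one _)

theorem integrable_mul_sin (h : IsLipschitzBump φ) (m : ℝ) (v : Fin d → ℝ) :
    Integrable fun y => φ y * Real.sin (m * v ⬝ᵥ y) :=
  h.integrable.mul_bdd (c := 1) (by fun_prop)
    (Filter.Eventually.of_forall fun y => Real.abs_sin_le_one _)

theorem abs_cosCoeff_le (h : IsLipschitzBump φ) (m : ℝ) (v : Fin d → ℝ) :
    |cosCoeff φ m v| ≤ 6 ^ d := by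
  rw [cosCoeff, ← Real.norm_eq_abs]
  refine le_trans (norm_integral_le_of_norm_le h.integrable.abs
    (Filter.Eventually.of_forall fun y => ?_)) h.integral_abs_le
  rw [norm_mul, Real.norm_eq_abs, Real.norm_eq_abs]
  exact mul_le_of_le_one_right (abs_nonneg _) (Real.abs_cos_le_one _)

theorem abs_sinCoeff_le (h : IsLipschitzBump φ) (m : ℝ) (v : Fin d → ℝ) :
    |sinCoeff φ m v| ≤ 6 ^ d := by
  rw [sinCoeff, ← Real.norm_eq_abs]
  refine le_trans (norm_integral_le_of_norm_le h.integrable.abs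
    (Filter.Eventually.of_forall fun y => ?_)) h.integral_abs_le
  rw [norm_mul, Real.norm_eq_abs, Real.norm_eq_abs]
  exact mul_le_of_le_one_right (abs_nonneg _) (Real.abs_sin_le_one _)

theorem continuous_cosCoeff (h : IsLipschitzBump φ) (m : ℝ) : Continuous (cosCoeff φ m) := by
  have := h.continuous
  refine continuous_of_dominated (bound := fun y => |φ y|)
    (fun v => by fun_prop) (fun v => Filter.Eventually.of_forall fun y => ?_)
    h.integrable.abs (Filter.Eventually.of_forall fun y => by fun_prop)
  rw [norm_mul, Real.norm_eq_abs, Real.norm_eq_abs]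
  exact mul_le_of_le_one_right (abs_nonneg _) (Real.abs_cos_le_one _)

theorem continuous_sinCoeff (h : IsLipschitzBump φ) (m : ℝ) : Continuous (sinCoeff φ m) := by
  have := h.continuous
  refine continuous_of_dominated (bound := fun y => |φ y|)
    (fun v => by fun_prop) (fun v => Filter.Eventually.of_forall fun y => ?_)
    h.integrable.abs (Filter.Eventually.of_forall fun y => by fun_prop)
  rw [norm_mul, Real.norm_eq_abs, Real.norm_eq_abs]
  exact mul_le_of_le_one_right (abs_nonneg _) (Real.abs_sin_le_one _)

theorem cosCoeff_mul_cos_add (h : IsLipschitzBump φ) (m : ℝ) (v x : Fin d → ℝ) :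
    cosCoeff φ m v * Real.cos (m * v ⬝ᵥ x) + sinCoeff φ m v * Real.sin (m * v ⬝ᵥ x)
      = ∫ y, φ y * Real.cos (v ⬝ᵥ (m • (x - y))) := by
  unfold cosCoeff sinCoeff
  rw [← integral_mul_const, ← integral_mul_const, ← integral_add
    ((h.integrable_mul_cos m v).mul_const _) ((h.integrable_mul_sin m v).mul_const _)]
  refine integral_congr_ae (Filter.Eventually.of_forall fun y => ?_)
  simp only [dotProduct_smul, dotProduct_sub, smul_eq_mul, mul_sub, Real.cos_sub]
  ring

/-- Gaussian averages of `φ` are superpositions of plane waves. -/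
theorem integral_gaussKernel_mul_wave (h : IsLipschitzBump φ) {b : ℝ} (hb : 0 < b) (m : ℝ)
    (x : Fin d → ℝ) :
    ∫ v, gaussKernel b v * (cosCoeff φ m v * Real.cos (m * v ⬝ᵥ x)
        + sinCoeff φ m v * Real.sin (m * v ⬝ᵥ x))
      = (Real.pi / b) ^ ((d : ℝ) / 2) * ∫ y, φ y * gaussKernel (m ^ 2 / (4 * b)) (x - y) := by
  have hc := h.continuous
  have hI : Integrable (fun p : (Fin d → ℝ) × (Fin d → ℝ) =>
      gaussKernel b p.1 * φ p.2 * Real.cos (p.1 ⬝ᵥ (m • (x - p.2)))) (volume.prod volume) := by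
    refine ((integrable_gaussKernel hb).mul_prod h.integrable).mul_bdd (c := 1) (by fun_prop)
      (Filter.Eventually.of_forall fun p => Real.abs_cos_le_one _)
  simp_rw [h.cosCoeff_mul_cos_add, ← integral_const_mul, ← mul_assoc]
  rw [integral_integral_swap hI]
  refine integral_congr_ae (Filter.Eventually.of_forall fun y => ?_)
  simp only
  have e := integral_exp_neg_mul_dotProduct_mul_cos hb (m • (x - y))
  have : ∀ v : Fin d → ℝ, gaussKernel b v * φ y * Real.cos (v ⬝ᵥ (m • (x - y)))
      = φ y * (Real.exp (-b * v ⬝ᵥ v) * Real.cos (v ⬝ᵥ (m • (x - y)))) := fun v => by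
    unfold gaussKernel; ring
  simp_rw [this]
  rw [integral_const_mul, e]
  unfold gaussKernel
  rw [mul_assoc, mul_left_comm]
  congr 3
  simp only [smul_dotProduct, dotProduct_smul, smul_eq_mul]
  field_simp

end IsLipschitzBump

section Symmetrization

open MeasureTheory

variable {d : ℕ} {f g : (Fin d → ℝ) → ℝ}

theorem integrable_mul_comp_sub (hf : Integrable f) (hg : Integrable g) :
    Integrable (fun p : (Fin d → ℝ) × (Fin d → ℝ) => f p.2 * g (p.1 - p.2))
      (volume.prod volume) :=
  hf.convolution_integrand (ContinuousLinearMap.mul ℝ ℝ) hg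

theorem integral_mul_comp_sub (hf : Integrable f) (hg : Integrable g) :
    ∫ p : (Fin d → ℝ) × (Fin d → ℝ), f p.2 * g (p.1 - p.2) ∂(volume.prod volume)
      = (∫ x, f x) * ∫ x, g x := by
  rw [integral_prod_symm _ (integrable_mul_comp_sub hf hg)]
  simp only [integral_const_mul]
  simp_rw [integral_sub_right_eq_self g, integral_mul_const]

theorem integrable_mul_comp_sub' (hf : Integrable f) (hg : Integrable g)
    (he : ∀ x y, g (x - y) = g (y - x)) :
    Integrable (fun p : (Fin d → ℝ) × (Fin d → ℝ) => f p.1 * g (p.1 - p.2))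
      (volume.prod volume) := by
  have := (integrable_mul_comp_sub hf hg).swap
  refine this.congr (Filter.Eventually.of_forall fun p => ?_)
  simp only [Function.comp, Prod.fst_swap, Prod.snd_swap]
  rw [he]

theorem integral_mul_comp_sub' (hf : Integrable f) (hg : Integrable g)
    (he : ∀ x y, g (x - y) = g (y - x)) :
    ∫ p : (Fin d → ℝ) × (Fin d → ℝ), f p.1 * g (p.1 - p.2) ∂(volume.prod volume)
      = (∫ x, f x) * ∫ x, g x := by
  rw [← integral_mul_comp_sub hf hg, ← integral_prod_swap]
  refine integral_congr_ae (Filter.Eventually.of_forall fun p => ?_)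
  simp only [Prod.fst_swap, Prod.snd_swap]
  rw [he]

end Symmetrization

namespace IsLipschitzBump

variable {d : ℕ} {φ : (Fin d → ℝ) → ℝ}

open MeasureTheory

theorem abs_wave_le (h : IsLipschitzBump φ) (m : ℝ) (v : Fin d → ℝ) (s : ℝ) :
    |cosCoeff φ m v * Real.cos s + sinCoeff φ m v * Real.sin s| ≤ 2 * 6 ^ d := by
  have h1 : |cosCoeff φ m v * Real.cos s| ≤ 6 ^ d := by
    rw [abs_mul]
    exact (mul_le_of_le_one_right (abs_nonneg _) (Real.abs_cos_le_one _)).trans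
      (h.abs_cosCoeff_le m v)
  have h2 : |sinCoeff φ m v * Real.sin s| ≤ 6 ^ d := by
    rw [abs_mul]
    exact (mul_le_of_le_one_right (abs_nonneg _) (Real.abs_sin_le_one _)).trans
      (h.abs_sinCoeff_le m v)
  linarith [abs_add_le (cosCoeff φ m v * Real.cos s) (sinCoeff φ m v * Real.sin s)]

theorem integral_gaussKernel_mul_sq (h : IsLipschitzBump φ) {b : ℝ} (hb : 0 < b) (m : ℝ) :
    ∫ v, gaussKernel b v * (cosCoeff φ m v ^ 2 + sinCoeff φ m v ^ 2)
      = (Real.pi / b) ^ ((d : ℝ) / 2)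
        * ∫ x, φ x * ∫ y, φ y * gaussKernel (m ^ 2 / (4 * b)) (x - y) := by
  have hc := h.continuous
  have hA := h.continuous_cosCoeff m
  have hB := h.continuous_sinCoeff m
  have hI : Integrable (fun p : (Fin d → ℝ) × (Fin d → ℝ) =>
      gaussKernel b p.1 * φ p.2 * (cosCoeff φ m p.1 * Real.cos (m * p.1 ⬝ᵥ p.2)
        + sinCoeff φ m p.1 * Real.sin (m * p.1 ⬝ᵥ p.2))) (volume.prod volume) := by
    refine ((integrable_gaussKernel hb).mul_prod h.integrable).mul_bdd (c := 2 * 6 ^ d)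
      (by fun_prop) (Filter.Eventually.of_forall fun p => h.abs_wave_le _ _ _)
  have e1 : ∀ v, gaussKernel b v * (cosCoeff φ m v ^ 2 + sinCoeff φ m v ^ 2)
      = ∫ x, gaussKernel b v * φ x * (cosCoeff φ m v * Real.cos (m * v ⬝ᵥ x)
        + sinCoeff φ m v * Real.sin (m * v ⬝ᵥ x)) := by
    intro v
    have e2 : ∀ x, gaussKernel b v * φ x * (cosCoeff φ m v * Real.cos (m * v ⬝ᵥ x)
        + sinCoeff φ m v * Real.sin (m * v ⬝ᵥ x))
        = gaussKernel b v * cosCoeff φ m v * (φ x * Real.cos (m * v ⬝ᵥ x))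
          + gaussKernel b v * sinCoeff φ m v * (φ x * Real.sin (m * v ⬝ᵥ x)) := fun x => by ring
    simp_rw [e2]
    rw [integral_add ((h.integrable_mul_cos m v).const_mul _)
      ((h.integrable_mul_sin m v).const_mul _), integral_const_mul, integral_const_mul]
    change _ = gaussKernel b v * cosCoeff φ m v * cosCoeff φ m v
      + gaussKernel b v * sinCoeff φ m v * sinCoeff φ m v
    ring
  simp_rw [e1]
  rw [integral_integral_swap hI, ← integral_const_mul]
  refine integral_congr_ae (Filter.Eventually.of_forall fun x => ?_)
  simp only
  rw [mul_left_comm, ← h.integral_gaussKernel_mul_wave hb, ← integral_const_mul]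
  refine integral_congr_ae (Filter.Eventually.of_forall fun v => ?_)
  simp only
  ring

theorem integrable_gaussKernel_mul_sq (h : IsLipschitzBump φ) {b : ℝ} (hb : 0 < b) (m : ℝ) :
    Integrable fun v => gaussKernel b v * (cosCoeff φ m v ^ 2 + sinCoeff φ m v ^ 2) := by
  have hA := h.continuous_cosCoeff m
  have hB := h.continuous_sinCoeff m
  refine (integrable_gaussKernel hb).mul_bdd (c := 6 ^ (2 * d) + 6 ^ (2 * d)) (by fun_prop)
    (Filter.Eventually.of_forall fun v => ?_)
  rw [Real.norm_of_nonneg (by positivity), mul_comm 2 d, pow_mul]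
  refine add_le_add ?_ ?_
  · exact sq_le_sq' (by linarith [(abs_le.1 (h.abs_cosCoeff_le m v)).1])
      (abs_le.1 (h.abs_cosCoeff_le m v)).2
  · exact sq_le_sq' (by linarith [(abs_le.1 (h.abs_sinCoeff_le m v)).1])
      (abs_le.1 (h.abs_sinCoeff_le m v)).2

theorem integral_integral_eq_sq_sub (h : IsLipschitzBump φ) {k : (Fin d → ℝ) → ℝ}
    (hk : Integrable k) (he : ∀ x y, k (x - y) = k (y - x)) (hk0 : ∫ z, k z = 0) :
    Integrable (fun p : (Fin d → ℝ) × (Fin d → ℝ) => (φ p.1 - φ p.2) ^ 2 * k (p.1 - p.2))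
      (volume.prod volume) ∧
    ∫ x, φ x * ∫ y, φ y * k (x - y)
      = -(1 / 2) * ∫ p : (Fin d → ℝ) × (Fin d → ℝ),
        (φ p.1 - φ p.2) ^ 2 * k (p.1 - p.2) ∂(volume.prod volume) := by
  have hc := h.continuous
  have hsq : Integrable fun x => φ x ^ 2 := by
    simp_rw [sq]
    exact h.integrable.mul_bdd (c := 1) (by fun_prop) (Filter.Eventually.of_forall h.abs_le_one)
  have i1 := integrable_mul_comp_sub hsq hk
  have i2 := integrable_mul_comp_sub' hsq hk he
  have i3 : Integrable (fun p : (Fin d → ℝ) × (Fin d → ℝ) => φ p.1 * (φ p.2 * k (p.1 - p.2)))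
      (volume.prod volume) :=
    (integrable_mul_comp_sub h.integrable hk).bdd_mul (c := 1) (by fun_prop)
      (Filter.Eventually.of_forall fun p => h.abs_le_one _)
  have i4 : Integrable (fun p : (Fin d → ℝ) × (Fin d → ℝ) => φ p.1 ^ 2 * k (p.1 - p.2)
      + φ p.2 ^ 2 * k (p.1 - p.2)) (volume.prod volume) := i2.add i1
  have e : (fun p : (Fin d → ℝ) × (Fin d → ℝ) => (φ p.1 - φ p.2) ^ 2 * k (p.1 - p.2))
      = fun p => φ p.1 ^ 2 * k (p.1 - p.2) + φ p.2 ^ 2 * k (p.1 - p.2)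
        - 2 * (φ p.1 * (φ p.2 * k (p.1 - p.2))) := by
    ext p; ring
  rw [e]
  refine ⟨i4.sub (i3.const_mul 2), ?_⟩
  rw [integral_sub i4 (i3.const_mul 2), integral_add i2 i1, integral_mul_comp_sub' hsq hk he,
    integral_mul_comp_sub hsq hk, hk0, integral_const_mul, integral_prod _ i3]
  simp only [integral_const_mul]
  ring

end IsLipschitzBump

/-- The constant in the energy estimate. -/
noncomputable def energyConst (d : ℕ) : ℝ :=
  64 * 6 ^ d * (2 * Real.pi) ^ ((d : ℝ) / 2) * (4 * Real.pi) ^ ((d : ℝ) / 2)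

theorem energyConst_pos (d : ℕ) : 0 < energyConst d := by unfold energyConst; positivity

namespace IsLipschitzBump

variable {d : ℕ} {φ : (Fin d → ℝ) → ℝ}

open MeasureTheory

theorem gaussKernel_mul_dotProduct_mul_sq_le (v : Fin d → ℝ) {s : ℝ} (hs : 0 ≤ s) :
    gaussKernel (1 / 2) v * (v ⬝ᵥ v) * s
      ≤ 4 * (gaussKernel (1 / 4) v * s - gaussKernel (1 / 2) v * s) := by
  rw [← sub_mul, ← mul_assoc]
  refine mul_le_mul_of_nonneg_right ?_ hs
  have e : gaussKernel (1 / 4) v = gaussKernel (1 / 2) v * Real.exp (1 / 4 * v ⬝ᵥ v) := by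
    unfold gaussKernel; rw [← Real.exp_add]; congr 1; ring
  have h2 := Real.add_one_le_exp (1 / 4 * v ⬝ᵥ v)
  have h3 := gaussKernel_pos (1 / 2) v
  rw [e]
  nlinarith [mul_le_mul_of_nonneg_left h2 h3.le]

theorem integrable_energy (h : IsLipschitzBump φ) (m : ℝ) :
    Integrable fun v => gaussKernel (1 / 2) v * (v ⬝ᵥ v)
      * (cosCoeff φ m v ^ 2 + sinCoeff φ m v ^ 2) := by
  have hA := h.continuous_cosCoeff m
  have hB := h.continuous_sinCoeff m
  refine Integrable.mono' (((h.integrable_gaussKernel_mul_sq (b := 1 / 4) (by norm_num) m).sub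
    (h.integrable_gaussKernel_mul_sq (b := 1 / 2) (by norm_num) m)).const_mul 4)
    (by fun_prop) (Filter.Eventually.of_forall fun v => ?_)
  have h0 : 0 ≤ v ⬝ᵥ v := sum_nonneg fun i _ => mul_self_nonneg _
  have h1 := gaussKernel_pos (1 / 2) v
  rw [Real.norm_of_nonneg (by positivity)]
  exact gaussKernel_mul_dotProduct_mul_sq_le v (by positivity)

/-- High-frequency decay of the Fourier transform of a Lipschitz bump, in a Gaussian mean. -/
theorem integral_energy_le (h : IsLipschitzBump φ) {m : ℝ} (hm : 0 < m) :
    ∫ v, gaussKernel (1 / 2) v * (v ⬝ᵥ v) * (cosCoeff φ m v ^ 2 + sinCoeff φ m v ^ 2)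
      ≤ energyConst d / m ^ (d + 2) := by
  have hc := h.continuous
  have j1 := h.integrable_gaussKernel_mul_sq (b := 1 / 4) (by norm_num) m
  have j2 := h.integrable_gaussKernel_mul_sq (b := 1 / 2) (by norm_num) m
  have hle : ∫ v, gaussKernel (1 / 2) v * (v ⬝ᵥ v) * (cosCoeff φ m v ^ 2 + sinCoeff φ m v ^ 2)
      ≤ 4 * ((∫ v, gaussKernel (1 / 4) v * (cosCoeff φ m v ^ 2 + sinCoeff φ m v ^ 2))
        - ∫ v, gaussKernel (1 / 2) v * (cosCoeff φ m v ^ 2 + sinCoeff φ m v ^ 2)) := by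
    rw [← integral_sub j1 j2, ← integral_const_mul]
    exact integral_mono (h.integrable_energy m) ((j1.sub j2).const_mul 4)
      fun v => gaussKernel_mul_dotProduct_mul_sq_le v (by positivity)
  refine hle.trans ?_
  rw [h.integral_gaussKernel_mul_sq (by norm_num), h.integral_gaussKernel_mul_sq (by norm_num)]
  have e1 : Real.pi / (1 / 4) = 4 * Real.pi := by ring
  have e2 : Real.pi / (1 / 2) = 2 * Real.pi := by ring
  have e3 : m ^ 2 / (4 * (1 / 4)) = m ^ 2 / 1 := by ring
  have e4 : m ^ 2 / (4 * (1 / 2)) = m ^ 2 / 2 := by ring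
  rw [e1, e2, e3, e4]
  set P₄ := (4 * Real.pi) ^ ((d : ℝ) / 2) with hP₄
  set P₂ := (2 * Real.pi) ^ ((d : ℝ) / 2) with hP₂
  have hP₄0 : 0 < P₄ := by positivity
  have hP₂0 : 0 < P₂ := by positivity
  have hm1 : 0 < m ^ 2 / 1 := by positivity
  have hm2 : 0 < m ^ 2 / 2 := by positivity
  have hm4 : 0 < m ^ 2 / 4 := by positivity
  have k1 : Integrable (gaussKernel (m ^ 2 / 1) : (Fin d → ℝ) → ℝ) := integrable_gaussKernel hm1
  have k2 : Integrable (gaussKernel (m ^ 2 / 2) : (Fin d → ℝ) → ℝ) := integrable_gaussKernel hm2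
  have k4 : Integrable (gaussKernel (m ^ 2 / 4) : (Fin d → ℝ) → ℝ) := integrable_gaussKernel hm4
  let k : (Fin d → ℝ) → ℝ := fun z =>
    P₄ * gaussKernel (m ^ 2 / 1) z - P₂ * gaussKernel (m ^ 2 / 2) z
  have hk : Integrable k := (k1.const_mul P₄).sub (k2.const_mul P₂)
  have hke : ∀ x y, k (x - y) = k (y - x) := fun x y => by
    simp only [k, gaussKernel_sub_comm _ x y]
  have hk0 : ∫ z, k z = 0 := by
    rw [integral_sub (k1.const_mul P₄) (k2.const_mul P₂), integral_const_mul, integral_const_mul,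
      integral_gaussKernel hm1, integral_gaussKernel hm2, pi_div_sq_div_rpow hm one_pos,
      pi_div_sq_div_rpow hm two_pos]
    have : P₄ * (1 * Real.pi) ^ ((d : ℝ) / 2) = P₂ * (2 * Real.pi) ^ ((d : ℝ) / 2) := by
      rw [hP₄, hP₂, ← Real.mul_rpow (by positivity) (by positivity),
        ← Real.mul_rpow (by positivity) (by positivity)]
      congr 1; ring
    rw [← mul_div_assoc, this, ← mul_div_assoc, sub_self]
  have hin : ∀ b, 0 < b → ∀ x, Integrable fun y => φ y * gaussKernel b (x - y) := fun b hb x =>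
    ((integrable_gaussKernel hb).comp_sub_left x).bdd_mul (c := 1) (by fun_prop)
      (Filter.Eventually.of_forall h.abs_le_one)
  have hout : ∀ b, 0 < b → Integrable fun x => φ x * ∫ y, φ y * gaussKernel b (x - y) :=
    fun b hb => by
    have := (integrable_mul_comp_sub h.integrable (integrable_gaussKernel hb)).integral_prod_left
    exact this.bdd_mul (c := 1) (by fun_prop) (Filter.Eventually.of_forall h.abs_le_one)
  have hS : P₄ * (∫ x, φ x * ∫ y, φ y * gaussKernel (m ^ 2 / 1) (x - y))
      - P₂ * (∫ x, φ x * ∫ y, φ y * gaussKernel (m ^ 2 / 2) (x - y))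
      = ∫ x, φ x * ∫ y, φ y * k (x - y) := by
    rw [← integral_const_mul, ← integral_const_mul, ← integral_sub ((hout _ hm1).const_mul _)
      ((hout _ hm2).const_mul _)]
    refine integral_congr_ae (Filter.Eventually.of_forall fun x => ?_)
    simp only
    have : ∀ y, φ y * k (x - y) = P₄ * (φ y * gaussKernel (m ^ 2 / 1) (x - y))
        - P₂ * (φ y * gaussKernel (m ^ 2 / 2) (x - y)) := fun y => by simp only [k]; ring
    simp_rw [this]
    rw [integral_sub ((hin _ hm1 x).const_mul _) ((hin _ hm2 x).const_mul _), integral_const_mul,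
      integral_const_mul]
    ring
  obtain ⟨hi, heq⟩ := h.integral_integral_eq_sq_sub hk hke hk0
  rw [hS, heq]
  have hB : Integrable ((Metric.closedBall (0 : Fin d → ℝ) 3).indicator
      (1 : (Fin d → ℝ) → ℝ)) := (integrable_indicator_iff measurableSet_closedBall).2
        (integrableOn_const measure_closedBall_lt_top.ne)
  have hBint : ∫ x, (Metric.closedBall (0 : Fin d → ℝ) 3).indicator (1 : (Fin d → ℝ) → ℝ) x
      = 6 ^ d := by
    rw [integral_indicator_one measurableSet_closedBall, Measure.real,
      Real.volume_pi_closedBall _ (by norm_num), ENNReal.toReal_ofReal (by positivity)]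
    norm_num
  set χ := (Metric.closedBall (0 : Fin d → ℝ) 3).indicator (1 : (Fin d → ℝ) → ℝ) with hχ
  have i1 := integrable_mul_comp_sub hB k4
  have i2 := integrable_mul_comp_sub' hB k4 (gaussKernel_sub_comm _)
  have hfin : -∫ p : (Fin d → ℝ) × (Fin d → ℝ), (φ p.1 - φ p.2) ^ 2 * k (p.1 - p.2)
        ∂(volume.prod volume)
      ≤ 16 / m ^ 2 * P₂ * (6 ^ d * (P₄ / m ^ d) + 6 ^ d * (P₄ / m ^ d)) := by
    have hval : ∫ p : (Fin d → ℝ) × (Fin d → ℝ), 16 / m ^ 2 * P₂ *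
        (χ p.1 * gaussKernel (m ^ 2 / 4) (p.1 - p.2) + χ p.2 * gaussKernel (m ^ 2 / 4) (p.1 - p.2))
        ∂(volume.prod volume)
        = 16 / m ^ 2 * P₂ * (6 ^ d * (P₄ / m ^ d) + 6 ^ d * (P₄ / m ^ d)) := by
      rw [integral_const_mul, integral_add i2 i1,
        integral_mul_comp_sub' hB k4 (gaussKernel_sub_comm _), integral_mul_comp_sub hB k4, hBint,
        integral_gaussKernel hm4, pi_div_sq_div_rpow hm four_pos]
    rw [← hval, ← integral_neg]
    refine integral_mono hi.neg ((i2.add i1).const_mul _) fun p => ?_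
    simp only
    obtain ⟨x, y⟩ := p
    simp only
    have hg1 := gaussKernel_pos (m ^ 2 / 1) (x - y)
    have hg2 := gaussKernel_pos (m ^ 2 / 2) (x - y)
    have hg4 := gaussKernel_pos (m ^ 2 / 4) (x - y)
    have hχ0 : ∀ z, 0 ≤ χ z := fun z => Set.indicator_nonneg (fun _ _ => zero_le_one) z
    have hsq : (φ x - φ y) ^ 2 ≤ (χ x + χ y) * (4 * ‖x - y‖ ^ 2) := by
      by_cases hxy : φ x - φ y = 0
      · rw [hxy, zero_pow two_ne_zero]
        have := hχ0 x; have := hχ0 y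
        positivity
      · have h1 : 1 ≤ χ x + χ y := by
          have hx := hχ0 x; have hy := hχ0 y
          by_cases hx3 : x ∈ Metric.closedBall (0 : Fin d → ℝ) 3
          · have : χ x = 1 := by simp [hχ, hx3]
            linarith
          · by_cases hy3 : y ∈ Metric.closedBall (0 : Fin d → ℝ) 3
            · have : χ y = 1 := by simp [hχ, hy3]
              linarith
            · rw [mem_closedBall_zero_iff, not_le] at hx3 hy3
              rw [h.eq_zero x hx3.le, h.eq_zero y hy3.le, sub_self] at hxy
              exact absurd rfl hxy
        have h2 : (φ x - φ y) ^ 2 ≤ (2 * ‖x - y‖) ^ 2 := by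
          rw [← sq_abs]
          exact pow_le_pow_left₀ (abs_nonneg _) (h.abs_sub_le x y) 2
        nlinarith [sq_nonneg ‖x - y‖]
    have hkk : -k (x - y) ≤ P₂ * gaussKernel (m ^ 2 / 2) (x - y) := by
      simp only [k]; nlinarith
    have hexp : ‖x - y‖ ^ 2 * gaussKernel (m ^ 2 / 2) (x - y)
        ≤ 4 / m ^ 2 * gaussKernel (m ^ 2 / 4) (x - y) := by
      have := sq_mul_norm_mul_exp_le m (x - y)
      change m ^ 2 * ‖x - y‖ ^ 2 * gaussKernel (m ^ 2 / 2) (x - y)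
        ≤ 4 * gaussKernel (m ^ 2 / 4) (x - y) at this
      rw [div_mul_eq_mul_div, le_div_iff₀ (by positivity)]
      linarith
    have hχxy : 0 ≤ χ x + χ y := add_nonneg (hχ0 x) (hχ0 y)
    calc -((φ x - φ y) ^ 2 * k (x - y)) = (φ x - φ y) ^ 2 * -k (x - y) := by ring
      _ ≤ (φ x - φ y) ^ 2 * (P₂ * gaussKernel (m ^ 2 / 2) (x - y)) := by gcongr
      _ ≤ (χ x + χ y) * (4 * ‖x - y‖ ^ 2) * (P₂ * gaussKernel (m ^ 2 / 2) (x - y)) := by gcongr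
      _ = (χ x + χ y) * 4 * P₂ * (‖x - y‖ ^ 2 * gaussKernel (m ^ 2 / 2) (x - y)) := by ring
      _ ≤ (χ x + χ y) * 4 * P₂ * (4 / m ^ 2 * gaussKernel (m ^ 2 / 4) (x - y)) := by gcongr
      _ = _ := by ring
  have hE : energyConst d / m ^ (d + 2)
      = 2 * (16 / m ^ 2 * P₂ * (6 ^ d * (P₄ / m ^ d) + 6 ^ d * (P₄ / m ^ d))) := by
    rw [energyConst, ← hP₂, ← hP₄]
    field_simp
    ring
  rw [hE]
  linarith

end IsLipschitzBump

section TrigPolynomial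

open MeasureTheory

/-- The trigonometric sum with real coefficients `p`, `q` and integer frequencies `m`. -/
noncomputable def trigSum {ι : Type*} [Fintype ι] (m : ι → ℤ) (p q : ι → ℝ) (t : ℝ) : ℝ :=
  ∑ j, (p j * Real.cos (m j * t) + q j * Real.sin (m j * t))

@[fun_prop]
theorem continuous_trigSum {ι : Type*} [Fintype ι] (m : ι → ℤ) (p q : ι → ℝ) :
    Continuous (trigSum m p q) := by
  unfold trigSum; fun_prop

theorem integral_cos_int_mul (P : ℕ) (k : ℤ) :
    ∫ t in (-(P * Real.pi))..(P * Real.pi), Real.cos (k * t)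
      = if k = 0 then 2 * Real.pi * P else 0 := by
  split_ifs with h
  · simp [h]; ring
  · have hk : (k : ℝ) ≠ 0 := by exact_mod_cast h
    rw [intervalIntegral.integral_comp_mul_left _ hk, integral_cos, mul_neg, Real.sin_neg]
    have : Real.sin (k * (P * Real.pi)) = 0 := by
      have := Real.sin_int_mul_pi (k * P)
      push_cast at this
      rw [← mul_assoc, this]
    simp [this]

theorem integral_sin_mul_symm (T k : ℝ) : ∫ t in (-T)..T, Real.sin (k * t) = 0 := by
  by_cases hk : k = 0
  · simp [hk]
  · rw [intervalIntegral.integral_comp_mul_left _ hk, integral_sin]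
    simp

theorem integral_trigSum_sq_le {ι : Type*} [Fintype ι] {m : ι → ℤ} (hm : Function.Injective m)
    (p q : ι → ℝ) (P : ℕ) :
    ∫ t in (-(P * Real.pi))..(P * Real.pi), trigSum m p q t ^ 2
      ≤ 2 * Real.pi * P * ∑ j, (p j ^ 2 + q j ^ 2) := by
  classical
  have hP : -(P * Real.pi) ≤ P * Real.pi := by
    have : 0 ≤ P * Real.pi := by positivity
    linarith
  have e : ∀ t, trigSum m p q t ^ 2 + trigSum m (fun j => -q j) p t ^ 2
      = ∑ j, ∑ k, ((p j * p k + q j * q k) * Real.cos (((m j - m k : ℤ) : ℝ) * t)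
        + (q j * p k - p j * q k) * Real.sin (((m j - m k : ℤ) : ℝ) * t)) := by
    intro t
    unfold trigSum
    rw [sq, sq, sum_mul_sum, sum_mul_sum, ← sum_add_distrib]
    refine sum_congr rfl fun j _ => ?_
    rw [← sum_add_distrib]
    refine sum_congr rfl fun k _ => ?_
    push_cast
    rw [sub_mul, Real.cos_sub, Real.sin_sub]
    ring
  calc ∫ t in (-(P * Real.pi))..(P * Real.pi), trigSum m p q t ^ 2
      ≤ ∫ t in (-(P * Real.pi))..(P * Real.pi),
          (trigSum m p q t ^ 2 + trigSum m (fun j => -q j) p t ^ 2) :=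
        intervalIntegral.integral_mono_on hP (Continuous.intervalIntegrable (by fun_prop) _ _)
          (Continuous.intervalIntegrable (by fun_prop) _ _)
          fun t _ => le_add_of_nonneg_right (sq_nonneg _)
    _ = ∑ j, ∑ k, ((p j * p k + q j * q k) * (if m j - m k = 0 then 2 * Real.pi * P else 0)
          + (q j * p k - p j * q k) * 0) := by
        simp_rw [e]
        rw [intervalIntegral.integral_finsetSum
          fun j _ => Continuous.intervalIntegrable (by fun_prop) _ _]
        refine sum_congr rfl fun j _ => ?_
        rw [intervalIntegral.integral_finsetSum
          fun k _ => Continuous.intervalIntegrable (by fun_prop) _ _]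
        refine sum_congr rfl fun k _ => ?_
        rw [intervalIntegral.integral_add (Continuous.intervalIntegrable (by fun_prop) _ _)
          (Continuous.intervalIntegrable (by fun_prop) _ _), intervalIntegral.integral_const_mul,
          intervalIntegral.integral_const_mul, integral_cos_int_mul, integral_sin_mul_symm]
    _ = _ := by
        simp only [sub_eq_zero, hm.eq_iff, mul_zero, add_zero, mul_ite, sum_ite_eq, mem_univ,
          if_true]
        rw [mul_sum]
        exact sum_congr rfl fun j _ => by ring

theorem integral_abs_trigSum_le {ι : Type*} [Fintype ι] {m : ι → ℤ} (hm : Function.Injective m)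
    (p q : ι → ℝ) {P : ℕ} {T θ : ℝ} (hT : 0 ≤ T) (hTP : T ≤ P * Real.pi) (hθ : 0 < θ) :
    ∫ t in (-T)..T, |trigSum m p q t|
      ≤ T / θ + θ * (Real.pi * P * ∑ j, (p j ^ 2 + q j ^ 2)) := by
  have hTT : -T ≤ T := by linarith
  calc ∫ t in (-T)..T, |trigSum m p q t|
      ≤ ∫ t in (-T)..T, (1 / (2 * θ) + θ / 2 * trigSum m p q t ^ 2) := by
        refine intervalIntegral.integral_mono_on hTT
          (Continuous.intervalIntegrable (by fun_prop) _ _)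
          (Continuous.intervalIntegrable (by fun_prop) _ _) fun t _ => ?_
        rw [← sq_abs]
        have : 1 / (2 * θ) + θ / 2 * |trigSum m p q t| ^ 2 - |trigSum m p q t|
            = (θ * |trigSum m p q t| - 1) ^ 2 / (2 * θ) := by field_simp; ring
        have : 0 ≤ (θ * |trigSum m p q t| - 1) ^ 2 / (2 * θ) := by positivity
        linarith
    _ = T / θ + θ / 2 * ∫ t in (-T)..T, trigSum m p q t ^ 2 := by
        rw [intervalIntegral.integral_add (Continuous.intervalIntegrable (by fun_prop) _ _)
          (Continuous.intervalIntegrable (by fun_prop) _ _), intervalIntegral.integral_const_mul]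
        simp only [intervalIntegral.integral_const, smul_eq_mul]
        field_simp
        ring
    _ ≤ T / θ + θ / 2 * ∫ t in (-(P * Real.pi))..(P * Real.pi), trigSum m p q t ^ 2 := by
        gcongr
        exact intervalIntegral.integral_mono_interval (by linarith) hTT hTP
          (Filter.Eventually.of_forall fun t => sq_nonneg _)
          (Continuous.intervalIntegrable (by fun_prop) _ _)
    _ ≤ T / θ + θ / 2 * (2 * Real.pi * P * ∑ j, (p j ^ 2 + q j ^ 2)) := by
        gcongr
        exact integral_trigSum_sq_le hm p q P
    _ = _ := by ring

end TrigPolynomial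

open MeasureTheory in
/-- On finitely many measurable sets, a signed density can be replaced by finitely many atoms. -/
theorem exists_atoms {Ω : Type*} {β : Type} [MeasurableSpace Ω] [Nonempty Ω] {μ : Measure Ω}
    {Ψ : Ω → ℝ}
    (hΨ : Integrable Ψ μ) {S : β → Set Ω} (hS : ∀ x, MeasurableSet (S x)) (X : Finset β) :
    ∃ (ι : Type) (_ : Fintype ι) (a : ι → ℝ) (ω : ι → Ω), ∑ k, |a k| ≤ ∫ z, |Ψ z| ∂μ ∧
      ∀ x ∈ X, ∑ k, a k * (S x).indicator 1 (ω k) = ∫ z in S x, Ψ z ∂μ := by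
  classical
  let A : (X → Bool) → Set Ω := fun σ => {z | ∀ x : X, z ∈ S x ↔ σ x = true}
  have hA : ∀ σ, MeasurableSet (A σ) := by
    intro σ
    have : A σ = ⋂ x : X, {z | z ∈ S x ↔ σ x = true} := by ext; simp [A]
    rw [this]
    exact MeasurableSet.iInter fun x => (hS x).iff (MeasurableSet.const _)
  have hU : ⋃ σ, A σ = Set.univ := by
    refine Set.eq_univ_of_forall fun z => Set.mem_iUnion.2 ⟨fun x => decide (z ∈ S x), ?_⟩
    simp [A]
  have hD : Pairwise (Function.onFun Disjoint A) := by
    intro σ τ hne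
    refine Set.disjoint_left.2 fun z hσ hτ => hne (funext fun x => ?_)
    have h1 := hσ x
    have h2 := hτ x
    rw [Bool.eq_iff_iff, ← h1, ← h2]
  have hsum : ∀ f : Ω → ℝ, Integrable f μ → ∑ σ, ∫ z in A σ, f z ∂μ = ∫ z, f z ∂μ := by
    intro f hf
    rw [← integral_iUnion_fintype hA hD fun σ => hf.integrableOn, hU, Measure.restrict_univ]
  let ω : (X → Bool) → Ω := fun σ => if h : (A σ).Nonempty then h.some else Classical.arbitrary Ω
  refine ⟨X → Bool, inferInstance, fun σ => ∫ z in A σ, Ψ z ∂μ, ω, ?_, fun x hx => ?_⟩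
  · rw [← hsum _ hΨ.abs]
    exact sum_le_sum fun σ _ => abs_integral_le_integral_abs
  · rw [← integral_indicator (hS x), ← hsum _ (hΨ.indicator (hS x))]
    refine sum_congr rfl fun σ _ => ?_
    by_cases h : (A σ).Nonempty
    · have hω : ω σ ∈ A σ := by simp only [ω, h, dif_pos]; exact h.some_mem
      have hx' := hω ⟨x, hx⟩
      rw [← integral_mul_const]
      refine setIntegral_congr_fun (hA σ) fun z hz => ?_
      have hz' := hz ⟨x, hx⟩
      by_cases hc : σ ⟨x, hx⟩ = true
      · simp [Set.indicator, hz'.2 hc, hx'.2 hc]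
      · have e1 : z ∉ S x := fun h' => hc (hz'.1 h')
        have e2 : ω σ ∉ S x := fun h' => hc (hx'.1 h')
        simp [Set.indicator, e1, e2]
    · simp [Set.not_nonempty_iff_eq_empty.1 h]

open MeasureTheory in
theorem integrable_gaussKernel_mul_inv_norm {d : ℕ} (hd : 2 ≤ d) {b : ℝ} (hb : 0 < b) :
    Integrable fun v : Fin d → ℝ => gaussKernel b v * ‖v‖⁻¹ := by
  have : Nontrivial (Fin d → ℝ) := by
    have : Nonempty (Fin d) := ⟨⟨0, by omega⟩⟩
    infer_instance
  have h1 : Integrable (fun v : Fin d → ℝ =>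
      (fun y : ℝ => Real.exp (-b * y ^ 2) * y⁻¹) ‖v‖) volume := by
    rw [integrable_fun_norm_addHaar volume (f := fun y : ℝ => Real.exp (-b * y ^ 2) * y⁻¹),
      Module.finrank_fin_fun]
    refine (integrableOn_rpow_mul_exp_neg_mul_sq hb (s := ((d - 2 : ℕ) : ℝ))
      (by have : (0 : ℝ) ≤ ((d - 2 : ℕ) : ℝ) := by positivity
          linarith)).congr_fun (fun y hy => ?_) measurableSet_Ioi
    have hy' : y ≠ 0 := ne_of_gt hy
    have e : d - 1 = (d - 2) + 1 := by omega
    simp only [smul_eq_mul, Real.rpow_natCast]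
    rw [e, pow_succ]
    field_simp
    ring
  refine h1.mono' (by
    refine (Continuous.aestronglyMeasurable (by fun_prop)).mul ?_
    exact (measurable_norm.inv).aestronglyMeasurable) (Filter.Eventually.of_forall fun v => ?_)
  have := norm_sq_le_dotProduct_self v
  rw [Real.norm_of_nonneg (mul_nonneg (gaussKernel_pos _ _).le (inv_nonneg.2 (norm_nonneg _)))]
  unfold gaussKernel
  simp only
  gcongr ?_ * _
  refine Real.exp_le_exp.2 ?_
  nlinarith

theorem hasDerivAt_trigSum {ι : Type*} [Fintype ι] (m : ι → ℤ) (p q : ι → ℝ) (t : ℝ) :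
    HasDerivAt (trigSum m p q) (trigSum m (fun j => m j * q j) (fun j => -(m j * p j)) t) t := by
  unfold trigSum
  refine HasDerivAt.fun_sum fun j _ => ?_
  have h := (hasDerivAt_id t).const_mul (m j : ℝ)
  have h1 := (h.cos.const_mul (p j)).add (h.sin.const_mul (q j))
  refine h1.congr_deriv ?_
  simp only [id]
  ring

/-- The frequencies `n, n + 1, …, 2 n - 1`. -/
def freq (n : ℕ) (j : Fin n) : ℤ := n + (j : ℕ)

theorem freq_injective (n : ℕ) : Function.Injective (freq n) := by
  intro i j h
  simp only [freq] at h
  exact Fin.ext (by omega)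

theorem le_freq {n : ℕ} (j : Fin n) : (n : ℝ) ≤ freq n j := by
  simp [freq]

theorem freq_le {n : ℕ} (j : Fin n) : (freq n j : ℝ) ≤ 2 * n := by
  have : ((j : ℕ) : ℝ) ≤ n := by exact_mod_cast j.2.le
  simp only [freq, Int.cast_add, Int.cast_natCast]
  linarith

/-- The weight of a frequency in the averaged Gaussian approximation of the identity. -/
noncomputable def freqWeight (d : ℕ) {n : ℕ} (j : Fin n) : ℝ :=
  freq n j ^ d / (n * ((2 * Real.pi) ^ ((d : ℝ) / 2)) ^ 2)

/-- The ridge profile in direction `v` of the Gaussian smoothing of `φ`. -/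
noncomputable def ridge {d : ℕ} (φ : (Fin d → ℝ) → ℝ) (n : ℕ) (v : Fin d → ℝ) : ℝ → ℝ :=
  trigSum (freq n) (fun j => freqWeight d j * cosCoeff φ (freq n j) v)
    (fun j => freqWeight d j * sinCoeff φ (freq n j) v)

/-- The derivative of `ridge`. -/
noncomputable def ridgeDeriv {d : ℕ} (φ : (Fin d → ℝ) → ℝ) (n : ℕ) (v : Fin d → ℝ) : ℝ → ℝ :=
  trigSum (freq n) (fun j => freq n j * (freqWeight d j * sinCoeff φ (freq n j) v))
    (fun j => -(freq n j * (freqWeight d j * cosCoeff φ (freq n j) v)))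

theorem hasDerivAt_ridge {d : ℕ} (φ : (Fin d → ℝ) → ℝ) (n : ℕ) (v : Fin d → ℝ) (t : ℝ) :
    HasDerivAt (ridge φ n v) (ridgeDeriv φ n v t) t := hasDerivAt_trigSum _ _ _ _

/-- The constant in the smoothing error. -/
noncomputable def smoothConst (d : ℕ) : ℝ :=
  2 * (4 * Real.pi) ^ ((d : ℝ) / 2) / (2 * Real.pi) ^ ((d : ℝ) / 2)

theorem smoothConst_pos (d : ℕ) : 0 < smoothConst d := by unfold smoothConst; positivity

namespace IsLipschitzBump

variable {d : ℕ} {φ : (Fin d → ℝ) → ℝ}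

open MeasureTheory

theorem continuous_ridge (h : IsLipschitzBump φ) (n : ℕ) :
    Continuous fun p : (Fin d → ℝ) × ℝ => ridge φ n p.1 p.2 := by
  have h1 := fun m => h.continuous_cosCoeff m
  have h2 := fun m => h.continuous_sinCoeff m
  unfold ridge trigSum
  fun_prop

theorem continuous_ridgeDeriv (h : IsLipschitzBump φ) (n : ℕ) :
    Continuous fun p : (Fin d → ℝ) × ℝ => ridgeDeriv φ n p.1 p.2 := by
  have h1 := fun m => h.continuous_cosCoeff m
  have h2 := fun m => h.continuous_sinCoeff m
  unfold ridgeDeriv trigSum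
  fun_prop

theorem abs_ridge_le (h : IsLipschitzBump φ) (n : ℕ) (v : Fin d → ℝ) (t : ℝ) :
    |ridge φ n v t| ≤ ∑ j : Fin n, |freqWeight d j| * (2 * 6 ^ d) := by
  unfold ridge trigSum
  refine (abs_sum_le_sum_abs _ _).trans (sum_le_sum fun j _ => ?_)
  rw [mul_assoc, mul_assoc, ← mul_add, abs_mul]
  exact mul_le_mul_of_nonneg_left (h.abs_wave_le _ _ _) (abs_nonneg _)

theorem integrable_gaussKernel_mul_ridge (h : IsLipschitzBump φ) (n : ℕ) {f : (Fin d → ℝ) → ℝ}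
    (hf : Continuous f) : Integrable fun v => gaussKernel (1 / 2) v * ridge φ n v (f v) := by
  have hc : Continuous fun v => ridge φ n v (f v) := by
    have hp : Continuous fun v => (v, f v) := continuous_id.prodMk hf
    have h1 := h.continuous_ridge n
    generalize ridge φ n = g at h1 ⊢
    exact h1.comp hp
  have hb : ∀ v, ‖ridge φ n v (f v)‖ ≤ ∑ j : Fin n, |freqWeight d j| * (2 * 6 ^ d) := fun v => by
    rw [Real.norm_eq_abs]; exact h.abs_ridge_le n v (f v)
  have hg := integrable_gaussKernel (d := d) (b := 1 / 2) (by norm_num)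
  exact hg.mul_bdd hc.aestronglyMeasurable (Filter.Eventually.of_forall hb)

/-- A Lipschitz bump is close to a Gaussian superposition of ridge functions. -/
theorem abs_integral_ridge_sub_le (h : IsLipschitzBump φ) {n : ℕ} (hn : 0 < n)
    (x : Fin d → ℝ) :
    |(∫ v, gaussKernel (1 / 2) v * ridge φ n v (v ⬝ᵥ x)) - φ x| ≤ smoothConst d / n := by
  have hn' : (0 : ℝ) < n := by exact_mod_cast hn
  set P₄ := (4 * Real.pi) ^ ((d : ℝ) / 2) with hP₄
  set P₂ := (2 * Real.pi) ^ ((d : ℝ) / 2) with hP₂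
  have hP₄0 : 0 < P₄ := by positivity
  have hP₂0 : 0 < P₂ := by positivity
  have hgauss : ∀ j : Fin n, Integrable fun v => gaussKernel (1 / 2) v *
      (cosCoeff φ (freq n j) v * Real.cos (freq n j * v ⬝ᵥ x)
        + sinCoeff φ (freq n j) v * Real.sin (freq n j * v ⬝ᵥ x)) := by
    intro j
    have hA := h.continuous_cosCoeff (freq n j)
    have hB := h.continuous_sinCoeff (freq n j)
    have hc : Continuous fun v => cosCoeff φ (freq n j) v * Real.cos (freq n j * v ⬝ᵥ x)
        + sinCoeff φ (freq n j) v * Real.sin (freq n j * v ⬝ᵥ x) := by fun_prop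
    exact (integrable_gaussKernel (d := d) (b := 1 / 2) (by norm_num)).mul_bdd (c := 2 * 6 ^ d)
      hc.aestronglyMeasurable (Filter.Eventually.of_forall fun v => h.abs_wave_le _ _ _)
  have e1 : ∫ v, gaussKernel (1 / 2) v * ridge φ n v (v ⬝ᵥ x)
      = ∑ j : Fin n, freqWeight d j * (P₂ * ∫ y, φ y * gaussKernel (freq n j ^ 2 / 2) (x - y)) := by
    have e2 : ∀ v, gaussKernel (1 / 2) v * ridge φ n v (v ⬝ᵥ x)
        = ∑ j : Fin n, freqWeight d j * (gaussKernel (1 / 2) v *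
          (cosCoeff φ (freq n j) v * Real.cos (freq n j * v ⬝ᵥ x)
            + sinCoeff φ (freq n j) v * Real.sin (freq n j * v ⬝ᵥ x))) := by
      intro v
      unfold ridge trigSum
      rw [mul_sum]
      exact sum_congr rfl fun j _ => by ring
    simp_rw [e2]
    rw [integral_finsetSum _ fun j _ => (hgauss j).const_mul _]
    refine sum_congr rfl fun j _ => ?_
    rw [integral_const_mul, h.integral_gaussKernel_mul_wave (by norm_num)]
    have e3 : Real.pi / (1 / 2) = 2 * Real.pi := by ring
    have e4 : (freq n j : ℝ) ^ 2 / (4 * (1 / 2)) = (freq n j : ℝ) ^ 2 / 2 := by ring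
    rw [e3, e4]
  have e5 : φ x = ∑ _j : Fin n, φ x / n := by
    rw [sum_const, card_univ, Fintype.card_fin, nsmul_eq_mul]
    field_simp
  have e6 : smoothConst d / n = ∑ _j : Fin n, smoothConst d / n ^ 2 := by
    rw [sum_const, card_univ, Fintype.card_fin, nsmul_eq_mul]
    field_simp
  rw [e1, e6]
  have e8 : (∑ j : Fin n, freqWeight d j * (P₂ * ∫ y, φ y * gaussKernel (freq n j ^ 2 / 2) (x - y)))
      - φ x = ∑ j : Fin n, (freqWeight d j *
        (P₂ * ∫ y, φ y * gaussKernel (freq n j ^ 2 / 2) (x - y)) - φ x / n) := by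
    rw [sum_sub_distrib, ← e5]
  rw [e8]
  refine (abs_sum_le_sum_abs _ _).trans (sum_le_sum fun j _ => ?_)
  have hm := le_freq j
  have hm0 : (0 : ℝ) < freq n j := hn'.trans_le hm
  have key := h.abs_gaussian_average_sub_le hm0 x
  set m : ℝ := (freq n j : ℝ) with hm_def
  have e7 : freqWeight d j * (P₂ * ∫ y, φ y * gaussKernel (m ^ 2 / 2) (x - y)) - φ x / n
      = m ^ d / (n * P₂) * ((∫ y, φ y * gaussKernel (m ^ 2 / 2) (x - y)) - φ x * (P₂ / m ^ d)) := by
    rw [freqWeight, ← hP₂, ← hm_def]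
    field_simp
  rw [e7, abs_mul, abs_of_pos (by positivity)]
  calc m ^ d / (n * P₂) * _ ≤ m ^ d / (n * P₂) * (2 / m * (P₄ / m ^ d)) := by gcongr
    _ = 2 * P₄ / P₂ / n / m := by field_simp
    _ ≤ 2 * P₄ / P₂ / n / n := by gcongr
    _ = smoothConst d / n ^ 2 := by
      rw [smoothConst, ← hP₂, ← hP₄]; field_simp

theorem integral_abs_ridgeDeriv_le (φ : (Fin d → ℝ) → ℝ) (n : ℕ) {κ : ℝ} (hκ : 0 < κ)
    (v : Fin d → ℝ) :
    ∫ t in (-(3 * d * ‖v‖))..(3 * d * ‖v‖), |ridgeDeriv φ n v t| ≤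
      3 * d / κ * (‖v‖⁻¹ + 3 * d) + κ * Real.pi * ∑ j : Fin n, (freq n j * freqWeight d j) ^ 2 *
        (v ⬝ᵥ v * (cosCoeff φ (freq n j) v ^ 2 + sinCoeff φ (freq n j) v ^ 2)) := by
  have hvv := norm_sq_le_dotProduct_self v
  have hvv0 : 0 ≤ v ⬝ᵥ v := (sq_nonneg _).trans hvv
  rcases eq_or_ne v 0 with rfl | hv
  · simp only [norm_zero, mul_zero, neg_zero, intervalIntegral.integral_same]
    positivity
  have hv0 : 0 < ‖v‖ := norm_pos_iff.2 hv
  set T : ℝ := 3 * d * ‖v‖ with hT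
  have hT0 : 0 ≤ T := by positivity
  have hP := Nat.lt_floor_add_one T
  have hP' := Nat.floor_le hT0
  have hcast : ((⌊T⌋₊ + 1 : ℕ) : ℝ) = ⌊T⌋₊ + 1 := by push_cast; ring
  set P : ℕ := ⌊T⌋₊ + 1
  have hP0 : (0 : ℝ) < P := by rw [hcast]; positivity
  have hTP : T ≤ P * Real.pi := by
    have := Real.pi_gt_three
    nlinarith
  have hθ : 0 < κ * ‖v‖ ^ 2 / P := by positivity
  refine (integral_abs_trigSum_le (freq_injective n) _ _ hT0 hTP hθ).trans ?_
  refine add_le_add ?_ ?_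
  · calc T / (κ * ‖v‖ ^ 2 / P) = 3 * d / κ * (P / ‖v‖) := by rw [hT]; field_simp
      _ ≤ 3 * d / κ * ((1 + T) / ‖v‖) := by gcongr; linarith
      _ = 3 * d / κ * (‖v‖⁻¹ + 3 * d) := by rw [hT]; field_simp
  · calc _ = κ * Real.pi * ∑ j : Fin n, (freq n j * freqWeight d j) ^ 2 *
        (‖v‖ ^ 2 * (cosCoeff φ (freq n j) v ^ 2 + sinCoeff φ (freq n j) v ^ 2)) := by
          rw [← mul_assoc, mul_sum, mul_sum]
          refine sum_congr rfl fun j _ => ?_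
          field_simp
          ring
      _ ≤ _ := by
        gcongr

theorem exists_integral_majorant_le (hd : 2 ≤ d) : ∃ C : ℝ, 0 < C ∧
    ∀ {φ : (Fin d → ℝ) → ℝ}, IsLipschitzBump φ → ∀ {n : ℕ}, 0 < n → ∃ G : (Fin d → ℝ) → ℝ,
      Integrable G ∧ ∫ v, G v ≤ C * (n : ℝ) ^ (((d : ℝ) - 1) / 2) ∧
      ∀ v, gaussKernel (1 / 2) v *
        ∫ t in (-(3 * d * ‖v‖))..(3 * d * ‖v‖), |ridgeDeriv φ n v t| ≤ G v := by
  have hI := integrable_gaussKernel_mul_inv_norm hd (b := 1 / 2) (by norm_num)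
  have hJ := integrable_gaussKernel (d := d) (b := 1 / 2) (by norm_num)
  set I := ∫ v : Fin d → ℝ, gaussKernel (1 / 2) v * ‖v‖⁻¹
  set J := ∫ v : Fin d → ℝ, gaussKernel (1 / 2) v
  have hI0 : 0 ≤ I := integral_nonneg fun v =>
    mul_nonneg (gaussKernel_pos _ _).le (inv_nonneg.2 (norm_nonneg _))
  have hJ0 : 0 ≤ J := integral_nonneg fun v => (gaussKernel_pos _ _).le
  have hE := energyConst_pos d
  set P₂ := (2 * Real.pi) ^ ((d : ℝ) / 2) with hP₂
  have hP₂0 : 0 < P₂ := by positivity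
  refine ⟨3 * d * (I + 3 * d * J) + Real.pi * (2 ^ d * energyConst d / P₂ ^ 4), by positivity,
    fun {φ} h {n} hn => ?_⟩
  have hn' : (0 : ℝ) < n := by exact_mod_cast hn
  set s : ℝ := (n : ℝ) ^ (((d : ℝ) - 1) / 2) with hs
  have hs0 : 0 < s := by positivity
  have hss : s * s * n = (n : ℝ) ^ d := by
    rw [hs, ← Real.rpow_add hn', ← Real.rpow_add_one hn'.ne', ← Real.rpow_natCast]
    congr 1
    ring
  have hEn := fun j : Fin n => h.integrable_energy (freq n j)
  have h1 : Integrable fun v : Fin d → ℝ => 3 * d / s⁻¹ * (gaussKernel (1 / 2) v * ‖v‖⁻¹) :=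
    hI.const_mul _
  have h2 : Integrable fun v : Fin d → ℝ => 3 * d / s⁻¹ * (3 * d) * gaussKernel (1 / 2) v :=
    hJ.const_mul _
  have h3 : Integrable fun v : Fin d → ℝ => s⁻¹ * Real.pi * ∑ j : Fin n,
      (freq n j * freqWeight d j) ^ 2 * (gaussKernel (1 / 2) v * (v ⬝ᵥ v) *
        (cosCoeff φ (freq n j) v ^ 2 + sinCoeff φ (freq n j) v ^ 2)) :=
    (integrable_finsetSum _ fun j _ => (hEn j).const_mul _).const_mul _
  have h12 : Integrable fun v : Fin d → ℝ => 3 * d / s⁻¹ * (gaussKernel (1 / 2) v * ‖v‖⁻¹)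
      + 3 * d / s⁻¹ * (3 * d) * gaussKernel (1 / 2) v := h1.add h2
  refine ⟨fun v => 3 * d / s⁻¹ * (gaussKernel (1 / 2) v * ‖v‖⁻¹)
      + 3 * d / s⁻¹ * (3 * d) * gaussKernel (1 / 2) v
      + s⁻¹ * Real.pi * ∑ j : Fin n, (freq n j * freqWeight d j) ^ 2 * (gaussKernel (1 / 2) v *
        (v ⬝ᵥ v) * (cosCoeff φ (freq n j) v ^ 2 + sinCoeff φ (freq n j) v ^ 2)),
    h12.add h3, ?_, fun v => ?_⟩
  · rw [integral_add h12 h3, integral_add h1 h2, integral_const_mul, integral_const_mul,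
      integral_const_mul, integral_finsetSum _ fun j _ => (hEn j).const_mul _]
    have hsum : ∑ j : Fin n, ∫ v, (freq n j * freqWeight d j) ^ 2 * (gaussKernel (1 / 2) v *
        (v ⬝ᵥ v) * (cosCoeff φ (freq n j) v ^ 2 + sinCoeff φ (freq n j) v ^ 2))
        ≤ ∑ _j : Fin n, (2 * n) ^ d * energyConst d / (n ^ 2 * P₂ ^ 4) := by
      refine sum_le_sum fun j _ => ?_
      rw [integral_const_mul]
      have hm0 : (0 : ℝ) < freq n j := hn'.trans_le (le_freq j)
      have hm1 := freq_le j
      refine (mul_le_mul_of_nonneg_left (h.integral_energy_le hm0) (sq_nonneg _)).trans ?_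
      calc _ = (freq n j : ℝ) ^ d * energyConst d / (n ^ 2 * P₂ ^ 4) := by
            rw [freqWeight, ← hP₂]
            field_simp
            ring
        _ ≤ _ := by gcongr
    rw [sum_const, card_univ, Fintype.card_fin, nsmul_eq_mul] at hsum
    have e : (n : ℝ) * ((2 * n) ^ d * energyConst d / (n ^ 2 * P₂ ^ 4))
        = s * s * (2 ^ d * energyConst d / P₂ ^ 4) := by
      rw [mul_pow, ← hss]
      field_simp
    rw [e] at hsum
    calc _ ≤ 3 * d / s⁻¹ * I + 3 * d / s⁻¹ * (3 * d) * J
          + s⁻¹ * Real.pi * (s * s * (2 ^ d * energyConst d / P₂ ^ 4)) := by gcongr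
      _ = _ := by field_simp
  · refine (mul_le_mul_of_nonneg_left (integral_abs_ridgeDeriv_le φ n (inv_pos.2 hs0) v)
      (gaussKernel_pos _ _).le).trans_eq ?_
    simp only [mul_add, mul_sum]
    refine congrArg₂ _ (by ring) (sum_congr rfl fun j _ => by ring)

/-- The density of half-spaces representing the Gaussian smoothing of `φ`. -/
noncomputable def halfSpaceDensity (φ : (Fin d → ℝ) → ℝ) (n : ℕ) (p : (Fin d → ℝ) × ℝ) : ℝ :=
  {p : (Fin d → ℝ) × ℝ | -(3 * d * ‖p.1‖) < p.2 ∧ p.2 ≤ 3 * d * ‖p.1‖}.indicator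
    (fun p => gaussKernel (1 / 2) p.1 * ridgeDeriv φ n p.1 p.2) p

theorem halfSpaceDensity_apply (φ : (Fin d → ℝ) → ℝ) (n : ℕ) (v : Fin d → ℝ) (t : ℝ) :
    halfSpaceDensity φ n (v, t) = (Set.Ioc (-(3 * d * ‖v‖)) (3 * d * ‖v‖)).indicator
      (fun t => gaussKernel (1 / 2) v * ridgeDeriv φ n v t) t := rfl

theorem integral_abs_halfSpaceDensity (φ : (Fin d → ℝ) → ℝ) (n : ℕ) (v : Fin d → ℝ) :
    ∫ t, |halfSpaceDensity φ n (v, t)| = gaussKernel (1 / 2) v *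
      ∫ t in (-(3 * d * ‖v‖))..(3 * d * ‖v‖), |ridgeDeriv φ n v t| := by
  have hT : -(3 * d * ‖v‖) ≤ 3 * d * ‖v‖ := by
    have : 0 ≤ 3 * d * ‖v‖ := by positivity
    linarith
  have e : ∀ t, |halfSpaceDensity φ n (v, t)| = (Set.Ioc (-(3 * d * ‖v‖)) (3 * d * ‖v‖)).indicator
      (fun t => gaussKernel (1 / 2) v * |ridgeDeriv φ n v t|) t := fun t => by
    rw [halfSpaceDensity_apply]
    by_cases ht : t ∈ Set.Ioc (-(3 * d * ‖v‖)) (3 * d * ‖v‖)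
    · rw [Set.indicator_of_mem ht, Set.indicator_of_mem ht, abs_mul,
        abs_of_pos (gaussKernel_pos _ _)]
    · rw [Set.indicator_of_notMem ht, Set.indicator_of_notMem ht, abs_zero]
  simp_rw [e]
  rw [integral_indicator measurableSet_Ioc, integral_const_mul,
    intervalIntegral.integral_of_le hT]

theorem integrable_halfSpaceDensity_fiber (φ : (Fin d → ℝ) → ℝ) (n : ℕ) (v : Fin d → ℝ) :
    Integrable fun t => halfSpaceDensity φ n (v, t) := by
  simp_rw [halfSpaceDensity_apply]
  rw [integrable_indicator_iff measurableSet_Ioc]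
  have hc : Continuous fun t => gaussKernel (1 / 2) v * ridgeDeriv φ n v t :=
    continuous_const.mul (continuous_trigSum _ _ _)
  exact (hc.integrableOn_Icc).mono_set Set.Ioc_subset_Icc_self

theorem integrable_halfSpaceDensity (h : IsLipschitzBump φ) (n : ℕ) {G : (Fin d → ℝ) → ℝ}
    (hG : Integrable G) (hle : ∀ v, gaussKernel (1 / 2) v *
      ∫ t in (-(3 * d * ‖v‖))..(3 * d * ‖v‖), |ridgeDeriv φ n v t| ≤ G v) :
    Integrable (halfSpaceDensity φ n) (volume.prod volume) := by
  have hm : AEStronglyMeasurable (halfSpaceDensity φ n) (volume.prod volume) := by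
    have hc : Continuous fun p : (Fin d → ℝ) × ℝ => gaussKernel (1 / 2) p.1 *
        ridgeDeriv φ n p.1 p.2 :=
      ((continuous_gaussKernel _).comp continuous_fst).mul (h.continuous_ridgeDeriv n)
    have h1 : MeasurableSet {p : (Fin d → ℝ) × ℝ | -(3 * d * ‖p.1‖) < p.2} :=
      measurableSet_lt (by fun_prop) (by fun_prop)
    have h2 : MeasurableSet {p : (Fin d → ℝ) × ℝ | p.2 ≤ 3 * d * ‖p.1‖} :=
      measurableSet_le (by fun_prop) (by fun_prop)
    exact (hc.stronglyMeasurable.indicator (h1.inter h2)).aestronglyMeasurable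
  rw [integrable_prod_iff hm]
  refine ⟨Filter.Eventually.of_forall fun v => integrable_halfSpaceDensity_fiber φ n v,
    hG.mono' hm.norm.integral_prod_right' (Filter.Eventually.of_forall fun v => ?_)⟩
  rw [Real.norm_of_nonneg (integral_nonneg fun t => norm_nonneg _)]
  simp_rw [Real.norm_eq_abs]
  rw [integral_abs_halfSpaceDensity]
  exact hle v

theorem integral_halfSpaceDensity_lt (φ : (Fin d → ℝ) → ℝ) (n : ℕ) {x : Fin d → ℝ} (hx : ‖x‖ ≤ 3)
    (v : Fin d → ℝ) :
    ∫ t, {p : (Fin d → ℝ) × ℝ | p.2 < p.1 ⬝ᵥ x}.indicator (halfSpaceDensity φ n) (v, t) =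
      gaussKernel (1 / 2) v * ridge φ n v (v ⬝ᵥ x) -
        gaussKernel (1 / 2) v * ridge φ n v (-(3 * d * ‖v‖)) := by
  have hle : |v ⬝ᵥ x| ≤ 3 * d * ‖v‖ := by
    refine (abs_dotProduct_le v x).trans ?_
    have : 0 ≤ d * ‖v‖ := by positivity
    nlinarith
  obtain ⟨h1, h2⟩ := abs_le.1 hle
  have e : ∀ t, {p : (Fin d → ℝ) × ℝ | p.2 < p.1 ⬝ᵥ x}.indicator (halfSpaceDensity φ n) (v, t) =
      (Set.Ioo (-(3 * d * ‖v‖)) (v ⬝ᵥ x)).indicator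
        (fun t => gaussKernel (1 / 2) v * ridgeDeriv φ n v t) t := fun t => by
    simp only [Set.indicator_apply, halfSpaceDensity_apply, Set.mem_ofPred_eq, Set.mem_Ioc,
      Set.mem_Ioo]
    split_ifs <;> first | rfl | (exfalso; grind)
  simp_rw [e]
  rw [integral_indicator measurableSet_Ioo, integral_const_mul, ← integral_Ioc_eq_integral_Ioo,
    ← intervalIntegral.integral_of_le h1, intervalIntegral.integral_eq_sub_of_hasDerivAt
      (fun t _ => hasDerivAt_ridge φ n v t)
      ((continuous_trigSum _ _ _).intervalIntegrable _ _), mul_sub]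

/-- A Lipschitz bump is approximated by superpositions of half-spaces of small total weight. -/
theorem exists_halfSpaces (hd : 2 ≤ d) : ∃ C : ℝ, 0 < C ∧
    ∀ {φ : (Fin d → ℝ) → ℝ}, IsLipschitzBump φ → ∀ {n : ℕ}, 0 < n → ∃ c₀ : ℝ,
      ∀ X : Finset (Fin d → ℝ), (∀ x ∈ X, ‖x‖ ≤ 3) →
        ∃ (ι : Type) (_ : Fintype ι) (a : ι → ℝ) (w : ι → Fin d → ℝ) (t : ι → ℝ),
          ∑ k, |a k| ≤ C * (n : ℝ) ^ (((d : ℝ) - 1) / 2) ∧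
          ∀ x ∈ X, |φ x - (c₀ + ∑ k, a k * (if t k < w k ⬝ᵥ x then 1 else 0))|
            ≤ smoothConst d / n := by
  obtain ⟨C, hC, H⟩ := exists_integral_majorant_le hd
  refine ⟨C, hC, fun {φ} h {n} hn => ?_⟩
  obtain ⟨G, hG, hGle, hle⟩ := H h hn
  have hΨ := h.integrable_halfSpaceDensity n hG hle
  have hS : ∀ x : Fin d → ℝ, MeasurableSet {p : (Fin d → ℝ) × ℝ | p.2 < p.1 ⬝ᵥ x} := fun x =>
    measurableSet_lt (by fun_prop) (Continuous.measurable (by fun_prop))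
  refine ⟨∫ v, gaussKernel (1 / 2) v * ridge φ n v (-(3 * d * ‖v‖)), fun X hX => ?_⟩
  obtain ⟨ι, hι, a, ω, ha, hω⟩ := exists_atoms hΨ hS X
  refine ⟨ι, hι, a, fun k => (ω k).1, fun k => (ω k).2, ha.trans ?_, fun x hx => ?_⟩
  · rw [integral_prod _ hΨ.abs]
    simp_rw [integral_abs_halfSpaceDensity]
    refine le_trans (integral_mono_of_nonneg (Filter.Eventually.of_forall fun v => ?_) hG
      (Filter.Eventually.of_forall hle)) hGle
    simp only [Pi.zero_apply]
    rw [← integral_abs_halfSpaceDensity]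
    exact integral_nonneg fun t => abs_nonneg _
  · have e1 : ∑ k, a k * (if (ω k).2 < (ω k).1 ⬝ᵥ x then 1 else 0)
        = ∫ z in {p : (Fin d → ℝ) × ℝ | p.2 < p.1 ⬝ᵥ x}, halfSpaceDensity φ n z
          ∂(volume.prod volume) := by
      rw [← hω x hx]
      refine sum_congr rfl fun k _ => ?_
      simp only [Set.indicator_apply, Set.mem_ofPred_eq, Pi.one_apply]
    have i1 : Integrable fun v => gaussKernel (1 / 2) v * ridge φ n v (v ⬝ᵥ x) :=
      h.integrable_gaussKernel_mul_ridge n (by fun_prop)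
    have i2 : Integrable fun v => gaussKernel (1 / 2) v * ridge φ n v (-(3 * d * ‖v‖)) :=
      h.integrable_gaussKernel_mul_ridge n (by fun_prop)
    rw [← integral_indicator (hS x), integral_prod _ (hΨ.indicator (hS x))] at e1
    simp_rw [integral_halfSpaceDensity_lt φ n (hX x hx)] at e1
    rw [integral_sub i1 i2] at e1
    rw [e1, add_sub_cancel, abs_sub_comm]
    exact h.abs_integral_ridge_sub_le hn x

end IsLipschitzBump

namespace IsLipschitzBump

theorem exists_halfSpaces_dim_one {φ : (Fin 1 → ℝ) → ℝ} (h : IsLipschitzBump φ) {n : ℕ}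
    (hn : 0 < n) : ∃ (a : Fin n → ℝ) (w : Fin n → Fin 1 → ℝ) (t : Fin n → ℝ),
      ∑ k, |a k| ≤ 12 ∧ ∀ x, ‖x‖ ≤ 3 →
        |φ x - ∑ k, a k * (if t k < w k ⬝ᵥ x then 1 else 0)| ≤ 12 / n := by
  have hn' : (0 : ℝ) < n := by exact_mod_cast hn
  let s : ℕ → ℝ := fun j => -3 + 6 * j / n
  let a : ℕ → ℝ := fun j => φ (fun _ => s (j + 1)) - φ fun _ => s j
  have ha : ∀ j, |a j| ≤ 12 / n := by
    intro j
    refine (h.abs_sub_le _ _).trans_eq ?_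
    have e : ((fun _ : Fin 1 => s (j + 1)) - fun _ => s j) = fun _ => 6 / (n : ℝ) := by
      ext
      simp only [Pi.sub_apply, s]
      push_cast
      ring
    rw [e, pi_norm_const, Real.norm_of_nonneg (by positivity)]
    ring
  refine ⟨fun k => a k, fun _ _ => 1, fun k => s k, ?_, fun x hx => ?_⟩
  · calc ∑ k : Fin n, |a k| ≤ ∑ _k : Fin n, 12 / (n : ℝ) := sum_le_sum fun k _ => ha k
      _ = 12 := by
        rw [sum_const, card_univ, Fintype.card_fin, nsmul_eq_mul]
        field_simp
  · have hx0 : |x 0| ≤ 3 := (norm_le_pi_norm x 0).trans hx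
    obtain ⟨h1, h2⟩ := abs_le.1 hx0
    set y : ℝ := (x 0 + 3) * n / 6 with hy
    have hy0 : 0 ≤ y := by
      have : 0 ≤ x 0 + 3 := by linarith
      positivity
    have hyn : y ≤ n := by
      rw [hy, div_le_iff₀ (by norm_num)]
      nlinarith
    have hm : ⌈y⌉₊ ≤ n := Nat.ceil_le.2 hyn
    have hlt : ∀ j : ℕ, s j < x 0 ↔ j < ⌈y⌉₊ := by
      intro j
      rw [Nat.lt_ceil, hy, lt_div_iff₀ (by norm_num)]
      have e : s j < x 0 ↔ 6 * j / n < x 0 + 3 := by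
        simp only [s]
        constructor <;> intro h <;> linarith
      rw [e, div_lt_iff₀ hn', mul_comm]
    have hs0 : φ (fun _ => s 0) = 0 := by
      refine h.eq_zero _ ?_
      rw [pi_norm_const]
      simp [s]
    have e1 : ∑ k : Fin n, a k * (if s k < (fun _ => 1 : Fin 1 → ℝ) ⬝ᵥ x then 1 else 0)
        = φ fun _ => s ⌈y⌉₊ := by
      have e2 : (fun _ => 1 : Fin 1 → ℝ) ⬝ᵥ x = x 0 := by simp [dotProduct]
      simp_rw [e2, hlt]
      rw [Fin.sum_univ_eq_sum_range (fun j => a j * if j < ⌈y⌉₊ then 1 else 0)]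
      simp_rw [mul_ite, mul_one, mul_zero]
      rw [← sum_filter]
      have e3 : (range n).filter (fun j => j < ⌈y⌉₊) = range ⌈y⌉₊ := by
        ext j
        simp only [mem_filter, mem_range]
        omega
      rw [e3, sum_range_sub (fun j => φ fun _ => s j), hs0, sub_zero]
    rw [e1]
    refine (h.abs_sub_le _ _).trans ?_
    have e4 : x 0 = -3 + 6 * y / n := by rw [hy]; field_simp; ring
    have e5 : ‖x - fun _ => s ⌈y⌉₊‖ ≤ 6 / n := by
      refine (pi_norm_le_iff_of_nonneg (by positivity)).2 fun i => ?_
      rw [Subsingleton.elim i 0, Pi.sub_apply, e4]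
      have e6 : -3 + 6 * y / n - s ⌈y⌉₊ = 6 / n * (y - ⌈y⌉₊) := by simp only [s]; ring
      have h3 := Nat.le_ceil y
      have h4 := Nat.ceil_lt_add_one hy0
      rw [e6, norm_mul, Real.norm_of_nonneg (by positivity), Real.norm_eq_abs]
      have : |y - ⌈y⌉₊| ≤ 1 := abs_le.2 ⟨by linarith, by linarith⟩
      exact mul_le_of_le_one_right (by positivity) this
    calc 2 * ‖x - fun _ => s ⌈y⌉₊‖ ≤ 2 * (6 / n) := by gcongr
      _ = 12 / n := by ring

/-- `O(n ^ d)` half-spaces approximate a Lipschitz bump within `O(1 / n)` on finite sets. -/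
theorem exists_sparse_approx {d : ℕ} (hd : 1 ≤ d) : ∃ C : ℝ, 0 < C ∧
    ∀ {φ : (Fin d → ℝ) → ℝ}, IsLipschitzBump φ → ∀ {n : ℕ}, 2 * netScale d ≤ n → ∃ K : ℝ,
      ∀ X : Finset (Fin d → ℝ), ↑X ⊆ Metric.closedBall (0 : Fin d → ℝ) 2 →
        ∃ (a : Fin (n ^ d + n ^ d + 1) → ℝ) (w : Fin (n ^ d + n ^ d + 1) → Fin d → ℝ)
          (t : Fin (n ^ d + n ^ d + 1) → ℝ), (∀ k, |a k| ≤ K) ∧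
          ∀ x ∈ X, |φ x - ∑ k, a k * (if t k < w k ⬝ᵥ x then 1 else 0)| ≤ C / n := by
  obtain ⟨C, hC, H⟩ : ∃ C : ℝ, 0 < C ∧
      ∀ {φ : (Fin d → ℝ) → ℝ}, IsLipschitzBump φ → ∀ {n : ℕ}, 0 < n → ∃ c₀ : ℝ,
        ∀ X : Finset (Fin d → ℝ), (∀ x ∈ X, ‖x‖ ≤ 3) →
          ∃ (ι : Type) (_ : Fintype ι) (a : ι → ℝ) (w : ι → Fin d → ℝ) (t : ι → ℝ),
            ∑ k, |a k| ≤ C * (n : ℝ) ^ (((d : ℝ) - 1) / 2) ∧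
            ∀ x ∈ X, |φ x - (c₀ + ∑ k, a k * (if t k < w k ⬝ᵥ x then 1 else 0))| ≤ C / n := by
    rcases hd.eq_or_lt with rfl | hd2
    · refine ⟨12, by norm_num, fun h n hn => ⟨0, fun X hX => ?_⟩⟩
      obtain ⟨a, w, t, ha, hφ⟩ := h.exists_halfSpaces_dim_one hn
      refine ⟨Fin n, inferInstance, a, w, t, by simpa using ha, fun x hx => ?_⟩
      rw [zero_add]
      exact hφ x (hX x hx)
    · obtain ⟨C, hC, H⟩ := exists_halfSpaces hd2
      have hs := smoothConst_pos d
      refine ⟨C + smoothConst d, by positivity, fun h n hn => ?_⟩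
      obtain ⟨c₀, hc₀⟩ := H h hn
      refine ⟨c₀, fun X hX => ?_⟩
      obtain ⟨ι, hι, a, w, t, ha, hφ⟩ := hc₀ X hX
      refine ⟨ι, hι, a, w, t, ha.trans ?_, fun x hx => (hφ x hx).trans ?_⟩
      · gcongr
        linarith
      · gcongr
        linarith
  have hS := sparsifyConst_pos d
  have hA := netScale_pos d
  refine ⟨C + 40 * sparsifyConst d * C, by positivity, fun {φ} h {n} hn => ?_⟩
  have hn' : (0 : ℝ) < n := lt_of_lt_of_le (by positivity) hn
  obtain ⟨c₀, hc₀⟩ := H h (by exact_mod_cast hn' : 0 < n)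
  refine ⟨max |c₀| (C * (n : ℝ) ^ (((d : ℝ) - 1) / 2)), fun X hX => ?_⟩
  obtain ⟨ι, hι, a, w, t, ha, hφ⟩ := hc₀ X fun x hx => by
    have : x ∈ Metric.closedBall (0 : Fin d → ℝ) 2 := hX hx
    rw [mem_closedBall_zero_iff] at this
    linarith
  have hN : 2 * netScale d ^ d ≤ ((n ^ d : ℕ) : ℝ) := by
    push_cast
    calc 2 * netScale d ^ d ≤ 2 ^ d * netScale d ^ d := by
          gcongr
          exact le_self_pow₀ (by norm_num) (by omega)
      _ = (2 * netScale d) ^ d := (mul_pow _ _ _).symm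
      _ ≤ (n : ℝ) ^ d := by gcongr
  obtain ⟨b, v, s, hb, hv⟩ := exists_sparse_halfSpaces hd hN a w t ha X
  refine ⟨Fin.cons c₀ b, Fin.cons 0 v, Fin.cons (-1) s, fun k => ?_, fun x hx => ?_⟩
  · refine Fin.cases ?_ (fun j => ?_) k
    · exact le_max_left _ _
    · exact (hb j).trans (le_max_right _ _)
  · rw [Fin.sum_univ_succ]
    simp only [Fin.cons_zero, Fin.cons_succ, zero_dotProduct]
    rw [if_pos (by norm_num), mul_one]
    have h1 := hφ x hx
    have h2 := hv x hx
    have hd0 : (d : ℝ) ≠ 0 := by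
      have : d ≠ 0 := by omega
      exact_mod_cast this
    have e : 40 * sparsifyConst d * (C * (n : ℝ) ^ (((d : ℝ) - 1) / 2)) *
        ((n ^ d : ℕ) : ℝ) ^ (-(1 / 2 + 1 / (2 * d)) : ℝ) = 40 * sparsifyConst d * C / n := by
      rw [Nat.cast_pow, ← Real.rpow_natCast, ← Real.rpow_mul hn'.le]
      have e1 : (d : ℝ) * -(1 / 2 + 1 / (2 * d)) = -1 - ((d : ℝ) - 1) / 2 := by
        field_simp
        ring
      rw [e1, Real.rpow_sub hn', Real.rpow_neg_one]
      have : (n : ℝ) ^ (((d : ℝ) - 1) / 2) ≠ 0 := by positivity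
      field_simp
    rw [e] at h2
    rw [add_div]
    rw [abs_le] at h1 h2 ⊢
    constructor <;> linarith [h1.1, h1.2, h2.1, h2.2]

end IsLipschitzBump

/-- A Lipschitz function on the cube extends to a Lipschitz bump. -/
theorem exists_isLipschitzBump {d : ℕ} {f : (Fin d → ℝ) → ℝ}
    (hf : ∀ x ∈ Set.Icc (0 : Fin d → ℝ) 1, f x ∈ Set.Icc (0 : ℝ) 1)
    (hL : ∀ x ∈ Set.Icc (0 : Fin d → ℝ) 1, ∀ y ∈ Set.Icc (0 : Fin d → ℝ) 1,
      |f x - f y| ≤ ‖x - y‖) :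
    ∃ φ : (Fin d → ℝ) → ℝ, IsLipschitzBump φ ∧ ∀ x ∈ Set.Icc (0 : Fin d → ℝ) 1, φ x = f x := by
  let p : (Fin d → ℝ) → Fin d → ℝ := fun x i => max 0 (min 1 (x i))
  have hp : ∀ x, p x ∈ Set.Icc (0 : Fin d → ℝ) 1 := fun x =>
    ⟨fun i => le_max_left _ _, fun i => max_le zero_le_one (min_le_left _ _)⟩
  have clamp : ∀ s t : ℝ, |max 0 (min 1 s) - max 0 (min 1 t)| ≤ |s - t| := fun s t =>
    (abs_max_sub_max_le_max _ _ _ _).trans (max_le (by simp)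
      ((abs_min_sub_min_le_max _ _ _ _).trans (max_le (by simp) le_rfl)))
  have hpL : ∀ x y, ‖p x - p y‖ ≤ ‖x - y‖ := fun x y =>
    (pi_norm_le_iff_of_nonneg (norm_nonneg _)).2 fun i =>
      (clamp (x i) (y i)).trans (norm_le_pi_norm (x - y) i)
  let χ : (Fin d → ℝ) → ℝ := fun x => max 0 (min 1 (3 - ‖x‖))
  have hχ0 : ∀ x, 0 ≤ χ x := fun x => le_max_left _ _
  have hχ1 : ∀ x, χ x ≤ 1 := fun x => max_le zero_le_one (min_le_left _ _)
  have hχL : ∀ x y, |χ x - χ y| ≤ ‖x - y‖ := fun x y => by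
    refine (clamp _ _).trans ?_
    rw [sub_sub_sub_cancel_left, norm_sub_rev]
    exact abs_norm_sub_norm_le y x
  have hF := fun x => hf (p x) (hp x)
  refine ⟨fun x => f (p x) * χ x, ⟨fun x y => ?_, fun x => ?_, fun x hx => ?_⟩, fun x hx => ?_⟩
  · have h1 := (hL _ (hp x) _ (hp y)).trans (hpL x y)
    have e : f (p x) * χ x - f (p y) * χ y
        = f (p x) * (χ x - χ y) + (f (p x) - f (p y)) * χ y := by ring
    simp only [e]
    refine (abs_add_le _ _).trans ?_
    rw [abs_mul, abs_mul, abs_of_nonneg (hF x).1, abs_of_nonneg (hχ0 y), two_mul]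
    exact add_le_add ((mul_le_of_le_one_left (abs_nonneg _) (hF x).2).trans (hχL x y))
      ((mul_le_of_le_one_right (abs_nonneg _) (hχ1 y)).trans h1)
  · rw [abs_of_nonneg (mul_nonneg (hF x).1 (hχ0 x))]
    exact mul_le_one₀ (hF x).2 (hχ0 x) (hχ1 x)
  · have : χ x = 0 := max_eq_left ((min_le_right _ _).trans (by linarith))
    simp only [this, mul_zero]
  · have e1 : p x = x := by
      ext i
      have h0 : 0 ≤ x i := hx.1 i
      have h1 : x i ≤ 1 := hx.2 i
      simp only [p]
      rw [min_eq_right h1, max_eq_right h0]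
    have hx1 : ‖x‖ ≤ 1 := (pi_norm_le_iff_of_nonneg zero_le_one).2 fun i => by
      rw [Real.norm_of_nonneg (hx.1 i)]
      exact hx.2 i
    have e2 : χ x = 1 := by
      simp only [χ]
      rw [min_eq_left (by linarith), max_eq_right zero_le_one]
    simp only [e1, e2, mul_one]

/-- **Shallow ReLU approximation of Lipschitz functions on the cube.**
For every `d ≥ 1` there is `c(d) > 0` such that every `f : [0,1]^d → [0,1]` that is
`1`-Lipschitz w.r.t. the sup norm can, for every `ε ∈ (0,1)`, be approximated uniformly to
within `ε` by a shallow ReLU network with `N ≤ c(d) · ε^{-d}` units. -/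
theorem shallow_relu_approx (d : ℕ) (hd : 1 ≤ d) :
    ∃ c : ℝ, 0 < c ∧
      ∀ f : (Fin d → ℝ) → ℝ,
        (∀ x ∈ Set.Icc (0 : Fin d → ℝ) 1, f x ∈ Set.Icc (0 : ℝ) 1) →
        (∀ x ∈ Set.Icc (0 : Fin d → ℝ) 1, ∀ y ∈ Set.Icc (0 : Fin d → ℝ) 1,
          |f x - f y| ≤ ‖x - y‖) →
        ∀ ε ∈ Set.Ioo (0 : ℝ) 1,
          ∃ (N : ℕ) (a b : Fin N → ℝ) (w : Fin N → Fin d → ℝ),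
            (N : ℝ) ≤ c * ε ^ (-(d : ℤ)) ∧
            ∀ x ∈ Set.Icc (0 : Fin d → ℝ) 1,
              |f x - ∑ k : Fin N, a k * max 0 ((∑ i, w k i * x i) + b k)| < ε := by
  obtain ⟨C, hC, H⟩ := IsLipschitzBump.exists_sparse_approx hd
  have hA := netScale_pos d
  refine ⟨6 * (2 * C + 2 * netScale d + 2) ^ d, by positivity, fun f hf hL ε hε => ?_⟩
  obtain ⟨hε0, hε1⟩ := hε
  obtain ⟨φ, hφ, hφf⟩ := exists_isLipschitzBump hf hL
  set r : ℝ := 2 * C / ε + 2 * netScale d + 1 with hr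
  have hr1 : 1 ≤ r := by
    have : 0 ≤ 2 * C / ε := by positivity
    linarith
  set n : ℕ := ⌈r⌉₊ with hn_def
  have hrn : r ≤ n := Nat.le_ceil r
  have hnr : (n : ℝ) < r + 1 := Nat.ceil_lt_add_one (by linarith)
  have hn1 : (1 : ℝ) ≤ n := hr1.trans hrn
  have hn0 : (0 : ℝ) < n := by linarith
  have hCn : 2 * C / n < ε := by
    rw [div_lt_comm₀ hn0 hε0]
    linarith
  obtain ⟨K, hK⟩ := H hφ (n := n) (by
    have : 0 ≤ 2 * C / ε := by positivity
    linarith)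
  obtain ⟨a, q, hq, hlim⟩ := exists_limit_halfSpaces hK
  obtain ⟨a', b', w', happ⟩ := exists_relu_of_limit_halfSpaces two_pos hφ.abs_sub_le
    (δ := C / n) (by positivity) a q hq hlim
  refine ⟨_, a', b', w', ?_, fun x hx => ?_⟩
  · have hnε : (n : ℝ) ≤ (2 * C + 2 * netScale d + 2) / ε := by
      rw [add_div, add_div]
      have h1 : 2 * netScale d ≤ 2 * netScale d / ε := le_div_self (by positivity) hε0 hε1.le
      have h2 : 2 ≤ 2 / ε := le_div_self (by positivity) hε0 hε1.le
      linarith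
    have hnd : (1 : ℝ) ≤ (n : ℝ) ^ d := one_le_pow₀ hn1
    rw [zpow_neg, zpow_natCast]
    push_cast
    calc (n : ℝ) ^ d + n ^ d + 1 + (n ^ d + n ^ d + 1) ≤ 6 * (n : ℝ) ^ d := by linarith
      _ ≤ 6 * ((2 * C + 2 * netScale d + 2) / ε) ^ d := by gcongr
      _ = 6 * (2 * C + 2 * netScale d + 2) ^ d * (ε ^ d)⁻¹ := by rw [div_pow]; ring
  · have hx1 : x ∈ Metric.closedBall (0 : Fin d → ℝ) 1 := by
      refine mem_closedBall_zero_iff.2 ((pi_norm_le_iff_of_nonneg zero_le_one).2 fun i => ?_)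
      rw [Real.norm_of_nonneg (hx.1 i)]
      exact hx.2 i
    have h1 := happ x hx1
    rw [hφf x hx] at h1
    refine h1.trans_lt (lt_of_eq_of_lt ?_ hCn)
    ring
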